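/- arXiv:1503.06563 — 3 statements merged into one kernel-verified Lean document; each statement's English description precedes it below -/
import Mathlib

section
/- Let X be a centered Gaussian vector on ℝ^n with covariance matrix Γ = B Bᵀ for an invertible matrix B, with almost surely unique argmax I, and let Y be an independent copy of X. For t ≥ 0 set X^t = e^{−t}X + √(1 − e^{−2t}) Y, with maximum M_n^t and argmax I^t; let M_n and I be the maximum and argmax of X. Then for every θ ∈ ℝ, every t ≥ 0, and every subset D ⊆ {1,…,n}, with p = 1 + e^{−t}, E[e^{θ(M_n + M_n^t)/2} 1_{{I ∈ D}} 1_{{I^t ∈ D}}] ≤ P(I ∈ D)^{(2−p)/p} · E[e^{θ M_n} 1_{{I ∈ D}}]. -/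
open MeasureTheory ProbabilityTheory Real

section HCHelpers

lemma hc_aux0 {r x : ℝ} (hr : r ≤ 0) (hx0 : 0 ≤ x) (hx1 : x < 1) :
    2 ≤ (1 + x) ^ r + (1 - x) ^ r := by
  have hu : 0 < (1 + x) ^ r := Real.rpow_pos_of_pos (by linarith) _
  have hv : 0 < (1 - x) ^ r := Real.rpow_pos_of_pos (by linarith) _
  have h1 : 1 ≤ (1 + x) ^ r * (1 - x) ^ r := by
    rw [← Real.mul_rpow (by linarith) (by linarith)]
    apply Real.one_le_rpow_of_pos_of_le_one_of_nonpos _ _ hr <;> nlinarith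
  nlinarith [sq_nonneg ((1 + x) ^ r - (1 - x) ^ r)]

lemma hc_aux1 {q : ℝ} (hq0 : 0 ≤ q) (hq1 : q ≤ 1) {x : ℝ} (hx0 : 0 ≤ x) (hx1 : x < 1) :
    2 * q * x ≤ (1 + x) ^ q - (1 - x) ^ q := by
  have hmono : MonotoneOn (fun x : ℝ => (1 + x) ^ q - (1 - x) ^ q - 2 * q * x) (Set.Ico 0 1) := by
    have hd : ∀ y ∈ Set.Ico (0:ℝ) 1, HasDerivAt
        (fun x : ℝ => (1 + x) ^ q - (1 - x) ^ q - 2 * q * x)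
        (q * ((1 + y) ^ (q-1) + (1 - y) ^ (q-1) - 2)) y := by
      intro y hy
      have h1 := ((hasDerivAt_id y).const_add 1).rpow_const (p := q) (Or.inl (by simp; linarith [hy.1]))
      have h2 := ((hasDerivAt_id y).const_sub 1).rpow_const (p := q) (Or.inl (by simp; linarith [hy.2]))
      have h3 := (hasDerivAt_id y).const_mul (2 * q)
      convert! (h1.sub h2).sub h3 using 1
      simp; ring
    apply monotoneOn_of_deriv_nonneg (convex_Ico 0 1)
    · exact fun y hy => (hd y hy).continuousAt.continuousWithinAt
    · intro y hy
      rw [interior_Ico] at hy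
      exact (hd y ⟨hy.1.le, hy.2⟩).differentiableAt.differentiableWithinAt
    · intro y hy
      rw [interior_Ico] at hy
      rw [(hd y ⟨hy.1.le, hy.2⟩).deriv]
      have := hc_aux0 (r := q - 1) (by linarith) hy.1.le hy.2
      exact mul_nonneg hq0 (by linarith)
  have := hmono (a := 0) (b := x) ⟨le_refl _, by norm_num⟩ ⟨hx0, hx1⟩ hx0
  simp at this
  linarith

lemma hc_aux2 {p : ℝ} (hp1 : 1 ≤ p) (hp2 : p ≤ 2) {x : ℝ} (hx0 : 0 ≤ x) (hx1 : x ≤ 1) :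
    1 + p * (p - 1) / 2 * x ^ 2 ≤ ((1 + x) ^ p + (1 - x) ^ p) / 2 := by
  have hmono : MonotoneOn (fun x : ℝ => (1 + x) ^ p + (1 - x) ^ p - p * (p - 1) * x ^ 2)
      (Set.Icc 0 1) := by
    have hd : ∀ y : ℝ, HasDerivAt
        (fun x : ℝ => (1 + x) ^ p + (1 - x) ^ p - p * (p - 1) * x ^ 2)
        (p * ((1 + y) ^ (p-1) - (1 - y) ^ (p-1) - 2 * (p - 1) * y)) y := by
      intro y
      have h1 := ((hasDerivAt_id y).const_add 1).rpow_const (p := p) (Or.inr hp1)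
      have h2 := ((hasDerivAt_id y).const_sub 1).rpow_const (p := p) (Or.inr hp1)
      have h3 := ((hasDerivAt_id y).pow 2).const_mul (p * (p - 1))
      convert! (h1.add h2).sub h3 using 1
      simp; ring
    apply monotoneOn_of_deriv_nonneg (convex_Icc 0 1)
    · exact fun y hy => (hd y).continuousAt.continuousWithinAt
    · intro y hy
      exact (hd y).differentiableAt.differentiableWithinAt
    · intro y hy
      rw [interior_Icc] at hy
      rw [(hd y).deriv]
      have := hc_aux1 (q := p - 1) (by linarith) (by linarith) hy.1.le hy.2
      exact mul_nonneg (by linarith) (by linarith)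
  have := hmono (a := 0) (b := x) ⟨le_refl _, by norm_num⟩ ⟨hx0, hx1⟩ hx0
  simp at this
  linarith

lemma hc_aux3 {p : ℝ} (hp1 : 1 ≤ p) (hp2 : p ≤ 2) {s x : ℝ} (hx0 : 0 ≤ x) (hx1 : x ≤ s) :
    s ^ 2 + (p - 1) * x ^ 2 ≤ ((((s + x) ^ p + (s - x) ^ p) / 2) ^ (1 / p)) ^ 2 := by
  rcases eq_or_lt_of_le (hx0.trans hx1) with hs | hs
  · have : x = 0 := by linarith
    subst this; subst hs; simp
    positivity
  obtain ⟨y, rfl⟩ : ∃ y, x = s * y := ⟨x / s, by field_simp⟩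
  have hy0 : 0 ≤ y := by
    by_contra h; push Not at h; nlinarith
  have hy1 : y ≤ 1 := by
    by_contra h; push Not at h; nlinarith
  have e1 : (s + s * y) ^ p = s ^ p * (1 + y) ^ p := by
    rw [← Real.mul_rpow hs.le (by linarith)]; ring_nf
  have e2 : (s - s * y) ^ p = s ^ p * (1 - y) ^ p := by
    rw [← Real.mul_rpow hs.le (by linarith)]; ring_nf
  have h2 := hc_aux2 hp1 hp2 hy0 hy1
  have hA : 0 ≤ ((1 + y) ^ p + (1 - y) ^ p) / 2 := by
    have := Real.rpow_nonneg (show 0 ≤ 1 + y by linarith) p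
    have := Real.rpow_nonneg (show 0 ≤ 1 - y by linarith) p
    linarith
  have e3 : ((s + s * y) ^ p + (s - s * y) ^ p) / 2
      = s ^ p * (((1 + y) ^ p + (1 - y) ^ p) / 2) := by rw [e1, e2]; ring
  rw [e3, Real.mul_rpow (by positivity) hA, ← Real.rpow_mul hs.le, mul_one_div_cancel (by linarith),
    Real.rpow_one, mul_pow]
  have hbase : 0 ≤ (p - 1) * y ^ 2 := mul_nonneg (by linarith) (sq_nonneg _)
  have h3 : (1 + (p - 1) * y ^ 2) ^ (p / 2) ≤ 1 + p / 2 * ((p - 1) * y ^ 2) :=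
    rpow_one_add_le_one_add_mul_self (by linarith) (by linarith) (by linarith)
  have h4 : (1 + (p - 1) * y ^ 2) ≤ ((((1 + y) ^ p + (1 - y) ^ p) / 2) ^ (1 / p)) ^ 2 := by
    rw [← Real.rpow_natCast (_ ^ (1 / p)), ← Real.rpow_mul hA]
    have h5 : (1 + (p - 1) * y ^ 2) ^ (p / 2) ≤ ((1 + y) ^ p + (1 - y) ^ p) / 2 := by linarith
    have h6 := Real.rpow_le_rpow (by positivity) h5 (show 0 ≤ 2 / p by positivity)
    rw [← Real.rpow_mul (by positivity), show p / 2 * (2 / p) = 1 by field_simp, Real.rpow_one] at h6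
    convert h6 using 2
    push_cast; ring
  nlinarith [mul_le_mul_of_nonneg_left h4 (sq_nonneg s)]

lemma hc_aux4 {p : ℝ} (hp1 : 1 ≤ p) (hp2 : p ≤ 2) {a b : ℝ} (ha : 0 ≤ a) (hb : 0 ≤ b) :
    ((a + b) / 2) ^ 2 + (p - 1) * ((a - b) / 2) ^ 2 ≤ (((a ^ p + b ^ p) / 2) ^ (1 / p)) ^ 2 := by
  rcases le_total b a with h | h
  · have := hc_aux3 hp1 hp2 (s := (a + b) / 2) (x := (a - b) / 2) (by linarith) (by linarith)
    convert this using 5 <;> ring_nf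
  · have := hc_aux3 hp1 hp2 (s := (a + b) / 2) (x := (b - a) / 2) (by linarith) (by linarith)
    rw [show (a + b) / 2 + (b - a) / 2 = b by ring, show (a + b) / 2 - (b - a) / 2 = a by ring,
      add_comm (b ^ p)] at this
    convert this using 2
    ring

lemma hc_twopoint {p : ℝ} (hp1 : 1 ≤ p) (hp2 : p ≤ 2) {a b c d : ℝ}
    (ha : 0 ≤ a) (hb : 0 ≤ b) (hc : 0 ≤ c) (hd : 0 ≤ d) :
    p / 4 * (a * c + b * d) + (2 - p) / 4 * (a * d + b * c) ≤
      ((a ^ p + b ^ p) / 2) ^ (1 / p) * ((c ^ p + d ^ p) / 2) ^ (1 / p) := by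
  have h1 := hc_aux4 hp1 hp2 ha hb
  have h2 := hc_aux4 hp1 hp2 hc hd
  set u := ((a ^ p + b ^ p) / 2) ^ (1 / p)
  set v := ((c ^ p + d ^ p) / 2) ^ (1 / p)
  have hu : 0 ≤ u := by positivity
  have hv : 0 ≤ v := by positivity
  have h0 : p / 4 * (a * c + b * d) + (2 - p) / 4 * (a * d + b * c)
     = (a + b) / 2 * ((c + d) / 2) + (p - 1) * ((a - b) / 2) * ((c - d) / 2) := by ring
  rw [h0]
  generalize (a + b) / 2 = s at *
  generalize (a - b) / 2 = x at *
  generalize (c + d) / 2 = s' at *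
  generalize (c - d) / 2 = x' at *
  apply le_of_sq_le_sq _ (by positivity)
  have hq : 0 ≤ p - 1 := by linarith
  calc (s * s' + (p - 1) * x * x') ^ 2 
      ≤ (s ^ 2 + (p - 1) * x ^ 2) * (s' ^ 2 + (p - 1) * x' ^ 2) := by
        nlinarith [mul_nonneg hq (sq_nonneg (s * x' - s' * x))]
    _ ≤ u ^ 2 * v ^ 2 := mul_le_mul h1 h2 (by positivity) (by positivity)
    _ = _ := by ring

open scoped ENNReal NNReal

lemma hc_twopoint_ennreal {p : ℝ} (hp1 : 1 ≤ p) (hp2 : p ≤ 2) (a b c d : ℝ≥0∞) :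
    ENNReal.ofReal (p / 4) * (a * c + b * d) + ENNReal.ofReal ((2 - p) / 4) * (a * d + b * c) ≤
      (ENNReal.ofReal (1 / 2) * (a ^ p + b ^ p)) ^ (1 / p) *
      (ENNReal.ofReal (1 / 2) * (c ^ p + d ^ p)) ^ (1 / p) := by
  have hp0 : 0 < p := by linarith
  have key0 : ∀ x y : ℝ≥0∞, (ENNReal.ofReal (1 / 2) * (x ^ p + y ^ p)) ^ (1 / p) = 0 →
      x = 0 ∧ y = 0 := by
    intro x y h
    simpa [ENNReal.rpow_eq_zero_iff, hp0, hp0.not_gt] using h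
  have keyT : ∀ x y : ℝ≥0∞, (x = ∞ ∨ y = ∞) →
      (ENNReal.ofReal (1 / 2) * (x ^ p + y ^ p)) ^ (1 / p) = ∞ := by
    intro x y h
    rcases h with rfl | rfl <;>
    · simp only [ENNReal.top_rpow_of_pos hp0, top_add, add_top]
      rw [ENNReal.mul_top (by simp), ENNReal.top_rpow_of_pos (by positivity)]
  by_cases h1 : c = 0 ∧ d = 0
  · obtain ⟨rfl, rfl⟩ := h1; simp
  by_cases h2 : a = 0 ∧ b = 0
  · obtain ⟨rfl, rfl⟩ := h2; simp
  by_cases h3 : a = ∞ ∨ b = ∞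
  · rw [keyT a b h3, ENNReal.top_mul (fun h => h1 (key0 c d h))]; exact le_top
  by_cases h4 : c = ∞ ∨ d = ∞
  · rw [keyT c d h4, ENNReal.mul_top (fun h => h2 (key0 a b h))]; exact le_top
  push Not at h3 h4
  obtain ⟨a', ha, rfl⟩ : ∃ a' : ℝ, 0 ≤ a' ∧ a = ENNReal.ofReal a' :=
    ⟨a.toReal, ENNReal.toReal_nonneg, (ENNReal.ofReal_toReal h3.1).symm⟩
  obtain ⟨b', hb, rfl⟩ : ∃ a' : ℝ, 0 ≤ a' ∧ b = ENNReal.ofReal a' :=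
    ⟨b.toReal, ENNReal.toReal_nonneg, (ENNReal.ofReal_toReal h3.2).symm⟩
  obtain ⟨c', hc, rfl⟩ : ∃ a' : ℝ, 0 ≤ a' ∧ c = ENNReal.ofReal a' :=
    ⟨c.toReal, ENNReal.toReal_nonneg, (ENNReal.ofReal_toReal h4.1).symm⟩
  obtain ⟨d', hd, rfl⟩ : ∃ a' : ℝ, 0 ≤ a' ∧ d = ENNReal.ofReal a' :=
    ⟨d.toReal, ENNReal.toReal_nonneg, (ENNReal.ofReal_toReal h4.2).symm⟩
  have hN : ∀ x y : ℝ, 0 ≤ x → 0 ≤ y →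
      (ENNReal.ofReal (1 / 2) * (ENNReal.ofReal x ^ p + ENNReal.ofReal y ^ p)) ^ (1 / p)
      = ENNReal.ofReal (((x ^ p + y ^ p) / 2) ^ (1 / p)) := by
    intro x y hx hy
    rw [ENNReal.ofReal_rpow_of_nonneg hx hp0.le, ENNReal.ofReal_rpow_of_nonneg hy hp0.le,
      ← ENNReal.ofReal_add (by positivity) (by positivity),
      ← ENNReal.ofReal_mul (by positivity), ENNReal.ofReal_rpow_of_nonneg (by positivity)
      (by positivity)]
    congr 2; ring
  rw [hN _ _ ha hb, hN _ _ hc hd]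
  have h2p : 0 ≤ (2 - p) / 4 := by linarith
  rw [← ENNReal.ofReal_mul ha, ← ENNReal.ofReal_mul ha, ← ENNReal.ofReal_mul hb,
    ← ENNReal.ofReal_mul hb, ← ENNReal.ofReal_add (by positivity) (by positivity),
    ← ENNReal.ofReal_add (by positivity) (by positivity), ← ENNReal.ofReal_mul (by positivity),
    ← ENNReal.ofReal_mul (by positivity), ← ENNReal.ofReal_add (by positivity) (by positivity),
    ← ENNReal.ofReal_mul (by positivity)]
  exact ENNReal.ofReal_le_ofReal (hc_twopoint hp1 hp2 ha hb hc hd)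

/-- Hypercontractive pair. -/
def HC {F E : Type*} [MeasurableSpace F] [MeasurableSpace E] (p : ℝ) (a b : F → E)
    (m : Measure F) : Prop :=
  ∀ f g : E → ℝ≥0∞, Measurable f → Measurable g →
    ∫⁻ z, f (a z) * g (b z) ∂m ≤
      (∫⁻ z, f (a z) ^ p ∂m) ^ (1 / p) * (∫⁻ z, g (b z) ^ p ∂m) ^ (1 / p)

/-- The two-point coupling. -/
noncomputable def tpM {F : Type*} [MeasurableSpace F] [Neg F] (p : ℝ) (z w : F) : Measure F :=
  ENNReal.ofReal (p / 4) • (Measure.dirac z + Measure.dirac (-z)) +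
    ENNReal.ofReal ((2 - p) / 4) • (Measure.dirac w + Measure.dirac (-w))

lemma tpM_prob {F : Type*} [MeasurableSpace F] [Neg F] {p : ℝ} (hp1 : 1 ≤ p) (hp2 : p ≤ 2)
    (z w : F) : IsProbabilityMeasure (tpM p z w) := by
  constructor
  have h2p : 0 ≤ (2 - p) / 4 := by linarith
  simp only [tpM, Measure.add_apply, Measure.smul_apply, measure_univ, smul_eq_mul]
  rw [← ENNReal.ofReal_one, ← ENNReal.ofReal_add (by positivity) (by positivity),
    ← ENNReal.ofReal_mul (by positivity), ← ENNReal.ofReal_mul (by positivity),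
    ← ENNReal.ofReal_add (by positivity) (by positivity)]
  congr 1; ring

lemma HC_tpM {F E : Type*} [MeasurableSpace F] [AddCommGroup F] [MeasurableSpace E]
    [AddCommGroup E] {p : ℝ}
    (hp1 : 1 ≤ p) (hp2 : p ≤ 2) (a b : F →+ E) (ha : Measurable a) (hb : Measurable b)
    (z w : F) (c : E) (h1 : a z = c) (h2 : b z = c) (h3 : a w = c) (h4 : b w = -c) :
    HC p a b (tpM p z w) := by
  intro f g hf hg
  have h2p : 0 ≤ (2 - p) / 4 := by linarith
  have hf' := hf.comp ha
  have hg' := hg.comp hb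
  simp only [tpM, lintegral_add_measure, lintegral_smul_measure]
  rw [lintegral_dirac' z (by fun_prop), lintegral_dirac' (-z) (by fun_prop),
    lintegral_dirac' w (by fun_prop), lintegral_dirac' (-w) (by fun_prop),
    lintegral_dirac' z (by fun_prop), lintegral_dirac' (-z) (by fun_prop),
    lintegral_dirac' w (by fun_prop), lintegral_dirac' (-w) (by fun_prop),
    lintegral_dirac' z (by fun_prop), lintegral_dirac' (-z) (by fun_prop),
    lintegral_dirac' w (by fun_prop), lintegral_dirac' (-w) (by fun_prop)]
  simp only [map_neg, h1, h2, h3, h4, neg_neg, smul_eq_mul]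
  convert hc_twopoint_ennreal hp1 hp2 (f c) (f (-c)) (g c) (g (-c)) using 3
  · rw [← add_mul, ← ENNReal.ofReal_add (by positivity) (by positivity)]
    congr 2; ring
  · rw [add_comm (g (-c) ^ p), ← add_mul, ← ENNReal.ofReal_add (by positivity) (by positivity)]
    congr 2; ring

lemma HC.map {F E E' F' : Type*} [MeasurableSpace F] [MeasurableSpace E]
    [MeasurableSpace E'] [MeasurableSpace F'] {p : ℝ} {a b : F → E} {a' b' : F' → E'}
    (ha' : Measurable a') (hb' : Measurable b') {m : Measure F} (h : HC p a b m)
    (φ : F → F') (hφ : Measurable φ) (ψ : E → E') (hψ : Measurable ψ)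
    (h1 : ∀ z, a' (φ z) = ψ (a z)) (h2 : ∀ z, b' (φ z) = ψ (b z)) :
    HC p a' b' (m.map φ) := by
  intro f g hf hg
  have hf' := hf.comp ha'
  have hg' := hg.comp hb'
  rw [lintegral_map (by fun_prop) hφ, lintegral_map (by fun_prop) hφ,
    lintegral_map (by fun_prop) hφ]
  simp only [h1, h2]
  exact h (fun x => f (ψ x)) (fun x => g (ψ x)) (hf.comp hψ) (hg.comp hψ)

lemma HC.conv {F E : Type*} [MeasurableSpace F] [AddCommGroup F] [MeasurableAdd₂ F]
    [MeasurableSpace E] [AddCommGroup E] [MeasurableAdd₂ E] {p : ℝ} (hp : 0 < p)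
    {a b : F →+ E} (ha : Measurable a) (hb : Measurable b) {m m' : Measure F}
    [SFinite m] [SFinite m']
    (h : HC p a b m) (h' : HC p a b m') : HC p a b (m.conv m') := by
  intro f g hf hg
  rw [Measure.lintegral_conv (by fun_prop), Measure.lintegral_conv (by fun_prop),
    Measure.lintegral_conv (by fun_prop)]
  simp only [map_add]
  let A : E → ℝ≥0∞ := fun x => (∫⁻ y, f (x + a y) ^ p ∂m') ^ (1 / p)
  let C : E → ℝ≥0∞ := fun x => (∫⁻ y, g (x + b y) ^ p ∂m') ^ (1 / p)
  have hA : Measurable A := by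
    refine Measurable.pow_const (Measurable.lintegral_prod_right' (f := fun q : E × F => f (q.1 + a q.2) ^ p) ?_) _
    fun_prop
  have hC : Measurable C := by
    refine Measurable.pow_const (Measurable.lintegral_prod_right' (f := fun q : E × F => g (q.1 + b q.2) ^ p) ?_) _
    fun_prop
  calc ∫⁻ x, ∫⁻ y, f (a x + a y) * g (b x + b y) ∂m' ∂m
      ≤ ∫⁻ x, A (a x) * C (b x) ∂m := by
        refine lintegral_mono fun x => ?_
        exact h' (fun y => f (a x + y)) (fun y => g (b x + y)) (by fun_prop) (by fun_prop)
    _ ≤ _ := h A C hA hC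
    _ = _ := by
      have e : ∀ x : ℝ≥0∞, (x ^ (1 / p)) ^ p = x := by
        intro x; rw [← ENNReal.rpow_mul, one_div_mul_cancel hp.ne', ENNReal.rpow_one]
      simp only [A, C, e]

open Filter Topology BoundedContinuousFunction

lemma tendsto_lintegral_hc {F : Type*} [MeasurableSpace F] [TopologicalSpace F]
    [OpensMeasurableSpace F] {μs : ℕ → ProbabilityMeasure F} {μ : ProbabilityMeasure F}
    (h : Tendsto μs atTop (𝓝 μ)) (f : F → ℝ≥0) (hf : Continuous f) (M : ℝ≥0)
    (hM : ∀ z, f z ≤ M) :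
    Tendsto (fun N => ∫⁻ z, f z ∂(μs N : Measure F)) atTop (𝓝 (∫⁻ z, f z ∂(μ : Measure F))) := by
  have hb : ∃ C, ∀ x y, dist (f x) (f y) ≤ C := by
    refine ⟨M, fun x y => ?_⟩
    rw [NNReal.dist_eq, abs_le]
    have h1 : (f x : ℝ) ≤ M := by exact_mod_cast hM x
    have h2 : (f y : ℝ) ≤ M := by exact_mod_cast hM y
    have h3 := (f x).2
    have h4 := (f y).2
    constructor <;> linarith
  exact ProbabilityMeasure.tendsto_iff_forall_lintegral_tendsto.1 h
    ⟨⟨f, hf⟩, hb⟩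

lemma HC_limit_bcf {F E : Type*} [MeasurableSpace F] [TopologicalSpace F]
    [OpensMeasurableSpace F] [TopologicalSpace E] [MeasurableSpace E] [BorelSpace E]
    {p : ℝ} (hp : 0 < p) {a b : F → E} (ha : Continuous a) (hb : Continuous b)
    {μs : ℕ → ProbabilityMeasure F} {μ : ProbabilityMeasure F}
    (h : Tendsto μs atTop (𝓝 μ)) (hHC : ∀ N, HC p a b (μs N : Measure F))
    (f g : E →ᵇ ℝ) :
    ∫⁻ z, ‖f (a z)‖ₑ * ‖g (b z)‖ₑ ∂(μ : Measure F) ≤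
      (∫⁻ z, ‖f (a z)‖ₑ ^ p ∂(μ : Measure F)) ^ (1 / p) *
      (∫⁻ z, ‖g (b z)‖ₑ ^ p ∂(μ : Measure F)) ^ (1 / p) := by
  have t1 := tendsto_lintegral_hc h (fun z => ‖f (a z)‖₊ * ‖g (b z)‖₊) (by fun_prop)
    (‖f‖₊ * ‖g‖₊) (fun z => mul_le_mul' (f.norm_coe_le_norm _) (g.norm_coe_le_norm _))
  have t2 := tendsto_lintegral_hc h (fun z => ‖f (a z)‖₊ ^ p)
    ((NNReal.continuous_rpow_const hp.le).comp (by fun_prop))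
    (‖f‖₊ ^ p) (fun z => NNReal.rpow_le_rpow (f.norm_coe_le_norm _) hp.le)
  have t3 := tendsto_lintegral_hc h (fun z => ‖g (b z)‖₊ ^ p)
    ((NNReal.continuous_rpow_const hp.le).comp (by fun_prop))
    (‖g‖₊ ^ p) (fun z => NNReal.rpow_le_rpow (g.norm_coe_le_norm _) hp.le)
  have fin : ∀ (φ : E →ᵇ ℝ) (c : F → E), ∫⁻ z, ((‖φ (c z)‖₊ ^ p : ℝ≥0) : ℝ≥0∞) ∂(μ : Measure F) ≠ ∞ := by
    intro φ c
    refine ne_top_of_le_ne_top (b := ∫⁻ z, ((‖φ‖₊ ^ p : ℝ≥0) : ℝ≥0∞) ∂(μ : Measure F)) (by simp) ?_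
    refine lintegral_mono fun z => ENNReal.coe_le_coe.2 ?_
    exact NNReal.rpow_le_rpow (φ.norm_coe_le_norm _) hp.le
  have t4 := ENNReal.Tendsto.mul
    (((ENNReal.continuous_rpow_const (y := 1 / p)).tendsto _).comp t2)
    (Or.inr (ENNReal.rpow_ne_top_of_nonneg (by positivity) (fin g b)))
    (((ENNReal.continuous_rpow_const (y := 1 / p)).tendsto _).comp t3)
    (Or.inr (ENNReal.rpow_ne_top_of_nonneg (by positivity) (fin f a)))
  have := le_of_tendsto_of_tendsto' t1 t4 (fun N => by
    have := hHC N (fun x => ‖f x‖ₑ) (fun x => ‖g x‖ₑ) (by fun_prop) (by fun_prop)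
    simpa [enorm_eq_nnnorm, ENNReal.coe_rpow_of_nonneg _ hp.le] using this)
  simpa [enorm_eq_nnnorm, ENNReal.coe_rpow_of_nonneg _ hp.le] using this

lemma memLp_approx {E : Type*} [TopologicalSpace E] [NormalSpace E] [MeasurableSpace E] [BorelSpace E]
    {μ : Measure E} [μ.WeaklyRegular] {q : ℝ≥0∞} (hq : q ≠ ∞) (hq1 : 1 ≤ q) {f : E → ℝ}
    (hf : MemLp f q μ) :
    ∃ fs : ℕ → E →ᵇ ℝ, (∀ᵐ x ∂μ, Tendsto (fun k => fs k x) atTop (𝓝 (f x))) ∧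
      Tendsto (fun k => eLpNorm (fs k) q μ) atTop (𝓝 (eLpNorm f q μ)) := by
  have h : ∀ k : ℕ, ∃ g : E →ᵇ ℝ, eLpNorm (f - (g : E → ℝ)) q μ ≤ ((k : ℝ≥0∞) + 1)⁻¹ ∧ MemLp g q μ :=
    fun k => hf.exists_boundedContinuous_eLpNorm_sub_le hq (by simp)
  choose g hg hgm using h
  have hz : Tendsto (fun k : ℕ => ((k : ℝ≥0∞) + 1)⁻¹) atTop (𝓝 0) := by
    have := (ENNReal.tendsto_inv_nat_nhds_zero).comp (tendsto_add_atTop_nat 1)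
    simpa [Function.comp_def] using this
  have ht : Tendsto (fun k => eLpNorm ((g k : E → ℝ) - f) q μ) atTop (𝓝 0) := by
    refine tendsto_of_tendsto_of_tendsto_of_le_of_le tendsto_const_nhds hz (fun _ => zero_le) ?_
    intro k
    beta_reduce
    rw [eLpNorm_sub_comm]
    exact hg k
  have htm := tendstoInMeasure_of_tendsto_eLpNorm (by positivity) (fun k => (hgm k).1) hf.1 ht
  obtain ⟨ns, hns, hae⟩ := htm.exists_seq_tendsto_ae
  refine ⟨fun k => g (ns k), hae, ?_⟩
  have ht2 := ht.comp hns.tendsto_atTop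
  have hfin := hf.2.ne
  refine tendsto_of_tendsto_of_tendsto_of_le_of_le (g := fun k => eLpNorm f q μ - eLpNorm ((g (ns k) : E → ℝ) - f) q μ)
    (h := fun k => eLpNorm f q μ + eLpNorm ((g (ns k) : E → ℝ) - f) q μ) ?_ ?_ ?_ ?_
  · simpa using ENNReal.Tendsto.sub tendsto_const_nhds ht2 (Or.inl hfin)
  · simpa using tendsto_const_nhds.add ht2
  · intro k
    simp only [tsub_le_iff_right]
    have := eLpNorm_add_le (hgm (ns k)).1 (hf.1.sub (hgm (ns k)).1) hq1
    rw [add_sub_cancel, eLpNorm_sub_comm f] at this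
    exact this
  · intro k
    have := eLpNorm_add_le hf.1 ((hgm (ns k)).1.sub hf.1) hq1
    rwa [add_sub_cancel] at this

lemma HC_limit {F E : Type*} [MeasurableSpace F] [TopologicalSpace F]
    [OpensMeasurableSpace F] [TopologicalSpace E] [NormalSpace E] [MeasurableSpace E] [BorelSpace E]
    {p : ℝ} (hp : 1 ≤ p) {a b : F → E} (ha : Continuous a) (hb : Continuous b)
    {μs : ℕ → ProbabilityMeasure F} {μ : ProbabilityMeasure F}
    (h : Tendsto μs atTop (𝓝 μ)) (hHC : ∀ N, HC p a b (μs N : Measure F))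
    [((μ : Measure F).map a).WeaklyRegular] [((μ : Measure F).map b).WeaklyRegular]
    (f g : E → ℝ) (hf : MemLp f (ENNReal.ofReal p) ((μ : Measure F).map a))
    (hg : MemLp g (ENNReal.ofReal p) ((μ : Measure F).map b)) :
    ∫⁻ z, ‖f (a z)‖ₑ * ‖g (b z)‖ₑ ∂(μ : Measure F) ≤
      eLpNorm f (ENNReal.ofReal p) ((μ : Measure F).map a) *
      eLpNorm g (ENNReal.ofReal p) ((μ : Measure F).map b) := by
  have hp0 : 0 < p := by linarith
  have hq1 : 1 ≤ ENNReal.ofReal p := by simpa using hp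
  obtain ⟨fs, fae, fn⟩ := memLp_approx (by simp) hq1 hf
  obtain ⟨gs, gae, gn⟩ := memLp_approx (by simp) hq1 hg
  have fae' := ae_of_ae_map ha.measurable.aemeasurable fae
  have gae' := ae_of_ae_map hb.measurable.aemeasurable gae
  have hfb : ∀ k, ∫⁻ z, ‖fs k (a z)‖ₑ * ‖gs k (b z)‖ₑ ∂(μ : Measure F) ≤
      eLpNorm (fs k) (ENNReal.ofReal p) ((μ : Measure F).map a) *
      eLpNorm (gs k) (ENNReal.ofReal p) ((μ : Measure F).map b) := by
    intro k
    have := HC_limit_bcf hp0 ha hb h hHC (fs k) (gs k)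
    rw [eLpNorm_eq_lintegral_rpow_enorm_toReal (by positivity) (by simp),
      eLpNorm_eq_lintegral_rpow_enorm_toReal (by positivity) (by simp),
      ENNReal.toReal_ofReal hp0.le, lintegral_map (by fun_prop) ha.measurable,
      lintegral_map (by fun_prop) hb.measurable]
    exact this
  have t4 := ENNReal.Tendsto.mul fn (Or.inr hg.2.ne) gn (Or.inr hf.2.ne)
  calc ∫⁻ z, ‖f (a z)‖ₑ * ‖g (b z)‖ₑ ∂(μ : Measure F)
      = ∫⁻ z, liminf (fun k => ‖fs k (a z)‖ₑ * ‖gs k (b z)‖ₑ) atTop ∂(μ : Measure F) := by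
        apply lintegral_congr_ae
        filter_upwards [fae', gae'] with z h1 h2
        refine (Tendsto.liminf_eq ?_).symm
        exact ENNReal.Tendsto.mul h1.enorm (Or.inr (by simp)) h2.enorm (Or.inr (by simp))
    _ ≤ liminf (fun k => ∫⁻ z, ‖fs k (a z)‖ₑ * ‖gs k (b z)‖ₑ ∂(μ : Measure F)) atTop := by
        apply lintegral_liminf_le
        intro k
        have := ((fs k).continuous.comp ha).measurable
        have := ((gs k).continuous.comp hb).measurable
        fun_prop
    _ ≤ liminf (fun k => eLpNorm (fs k) (ENNReal.ofReal p) ((μ : Measure F).map a) *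
      eLpNorm (gs k) (ENNReal.ofReal p) ((μ : Measure F).map b)) atTop :=
        liminf_le_liminf (Eventually.of_forall hfb)
    _ = _ := t4.liminf_eq

lemma cos_limit (c : ℝ) :
    Tendsto (fun N : ℕ => (N : ℝ) * (Real.cos (c / √N) - 1)) atTop (𝓝 (-(c ^ 2 / 2))) := by
  have hd : HasDerivAt (fun x : ℝ => Real.sin (c / 2 * x)) (c / 2) 0 := by
    have := (((hasDerivAt_id (0:ℝ)).const_mul (c / 2))).sin
    simpa using this
  rw [hasDerivAt_iff_tendsto_slope_zero] at hd
  have ht : Tendsto (fun N : ℕ => (√(N:ℝ))⁻¹) atTop (𝓝[≠] 0) := by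
    rw [tendsto_nhdsWithin_iff]
    refine ⟨tendsto_inv_atTop_zero.comp (Real.tendsto_sqrt_atTop.comp tendsto_natCast_atTop_atTop), ?_⟩
    filter_upwards [eventually_gt_atTop 0] with N hN
    have : 0 < √(N:ℝ) := by positivity
    simp [this.ne']
  have h1 := ((hd.comp ht).pow 2).const_mul (-2)
  refine (h1.congr ?_).trans (by rw [show -2 * (c / 2) ^ 2 = -(c ^ 2 / 2) by ring])
  intro N
  have h2 : Real.cos (c / √N) - 1 = -2 * Real.sin (c / 2 * (√N)⁻¹) ^ 2 := by
    rw [Real.sin_sq_eq_half_sub, show 2 * (c / 2 * (√(N:ℝ))⁻¹) = c / √N by ring]; ring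
  rw [h2]
  simp [mul_pow]
  ring

noncomputable def phiHC (p α β : ℝ) : ℝ :=
  p / 2 * Real.cos (α + β) + (2 - p) / 2 * Real.cos (α - β)

lemma phiHC_limit (p α β : ℝ) :
    Tendsto (fun N : ℕ => phiHC p (α / √N) (β / √N) ^ N) atTop
      (𝓝 (Real.exp (-((α ^ 2 + β ^ 2 + 2 * (p - 1) * α * β) / 2)))) := by
  have h1 := ((cos_limit (α + β)).const_mul (p / 2)).add
    ((cos_limit (α - β)).const_mul ((2 - p) / 2))
  have h2 : Tendsto (fun N : ℕ => (N : ℝ) * (phiHC p (α / √N) (β / √N) - 1)) atTop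
      (𝓝 (-((α ^ 2 + β ^ 2 + 2 * (p - 1) * α * β) / 2))) := by
    refine (h1.congr ?_).trans (le_of_eq (congrArg _ (by ring)))
    intro N
    simp only [phiHC, add_div, sub_div]
    ring
  have := Real.tendsto_one_add_pow_exp_of_tendsto h2
  simpa using this

abbrev EE (n : ℕ) := EuclideanSpace ℝ (Fin n)
abbrev FF (n : ℕ) := WithLp 2 (EE n × EE n)

def fstFF (n : ℕ) : FF n →+ EE n where
  toFun z := z.fst
  map_zero' := rfl
  map_add' _ _ := rfl
def sndFF (n : ℕ) : FF n →+ EE n where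
  toFun z := z.snd
  map_zero' := rfl
  map_add' _ _ := rfl

lemma cont_fstFF (n : ℕ) : Continuous (fstFF n) := by
  change Continuous (fun z : FF n => z.fst); fun_prop
lemma cont_sndFF (n : ℕ) : Continuous (sndFF n) := by
  change Continuous (fun z : FF n => z.snd); fun_prop

lemma charFun_tpM {n : ℕ} {p : ℝ} (hp1 : 1 ≤ p) (hp2 : p ≤ 2) (c : EE n) (u : FF n) :
    charFun (tpM p (WithLp.toLp 2 (c, c) : FF n) (WithLp.toLp 2 (c, -c))) u =
      (phiHC p (inner ℝ c u.fst) (inner ℝ c u.snd) : ℝ) := by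
  have h2p : 0 ≤ (2 - p) / 4 := by linarith
  have h1p : 0 ≤ p / 4 := by linarith
  have hi : ∀ z : FF n, Integrable (fun x : FF n => Complex.exp (inner ℝ x u * Complex.I)) (Measure.dirac z) :=
    fun z => integrable_dirac (by simp)
  rw [charFun_apply, tpM]
  rw [integral_add_measure, integral_smul_measure, integral_smul_measure, integral_add_measure (hi _) (hi _),
    integral_add_measure (hi _) (hi _)]
  · have i1 : inner ℝ (WithLp.toLp 2 (c, c) : FF n) u = inner ℝ c u.fst + inner ℝ c u.snd := rfl
    have i2 : inner ℝ (WithLp.toLp 2 (c, -c) : FF n) u = inner ℝ c u.fst - inner ℝ c u.snd := by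
      rw [sub_eq_add_neg, ← inner_neg_left]; rfl
    simp only [integral_dirac, inner_neg_left, i1, i2, ENNReal.toReal_ofReal h2p,
      ENNReal.toReal_ofReal h1p, phiHC]
    simp only [Complex.real_smul]
    push_cast
    rw [Complex.cos, Complex.cos]
    ring_nf
  · exact ((hi _).add_measure (hi _)).smul_measure (by simp)
  · exact ((hi _).add_measure (hi _)).smul_measure (by simp)

lemma exists_HC_prod {n : ℕ} {p : ℝ} (hp1 : 1 ≤ p) (hp2 : p ≤ 2) {ι : Type*} (c : ι → EE n)
    (s : Finset ι) : ∃ m : Measure (FF n), IsProbabilityMeasure m ∧ HC p (fstFF n) (sndFF n) m ∧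
      ∀ u, charFun m u = ((∏ i ∈ s, phiHC p (inner ℝ (c i) u.fst) (inner ℝ (c i) u.snd) : ℝ) : ℂ) := by
  classical
  have hp0 : 0 < p := by linarith
  have m1 := (cont_fstFF n).measurable
  have m2 := (cont_sndFF n).measurable
  induction s using Finset.induction_on with
  | empty =>
    refine ⟨Measure.dirac 0, inferInstance, ?_, ?_⟩
    · intro f g hf hg
      have := hf.comp m1
      have := hg.comp m2
      rw [lintegral_dirac' _ (by fun_prop), lintegral_dirac' _ (by fun_prop),
        lintegral_dirac' _ (by fun_prop), ← ENNReal.rpow_mul, ← ENNReal.rpow_mul,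
        mul_one_div_cancel hp0.ne', ENNReal.rpow_one, ENNReal.rpow_one]
    · intro u; simp [charFun_dirac]
  | insert i s hi ih =>
    obtain ⟨m, hm, hHC, hch⟩ := ih
    have := tpM_prob hp1 hp2 (WithLp.toLp 2 (c i, c i) : FF n) (WithLp.toLp 2 (c i, -c i))
    refine ⟨(tpM p (WithLp.toLp 2 (c i, c i) : FF n) (WithLp.toLp 2 (c i, -c i))).conv m,
      inferInstance, ?_, ?_⟩
    · refine HC.conv hp0 m1 m2 ?_ hHC
      exact HC_tpM hp1 hp2 _ _ m1 m2 _ _ (c i) rfl rfl rfl rfl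
    · intro u
      rw [charFun_conv, hch, charFun_tpM hp1 hp2, Finset.prod_insert hi]
      push_cast; rfl

lemma exists_HC_seq {n : ℕ} {p : ℝ} (hp1 : 1 ≤ p) (hp2 : p ≤ 2) (c : Fin n → EE n)
    (μ : ProbabilityMeasure (FF n))
    (hμ : ∀ u, charFun (μ : Measure (FF n)) u = (Real.exp (- ((∑ i, ((inner ℝ (c i) u.fst) ^ 2 +
      (inner ℝ (c i) u.snd) ^ 2 + 2 * (p - 1) * (inner ℝ (c i) u.fst) * (inner ℝ (c i) u.snd))) / 2))
      : ℝ)) :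
    ∃ μs : ℕ → ProbabilityMeasure (FF n), Tendsto μs atTop (𝓝 μ) ∧
      ∀ N, HC p (fstFF n) (sndFF n) (μs N : Measure (FF n)) := by
  have h := fun N : ℕ => exists_HC_prod hp1 hp2 (fun q : Fin N × Fin n => (√(N:ℝ))⁻¹ • c q.2)
    Finset.univ
  choose m hm hHC hch using h
  let μs : ℕ → ProbabilityMeasure (FF n) := fun N => ⟨m N, hm N⟩
  refine ⟨μs, ?_, hHC⟩
  refine ProbabilityMeasure.tendsto_iff_tendsto_charFun.2 fun u => ?_
  change Tendsto (fun N => charFun (m N) u) atTop _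
  rw [hμ]
  simp only [hch]
  refine (Complex.continuous_ofReal.tendsto _).comp ?_
  rw [Finset.sum_div, ← Finset.sum_neg_distrib, Real.exp_sum]
  refine (tendsto_finsetProd Finset.univ (fun i _ => phiHC_limit p (inner ℝ (c i) u.fst) (inner ℝ (c i) u.snd))).congr ?_
  intro N
  rw [Fintype.prod_prod_type]
  simp only [Finset.prod_const, inner_smul_left, Finset.card_univ, Fintype.card_fin]
  rw [← Finset.prod_pow]
  refine Finset.prod_congr rfl fun i _ => ?_
  congr 2 <;> simp [div_eq_inv_mul]

section GaussianPart
variable {Ω : Type*} [MeasurableSpace Ω] {P : Measure Ω} [IsProbabilityMeasure P]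
    {n : ℕ} {X : Ω → (Fin n → ℝ)}

lemma coord_map (hgauss : ∀ a : Fin n → ℝ, ∃ v : NNReal,
      P.map (fun ω => ∑ i, a i * X ω i) = gaussianReal 0 v) (i : Fin n) :
    ∃ v : NNReal, P.map (fun ω => X ω i) = gaussianReal 0 v := by
  obtain ⟨v, hv⟩ := hgauss (Pi.single i 1)
  refine ⟨v, ?_⟩
  rw [← hv]
  congr 1
  ext ω
  simp [Pi.single_apply]

lemma memLp_of_gauss {W : Ω → ℝ} (hW : Measurable W) {v : ℝ≥0} (h : P.map W = gaussianReal 0 v) :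
    MemLp W 2 P := by
  have := memLp_id_gaussianReal (μ := 0) (v := v) 2
  rw [← h, memLp_map_measure_iff (by fun_prop) hW.aemeasurable] at this
  simpa using this

lemma memLp_exp_of_gauss {W : Ω → ℝ} (hW : Measurable W) {v : ℝ≥0}
    (h : P.map W = gaussianReal 0 v) (c : ℝ) {q : ℝ} (hq : 1 ≤ q) :
    MemLp (fun ω => Real.exp (c * W ω)) (ENNReal.ofReal q) P := by
  have hq0 : 0 < q := by linarith
  have h1 := integrable_exp_mul_gaussianReal (μ := 0) (v := v) (q * c)
  rw [← h, integrable_map_measure (by fun_prop) hW.aemeasurable] at h1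
  rw [← integrable_norm_rpow_iff (by fun_prop) (by simpa using hq0) (by simp),
    ENNReal.toReal_ofReal hq0.le]
  refine h1.congr (ae_of_all _ fun ω => ?_)
  simp only [Function.comp, Real.norm_eq_abs, Real.abs_exp]
  rw [← Real.exp_mul]
  ring_nf

lemma quad_eq (hX : Measurable X) (hgauss : ∀ a : Fin n → ℝ, ∃ v : NNReal,
      P.map (fun ω => ∑ i, a i * X ω i) = gaussianReal 0 v)
    (B : Matrix (Fin n) (Fin n) ℝ)
    (hΓ : ∀ i j, ∫ ω, X ω i * X ω j ∂P = (B * B.transpose) i j) (a : Fin n → ℝ) :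
    charFun (P.map (fun ω => ∑ i, a i * X ω i)) 1 =
      (Real.exp (-((∑ k, (∑ i, B i k * a i) ^ 2) / 2)) : ℝ) := by
  have hXi : ∀ i, Measurable fun ω => X ω i := fun i => (measurable_pi_apply i).comp hX
  have hm : ∀ i, MemLp (fun ω => X ω i) 2 P := fun i => by
    obtain ⟨v, hv⟩ := coord_map hgauss i
    exact memLp_of_gauss (hXi i) hv
  obtain ⟨v, hv⟩ := hgauss a
  have hW : Measurable (fun ω => ∑ i, a i * X ω i) := by fun_prop
  have h1 : (v : ℝ) = ∫ ω, (∑ i, a i * X ω i) ^ 2 ∂P := by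
    have e1 : Var[fun x : ℝ => x; gaussianReal 0 v] = v := variance_fun_id_gaussianReal
    have e2 : ∫ x, x ∂(gaussianReal 0 v) = 0 := integral_id_gaussianReal
    rw [variance_eq_integral (by fun_prop)] at e1
    simp only [e2, sub_zero] at e1
    rw [← e1, ← hv, integral_map hW.aemeasurable (by fun_prop)]
  have h2 : ∫ ω, (∑ i, a i * X ω i) ^ 2 ∂P = ∑ k, (∑ i, B i k * a i) ^ 2 := by
    have hint : ∀ i j, Integrable (fun ω => X ω i * X ω j) P := fun i j => (hm i).integrable_mul (hm j)
    calc ∫ ω, (∑ i, a i * X ω i) ^ 2 ∂P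
        = ∫ ω, ∑ i, ∑ j, (a i * a j) * (X ω i * X ω j) ∂P := by
          congr 1; ext ω
          rw [sq, Finset.sum_mul_sum]
          refine Finset.sum_congr rfl fun i _ => Finset.sum_congr rfl fun j _ => by ring
      _ = ∑ i, ∑ j, (a i * a j) * (B * B.transpose) i j := by
          rw [integral_finsetSum _ (fun i _ => integrable_finsetSum _ fun j _ => (hint i j).const_mul _)]
          refine Finset.sum_congr rfl fun i _ => ?_
          rw [integral_finsetSum _ (fun j _ => (hint i j).const_mul _)]
          refine Finset.sum_congr rfl fun j _ => ?_
          rw [integral_const_mul, hΓ]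
      _ = ∑ i, ∑ j, ∑ k, (B i k * a i) * (B j k * a j) := by
          refine Finset.sum_congr rfl fun i _ => Finset.sum_congr rfl fun j _ => ?_
          rw [Matrix.mul_apply, Finset.mul_sum]
          refine Finset.sum_congr rfl fun k _ => ?_
          rw [Matrix.transpose_apply]; ring
      _ = ∑ k, (∑ i, B i k * a i) ^ 2 := by
          simp only [sq, Finset.sum_mul_sum]
          rw [Finset.sum_comm' (t' := Finset.univ) (s' := fun _ => Finset.univ) (by simp)]
          rw [Finset.sum_congr rfl fun i _ => Finset.sum_comm]
          rw [Finset.sum_comm]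
          refine Finset.sum_congr rfl fun k _ => ?_
          rw [Finset.sum_comm]
  rw [hv, charFun_gaussianReal, ← h2, ← h1]
  push_cast
  simp

lemma charFun_pair (hX : Measurable X) (hgauss : ∀ a : Fin n → ℝ, ∃ v : NNReal,
      P.map (fun ω => ∑ i, a i * X ω i) = gaussianReal 0 v)
    (B : Matrix (Fin n) (Fin n) ℝ)
    (hΓ : ∀ i j, ∫ ω, X ω i * X ω j ∂P = (B * B.transpose) i j)
    {Y : Ω → (Fin n → ℝ)} (hY : Measurable Y) (hlaw : P.map X = P.map Y) (hindep : IndepFun X Y P)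
    {ρ s : ℝ} (hs : s ^ 2 = 1 - ρ ^ 2) (Xt : Ω → (Fin n → ℝ))
    (hXt : ∀ ω, Xt ω = ρ • X ω + s • Y ω) (u : FF n) :
    charFun (P.map (fun ω => (WithLp.toLp 2 (WithLp.toLp 2 (X ω), WithLp.toLp 2 (Xt ω)) : FF n))) u =
      (Real.exp (- ((∑ k, ((inner ℝ (WithLp.toLp 2 (fun i => B i k) : EE n) u.fst) ^ 2 +
      (inner ℝ (WithLp.toLp 2 (fun i => B i k) : EE n) u.snd) ^ 2 +
       2 * ρ * (inner ℝ (WithLp.toLp 2 (fun i => B i k) : EE n) u.fst) *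
       (inner ℝ (WithLp.toLp 2 (fun i => B i k) : EE n) u.snd))) / 2))
      : ℝ) := by
  have hXtm : Measurable Xt := by
    have : Xt = fun ω => ρ • X ω + s • Y ω := funext hXt
    rw [this]; fun_prop
  let v : Fin n → ℝ := fun i => u.fst i + ρ * u.snd i
  let w : Fin n → ℝ := fun i => s * u.snd i
  have hlin : ∀ a : Fin n → ℝ, Measurable (fun x : Fin n → ℝ => ∑ i, a i * x i) := fun a => by fun_prop
  have e1 : charFun (P.map (fun ω => (WithLp.toLp 2 (WithLp.toLp 2 (X ω), WithLp.toLp 2 (Xt ω)) : FF n))) u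
      = charFun (P.map (fun ω => (∑ i, v i * X ω i) + ∑ i, w i * Y ω i)) 1 := by
    rw [charFun_apply, charFun_apply_real, integral_map (by fun_prop) (by fun_prop),
      integral_map (by fun_prop) (by fun_prop)]
    congr 1; ext ω
    have : inner ℝ (WithLp.toLp 2 (WithLp.toLp 2 (X ω), WithLp.toLp 2 (Xt ω)) : FF n) u
      = (∑ i, v i * X ω i) + ∑ i, w i * Y ω i := by
      rw [WithLp.prod_inner_apply, PiLp.inner_apply, PiLp.inner_apply, ← Finset.sum_add_distrib,
        ← Finset.sum_add_distrib]
      refine Finset.sum_congr rfl fun i _ => ?_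
      change u.fst i * X ω i + u.snd i * Xt ω i = _
      rw [hXt]
      simp only [Pi.add_apply, Pi.smul_apply, smul_eq_mul, v, w]
      ring
    rw [this]; simp
  have hi2 : IndepFun (fun ω => ∑ i, v i * X ω i) (fun ω => ∑ i, w i * Y ω i) P :=
    hindep.comp (hlin v) (hlin w)
  have e2 : P.map (fun ω => ∑ i, w i * Y ω i) = P.map (fun ω => ∑ i, w i * X ω i) := by
    have h1 := Measure.map_map (μ := P) (hlin w) hY
    have h2 := Measure.map_map (μ := P) (hlin w) hX
    rw [← hlaw, h2] at h1
    exact h1.symm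
  rw [e1, hi2.charFun_map_fun_add_eq_mul (by fun_prop) (by fun_prop), Pi.mul_apply, e2,
    quad_eq hX hgauss B hΓ, quad_eq hX hgauss B hΓ, ← Complex.ofReal_mul, ← Real.exp_add]
  congr 2
  rw [← neg_add, ← add_div, ← Finset.sum_add_distrib]
  congr 2
  refine Finset.sum_congr rfl fun k _ => ?_
  have f1 : ∑ i, B i k * v i = inner ℝ (WithLp.toLp 2 (fun i => B i k) : EE n) u.fst
      + ρ * inner ℝ (WithLp.toLp 2 (fun i => B i k) : EE n) u.snd := by
    simp only [PiLp.inner_apply, v, Finset.mul_sum, ← Finset.sum_add_distrib]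
    refine Finset.sum_congr rfl fun i _ => ?_
    simp; ring
  have f2 : ∑ i, B i k * w i = s * inner ℝ (WithLp.toLp 2 (fun i => B i k) : EE n) u.snd := by
    simp only [PiLp.inner_apply, w, Finset.mul_sum]
    refine Finset.sum_congr rfl fun i _ => ?_
    simp; ring
  rw [f1, f2, mul_pow, hs]
  ring

end GaussianPart

lemma core_bound
    {Ω : Type*} [MeasurableSpace Ω] (P : Measure Ω) [IsProbabilityMeasure P]
    (n : ℕ) (X Y : Ω → (Fin n → ℝ)) (hX : Measurable X) (hY : Measurable Y)
    (hgauss : ∀ a : Fin n → ℝ, ∃ v : NNReal,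
      P.map (fun ω => ∑ i, a i * X ω i) = gaussianReal 0 v)
    (B : Matrix (Fin n) (Fin n) ℝ)
    (hΓ : ∀ i j, ∫ ω, X ω i * X ω j ∂P = (B * B.transpose) i j)
    (hlaw : P.map X = P.map Y) (hindep : IndepFun X Y P)
    {ρ s p : ℝ} (hρ0 : 0 ≤ ρ) (hρ1 : ρ ≤ 1) (hs : s ^ 2 = 1 - ρ ^ 2) (hp : p = 1 + ρ)
    (Xt : Ω → (Fin n → ℝ)) (hXt : ∀ ω, Xt ω = ρ • X ω + s • Y ω)
    (f : (Fin n → ℝ) → ℝ) (hf : Measurable f)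
    (hfL : MemLp (fun ω => f (X ω)) (ENNReal.ofReal p) P) :
    ∫⁻ ω, ‖f (X ω)‖ₑ * ‖f (Xt ω)‖ₑ ∂P ≤
      eLpNorm (fun ω => f (X ω)) (ENNReal.ofReal p) P ^ 2 := by
  have hp1 : 1 ≤ p := by linarith
  have hp2 : p ≤ 2 := by linarith
  have hXtm : Measurable Xt := by
    have : Xt = fun ω => ρ • X ω + s • Y ω := funext hXt
    rw [this]; fun_prop
  let Z : Ω → FF n := fun ω => WithLp.toLp 2 (WithLp.toLp 2 (X ω), WithLp.toLp 2 (Xt ω))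
  have hZ : Measurable Z := by fun_prop
  have hch := charFun_pair hX hgauss B hΓ hY hlaw hindep hs Xt hXt
  have : IsProbabilityMeasure (P.map Z) := Measure.isProbabilityMeasure_map hZ.aemeasurable
  let μ : ProbabilityMeasure (FF n) := ⟨P.map Z, this⟩
  have hμ : (μ : Measure (FF n)) = P.map Z := rfl
  obtain ⟨μs, hlim, hHC⟩ := exists_HC_seq hp1 hp2
    (fun k => (WithLp.toLp 2 (fun i => B i k) : EE n)) μ (by
      intro u
      rw [show p - 1 = ρ by linarith]
      exact hch u)
  have hA : (μ : Measure (FF n)).map (fstFF n) = P.map (fun ω => (WithLp.toLp 2 (X ω) : EE n)) := by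
    rw [hμ, Measure.map_map (cont_fstFF n).measurable hZ]; rfl
  have hB : (μ : Measure (FF n)).map (sndFF n) = P.map (fun ω => (WithLp.toLp 2 (Xt ω) : EE n)) := by
    rw [hμ, Measure.map_map (cont_sndFF n).measurable hZ]; rfl
  have p1 : IsProbabilityMeasure (P.map (fun ω => (WithLp.toLp 2 (X ω) : EE n))) :=
    Measure.isProbabilityMeasure_map (by fun_prop)
  have p2 : IsProbabilityMeasure (P.map (fun ω => (WithLp.toLp 2 (Xt ω) : EE n))) :=
    Measure.isProbabilityMeasure_map (by fun_prop)
  have hAB : P.map (fun ω => (WithLp.toLp 2 (Xt ω) : EE n)) = P.map (fun ω => (WithLp.toLp 2 (X ω) : EE n)) := by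
    apply Measure.ext_of_charFun
    ext u
    have c1 : charFun (P.map (fun ω => (WithLp.toLp 2 (Xt ω) : EE n))) u = charFun (P.map Z) (WithLp.toLp 2 (0, u)) := by
      rw [charFun_apply, charFun_apply, integral_map (by fun_prop) (by fun_prop),
        integral_map (by fun_prop) (by fun_prop)]
      simp [Z, WithLp.prod_inner_apply]
    have c2 : charFun (P.map (fun ω => (WithLp.toLp 2 (X ω) : EE n))) u = charFun (P.map Z) (WithLp.toLp 2 (u, 0)) := by
      rw [charFun_apply, charFun_apply, integral_map (by fun_prop) (by fun_prop),
        integral_map (by fun_prop) (by fun_prop)]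
      simp [Z, WithLp.prod_inner_apply]
    rw [c1, c2, hch, hch]
    simp
  have w1 : ((μ : Measure (FF n)).map (fstFF n)).WeaklyRegular := by rw [hA]; infer_instance
  have w2 : ((μ : Measure (FF n)).map (sndFF n)).WeaklyRegular := by rw [hB]; infer_instance
  let F : EE n → ℝ := fun x => f x.ofLp
  have hF : Measurable F := by fun_prop
  have hFL : MemLp F (ENNReal.ofReal p) (P.map (fun ω => (WithLp.toLp 2 (X ω) : EE n))) := by
    rw [memLp_map_measure_iff (by fun_prop) (by fun_prop)]
    exact hfL
  have hFn : eLpNorm F (ENNReal.ofReal p) (P.map (fun ω => (WithLp.toLp 2 (X ω) : EE n)))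
      = eLpNorm (fun ω => f (X ω)) (ENNReal.ofReal p) P := by
    rw [eLpNorm_map_measure (by fun_prop) (by fun_prop)]
    rfl
  have main := HC_limit hp1 (cont_fstFF n) (cont_sndFF n) hlim hHC F F
    (by rw [hA]; exact hFL) (by rw [hB, hAB]; exact hFL)
  rw [hA, hB, hAB, hFn, hμ, lintegral_map ?_ hZ, ← sq] at main
  · exact main
  · exact (hF.comp (cont_fstFF n).measurable).enorm.mul
      (hF.comp (cont_sndFF n).measurable).enorm

end HCHelpers

/-- **Hölder + hypercontractivity step in Tanguy's Theorem 2.1**: let `X` be a centered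
Gaussian vector with covariance `Γ = B Bᵀ`, `B` invertible, with a.s. unique argmax `I`,
`Y` an independent copy, `X^t = e^{−t} X + √(1 − e^{−2t}) Y` with maximum `M_n^t` and
argmax `I^t`. Then for every `θ ∈ ℝ`, `t ≥ 0`, and `D ⊆ {1,…,n}`, with `p = 1 + e^{−t}`,
`E[e^{θ(M_n + M_n^t)/2} 1_{I ∈ D} 1_{I^t ∈ D}] ≤ P(I ∈ D)^{(2−p)/p} E[e^{θ M_n} 1_{I ∈ D}]`. -/
theorem holder_hypercontractivity_argmax_bound
    {Ω : Type*} [MeasurableSpace Ω] (P : Measure Ω) [IsProbabilityMeasure P]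
    (n : ℕ) (hn : 1 ≤ n)
    (X Y : Ω → (Fin n → ℝ)) (hX : Measurable X) (hY : Measurable Y)
    -- `X` is a centered Gaussian vector: every linear combination is centered Gaussian
    (hgauss : ∀ a : Fin n → ℝ, ∃ v : NNReal,
      P.map (fun ω => ∑ i, a i * X ω i) = gaussianReal 0 v)
    -- the covariance matrix is `B Bᵀ` with `B` invertible
    (B : Matrix (Fin n) (Fin n) ℝ) (hB : IsUnit B.det)
    (hΓ : ∀ i j, ∫ ω, X ω i * X ω j ∂P = (B * B.transpose) i j)
    -- `Y` is an independent copy of `X`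
    (hlaw : P.map X = P.map Y) (hindep : IndepFun X Y P)
    (t : ℝ) (ht : 0 ≤ t)
    -- `X^t`
    (Xt : Ω → (Fin n → ℝ))
    (hXt : ∀ ω, Xt ω = Real.exp (-t) • X ω + Real.sqrt (1 - Real.exp (-2 * t)) • Y ω)
    -- the a.s. unique argmaxes of `X` and of `X^t`
    (I It : Ω → Fin n) (hImeas : Measurable I) (hItmeas : Measurable It)
    (hI : ∀ᵐ ω ∂P, (∀ j, X ω j ≤ X ω (I ω)) ∧ ∀ j, X ω j = X ω (I ω) → j = I ω)
    (hIt : ∀ᵐ ω ∂P, (∀ j, Xt ω j ≤ Xt ω (It ω)) ∧ ∀ j, Xt ω j = Xt ω (It ω) → j = It ω)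
    (θ : ℝ) (D : Finset (Fin n)) (p : ℝ) (hp : p = 1 + Real.exp (-t)) :
    ∫ ω in {ω | I ω ∈ D ∧ It ω ∈ D},
        Real.exp (θ * ((⨆ i, X ω i) + ⨆ i, Xt ω i) / 2) ∂P ≤
      (P {ω | I ω ∈ D}).toReal ^ ((2 - p) / p) *
        ∫ ω in {ω | I ω ∈ D}, Real.exp (θ * ⨆ i, X ω i) ∂P := by
  have hne : Nonempty (Fin n) := ⟨⟨0, hn⟩⟩
  have he0 : 0 ≤ Real.exp (-t) := (Real.exp_pos _).le
  have he1 : Real.exp (-t) ≤ 1 := Real.exp_le_one_iff.2 (by linarith)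
  have hp1 : 1 ≤ p := by linarith
  have hp2 : p ≤ 2 := by linarith
  have hs : Real.sqrt (1 - Real.exp (-2 * t)) ^ 2 = 1 - Real.exp (-t) ^ 2 := by
    rw [Real.sq_sqrt]
    · rw [← Real.exp_nat_mul]; congr 2; push_cast; ring
    · have : Real.exp (-2 * t) ≤ 1 := Real.exp_le_one_iff.2 (by linarith)
      linarith
  have hXi : ∀ i, Measurable fun ω => X ω i := fun i => (measurable_pi_apply i).comp hX
  have hsup : Measurable (fun x : Fin n → ℝ => ⨆ i, x i) :=
    Measurable.iSup fun i => measurable_pi_apply i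
  let A : Set (Fin n → ℝ) := {x | ∃ i ∈ D, ∀ j, x j ≤ x i}
  have hA : MeasurableSet A := by
    have : A = ⋃ i ∈ D, ⋂ j, {x : Fin n → ℝ | x j ≤ x i} := by
      ext x; simp [A]
    rw [this]
    exact Finset.measurableSet_biUnion _ fun i _ => MeasurableSet.iInter fun j =>
      measurableSet_le (measurable_pi_apply j) (measurable_pi_apply i)
  have hAiff : ∀ (x : Fin n → ℝ) (k : Fin n),
      ((∀ j, x j ≤ x k) ∧ ∀ j, x j = x k → j = k) → (x ∈ A ↔ k ∈ D) := by
    intro x k hk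
    constructor
    · rintro ⟨i, hi, h⟩
      have := hk.2 i (le_antisymm (hk.1 i) (h k))
      rwa [← this]
    · intro h
      exact ⟨k, h, hk.1⟩
  let e : (Fin n → ℝ) → ℝ := fun x => Real.exp (θ / 2 * ⨆ i, x i)
  have he : Measurable e := by fun_prop
  let f : (Fin n → ℝ) → ℝ := A.indicator e
  have hf : Measurable f := he.indicator hA
  have hSm : MeasurableSet {ω | I ω ∈ D} := hImeas (D : Set (Fin n)).toFinite.measurableSet
  have hSm' : MeasurableSet {ω | It ω ∈ D} := hItmeas (D : Set (Fin n)).toFinite.measurableSet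
  -- integrability
  have heL : ∀ q : ℝ, 1 ≤ q → MemLp (fun ω => e (X ω)) (ENNReal.ofReal q) P := by
    intro q hq
    have h1 : MemLp (fun ω => ∑ i, Real.exp (θ / 2 * X ω i)) (ENNReal.ofReal q) P := by
      refine memLp_finsetSum _ fun i _ => ?_
      obtain ⟨v, hv⟩ := coord_map hgauss i
      exact memLp_exp_of_gauss (hXi i) hv _ hq
    refine h1.mono (he.comp hX).aestronglyMeasurable (ae_of_all _ fun ω => ?_)
    obtain ⟨i, hi⟩ := exists_eq_ciSup_of_finite (f := fun i => X ω i)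
    simp only [e, Real.norm_eq_abs, Real.abs_exp]
    rw [← hi]
    refine le_trans ?_ (le_abs_self _)
    exact Finset.single_le_sum (f := fun i => Real.exp (θ / 2 * X ω i))
      (fun i _ => (Real.exp_pos _).le) (Finset.mem_univ i)
  have hfX : (fun ω => f (X ω)) =ᵐ[P] {ω | I ω ∈ D}.indicator (fun ω => e (X ω)) := by
    filter_upwards [hI] with ω hω
    have := hAiff _ _ hω
    simp only [f, Set.indicator_apply, this, Set.mem_ofPred_eq]
  have hfXt : (fun ω => f (Xt ω)) =ᵐ[P] {ω | It ω ∈ D}.indicator (fun ω => e (Xt ω)) := by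
    filter_upwards [hIt] with ω hω
    have := hAiff _ _ hω
    simp only [f, Set.indicator_apply, this, Set.mem_ofPred_eq]
  have hfL : MemLp (fun ω => f (X ω)) (ENNReal.ofReal p) P :=
    (memLp_congr_ae hfX).2 ((heL p hp1).indicator hSm)
  have core := core_bound P n X Y hX hY hgauss B hΓ hlaw hindep he0 he1 hs hp Xt hXt f hf hfL
  have hnorm : eLpNorm (fun ω => f (X ω)) (ENNReal.ofReal p) P =
      eLpNorm (fun ω => e (X ω)) (ENNReal.ofReal p) (P.restrict {ω | I ω ∈ D}) := by
    rw [eLpNorm_congr_ae hfX, eLpNorm_indicator_eq_eLpNorm_restrict hSm]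
  have hold : eLpNorm (fun ω => e (X ω)) (ENNReal.ofReal p) (P.restrict {ω | I ω ∈ D}) ≤
      eLpNorm (fun ω => e (X ω)) (ENNReal.ofReal 2) (P.restrict {ω | I ω ∈ D}) *
        (P.restrict {ω | I ω ∈ D}) Set.univ ^ (1 / (ENNReal.ofReal p).toReal - 1 / (ENNReal.ofReal 2).toReal) :=
    eLpNorm_le_eLpNorm_mul_rpow_measure_univ (ENNReal.ofReal_le_ofReal hp2)
      (he.comp hX).aestronglyMeasurable
  rw [ENNReal.toReal_ofReal (by linarith), ENNReal.toReal_ofReal (by norm_num),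
    Measure.restrict_apply_univ] at hold
  have hint : Integrable (fun ω => Real.exp (θ * ⨆ i, X ω i)) (P.restrict {ω | I ω ∈ D}) := by
    have h2 := heL 2 (by norm_num)
    rw [ENNReal.ofReal_ofNat] at h2
    refine (h2.integrable_sq.congr (ae_of_all _ fun ω => ?_)).restrict
    simp only [e, ← Real.exp_nat_mul]
    congr 1; push_cast; ring
  have hn2 : eLpNorm (fun ω => e (X ω)) (ENNReal.ofReal 2) (P.restrict {ω | I ω ∈ D}) ^ 2 =
      ENNReal.ofReal (∫ ω in {ω | I ω ∈ D}, Real.exp (θ * ⨆ i, X ω i) ∂P) := by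
    rw [eLpNorm_eq_lintegral_rpow_enorm_toReal (by simp) (by simp),
      ENNReal.toReal_ofReal (by norm_num), ← ENNReal.rpow_natCast, ← ENNReal.rpow_mul,
      ofReal_integral_eq_lintegral_ofReal hint (ae_of_all _ fun ω => (Real.exp_pos _).le)]
    norm_num
    refine lintegral_congr fun ω => ?_
    simp only [e]
    rw [Real.enorm_eq_ofReal (Real.exp_pos _).le, ← ENNReal.ofReal_pow (Real.exp_pos _).le,
      ← Real.exp_nat_mul]
    congr 2; push_cast; ring
  have hL : ∫⁻ ω in {ω | I ω ∈ D ∧ It ω ∈ D},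
      ENNReal.ofReal (Real.exp (θ * ((⨆ i, X ω i) + ⨆ i, Xt ω i) / 2)) ∂P
      = ∫⁻ ω, ‖f (X ω)‖ₑ * ‖f (Xt ω)‖ₑ ∂P := by
    have hSS : MeasurableSet {ω | I ω ∈ D ∧ It ω ∈ D} := hSm.inter hSm'
    rw [← lintegral_indicator hSS]
    refine lintegral_congr_ae ?_
    filter_upwards [hfX, hfXt] with ω h1 h2
    rw [h1, h2]
    by_cases hi : I ω ∈ D <;> by_cases hj : It ω ∈ D <;> simp [Set.indicator_apply, hi, hj]
    simp only [e]
    rw [Real.enorm_eq_ofReal (Real.exp_pos _).le, Real.enorm_eq_ofReal (Real.exp_pos _).le,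
      ← ENNReal.ofReal_mul (Real.exp_pos _).le, ← Real.exp_add]
    congr 2; ring
  have hXtm : Measurable Xt := by
    have : Xt = fun ω => Real.exp (-t) • X ω + Real.sqrt (1 - Real.exp (-2 * t)) • Y ω := funext hXt
    rw [this]; fun_prop
  have hsX := hsup.comp hX
  have hsXt := hsup.comp hXtm
  rw [integral_eq_lintegral_of_nonneg_ae (ae_of_all _ fun ω => (Real.exp_pos _).le)
    (Measurable.aestronglyMeasurable (by
      simp only [Function.comp_def] at hsX hsXt
      fun_prop)), hL]
  refine ENNReal.toReal_le_of_le_ofReal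
    (mul_nonneg (Real.rpow_nonneg ENNReal.toReal_nonneg _)
      (integral_nonneg fun ω => (Real.exp_pos _).le)) ?_
  refine core.trans ?_
  rw [hnorm]
  refine (pow_le_pow_left₀ zero_le hold 2).trans (le_of_eq ?_)
  have hexp : 0 ≤ (2 - p) / p := div_nonneg (by linarith) (by linarith)
  rw [mul_pow, hn2, ENNReal.ofReal_mul (Real.rpow_nonneg ENNReal.toReal_nonneg _), mul_comm,
    ← ENNReal.ofReal_rpow_of_nonneg ENNReal.toReal_nonneg hexp,
    ENNReal.ofReal_toReal (measure_ne_top _ _), ← ENNReal.rpow_natCast, ← ENNReal.rpow_mul]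
  congr 2
  have : p ≠ 0 := by linarith
  push_cast
  field_simp
end

section
/- Consider the scan test in the Gaussian detection problem: X = (X_1,…,X_n) is observed, 𝒞 = {S_1,…,S_N} is a class of subsets of {1,…,n} each of cardinality K, and the test f accepts (f(X)=0) unless 2 max_{S∈𝒞} X_S ≥ μK + E_0[max_{S∈𝒞} X_S], where X_S = Σ_{i∈S} X_i. Then for every δ ∈ (0,1), the risk R(f) = P_0(f(X)=1) + (1/N) Σ_{S∈𝒞} P_S(f(X)=0) satisfies R(f) ≤ δ whenever μ ≥ (1/K) E_0[max_{S∈𝒞} X_S] + 2 √((2/K) log(2/δ)). -/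
open MeasureTheory ProbabilityTheory Real

namespace ScanAux

noncomputable def gam (n : ℕ) : Measure (Fin n → ℝ) := Measure.pi fun _ => gaussianReal 0 1

instance (n : ℕ) : IsProbabilityMeasure (gam n) := by unfold gam; infer_instance

def W {n : ℕ} (x : Fin n → ℝ) : ℝ := ∑ i, |x i|

lemma W_nonneg {n : ℕ} (x : Fin n → ℝ) : 0 ≤ W x := Finset.sum_nonneg fun _ _ => abs_nonneg _

lemma continuous_W {n : ℕ} : Continuous (W (n := n)) := by unfold W; fun_prop

lemma int_abs (c : ℝ) : Integrable (fun z : ℝ => exp (c * |z|)) (gaussianReal 0 1) :=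
  integrable_exp_mul_abs (X := fun z : ℝ => z) (integrable_exp_mul_gaussianReal c)
    (integrable_exp_mul_gaussianReal (-c))

lemma int_W (n : ℕ) (c : ℝ) : Integrable (fun x : Fin n → ℝ => exp (c * W x)) (gam n) := by
  have := Integrable.fintype_prod (ι := Fin n) (μ := fun _ => gaussianReal 0 1)
    (f := fun _ z => exp (c * |z|)) (fun _ => int_abs c)
  refine this.congr (Filter.Eventually.of_forall fun x => ?_)
  simp only [W, Finset.mul_sum, exp_sum]

lemma int_dom {n : ℕ} {f : (Fin n → ℝ) → ℝ} (hf : Continuous f) (C c : ℝ)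
    (h : ∀ x, |f x| ≤ C * exp (c * W x)) : Integrable f (gam n) :=
  ((int_W n c).const_mul C).mono' hf.aestronglyMeasurable (Filter.Eventually.of_forall h)

lemma int_W2 (n : ℕ) (c : ℝ) : Integrable
    (fun p : (Fin n → ℝ) × (Fin n → ℝ) => exp (c * (W p.1 + W p.2))) ((gam n).prod (gam n)) := by
  refine ((int_W n c).mul_prod (int_W n c)).congr (Filter.Eventually.of_forall fun x => ?_)
  simp only [mul_add, exp_add]

lemma int_dom2 {n : ℕ} {f : (Fin n → ℝ) × (Fin n → ℝ) → ℝ} (hf : Continuous f) (C c : ℝ)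
    (h : ∀ p, |f p| ≤ C * exp (c * (W p.1 + W p.2))) : Integrable f ((gam n).prod (gam n)) :=
  ((int_W2 n c).const_mul C).mono' hf.aestronglyMeasurable (Filter.Eventually.of_forall h)

lemma int_dom1 {f : ℝ → ℝ} (hf : Continuous f) (C c : ℝ)
    (h : ∀ x, |f x| ≤ C * exp (c * |x|)) : Integrable f (gaussianReal 0 1) :=
  ((int_abs c).const_mul C).mono' hf.aestronglyMeasurable (Filter.Eventually.of_forall h)

lemma vol_of_gauss {f : ℝ → ℝ} (h : Integrable f (gaussianReal 0 1)) :
    Integrable (fun x => f x * gaussianPDFReal 0 1 x) := by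
  rw [gaussianReal_of_var_ne_zero _ one_ne_zero] at h
  rw [integrable_withDensity_iff (measurable_gaussianPDF _ _)
    (Filter.Eventually.of_forall fun _ => gaussianPDF_lt_top)] at h
  simpa [toReal_gaussianPDF] using h

lemma mul_bd {a w C c y : ℝ} (ha : |a| ≤ w) (_hw : 0 ≤ w) (hy : |y| ≤ C * exp (c * w)) :
    |a * y| ≤ C * exp ((c + 1) * w) := by
  have h1 : w ≤ exp w := by linarith [add_one_le_exp w]
  have : (c + 1) * w = w + c * w := by ring
  rw [abs_mul, this, exp_add]
  have h2 : 0 ≤ C * exp (c * w) := (abs_nonneg _).trans hy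
  calc |a| * |y| ≤ exp w * (C * exp (c * w)) := by gcongr; linarith
    _ = _ := by ring

lemma stein1 {f f' : ℝ → ℝ} (hd : ∀ x, HasDerivAt f (f' x) x) (hc : Continuous f') (C c : ℝ)
    (h : ∀ x, |f x| ≤ C * exp (c * |x|)) (h' : ∀ x, |f' x| ≤ C * exp (c * |x|)) :
    ∫ x, x * f x ∂(gaussianReal 0 1) = ∫ x, f' x ∂(gaussianReal 0 1) := by
  have hfc : Continuous f := continuous_iff_continuousAt.2 fun x => (hd x).continuousAt
  rw [integral_gaussianReal_eq_integral_smul one_ne_zero,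
    integral_gaussianReal_eq_integral_smul one_ne_zero]
  have hv : ∀ x, HasDerivAt (gaussianPDFReal 0 1) (-x * gaussianPDFReal 0 1 x) x := by
    intro x
    simp only [gaussianPDFReal_def]
    have h1 : HasDerivAt (fun x : ℝ => -(x - 0) ^ 2 / (2 * ((1 : NNReal) : ℝ))) (-x) x := by
      have := (((hasDerivAt_id x).sub_const 0).pow 2).neg.div_const (2 * ((1 : NNReal) : ℝ))
      refine this.congr_deriv ?_
      simp; ring
    refine (h1.exp.const_mul _).congr_deriv ?_
    ring
  have i0 := vol_of_gauss (int_dom1 hfc C c h)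
  have i1 := vol_of_gauss (int_dom1 hc C c h')
  have i2 := vol_of_gauss (int_dom1 (f := fun x => x * f x) (by fun_prop) C (c + 1)
    (fun x => mul_bd le_rfl (abs_nonneg x) (h x)))
  have := integral_mul_deriv_eq_deriv_mul_of_integrable (u := f) (u' := f')
    (v := gaussianPDFReal 0 1) (v' := fun x => -x * gaussianPDFReal 0 1 x)
    (fun x _ => hd x) (fun x _ => hv x)
    (i2.neg.congr (Filter.Eventually.of_forall fun x => by simp; ring)) i1 i0
  have e : ∫ x, gaussianPDFReal 0 1 x • (x * f x)
      = - ∫ x, f x * (-x * gaussianPDFReal 0 1 x) := by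
    rw [← integral_neg]; congr 1; ext x; simp; ring
  rw [e, this, neg_neg]
  congr 1; ext x; simp; ring

lemma W_insertNth {n : ℕ} (i : Fin (n + 1)) (z : ℝ) (x : Fin n → ℝ) :
    W (i.insertNth (α := fun _ => ℝ) z x) = |z| + W x := by
  simp [W, Fin.sum_univ_succAbove _ i]

lemma abs_le_W {n : ℕ} (x : Fin n → ℝ) (i : Fin n) : |x i| ≤ W x :=
  Finset.single_le_sum (f := fun i => |x i|) (fun _ _ => abs_nonneg _) (Finset.mem_univ i)

lemma integral_split {n : ℕ} (i : Fin (n + 1)) {f : (Fin (n + 1) → ℝ) → ℝ}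
    (hf : Integrable f (gam (n + 1))) :
    ∫ x, f x ∂(gam (n + 1)) =
      ∫ x, ∫ z, f (i.insertNth (α := fun _ => ℝ) z x) ∂(gaussianReal 0 1) ∂(gam n) := by
  have mp := (measurePreserving_piFinSuccAbove (n := n) (fun _ => gaussianReal 0 1) i).symm
  have h1 := mp.integral_comp' (g := f)
  have h2 : Integrable (fun p : ℝ × (Fin n → ℝ) =>
      f ((MeasurableEquiv.piFinSuccAbove (fun _ => ℝ) i).symm p))
      ((gaussianReal 0 1).prod (gam n)) :=
    (mp.integrable_comp_emb (MeasurableEquiv.measurableEmbedding _)).2 hf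
  have h3 := integral_prod_symm _ h2
  unfold gam at *
  rw [← h1, h3]
  rfl

lemma stein {n : ℕ} (i : Fin n) {f f' : (Fin n → ℝ) → ℝ}
    (hd : ∀ x, HasDerivAt (fun t => f (Function.update x i t)) (f' x) (x i))
    (hfc : Continuous f) (hc : Continuous f') (C c : ℝ)
    (h : ∀ x, |f x| ≤ C * exp (c * W x)) (h' : ∀ x, |f' x| ≤ C * exp (c * W x)) :
    ∫ x, x i * f x ∂(gam n) = ∫ x, f' x ∂(gam n) := by
  cases n with
  | zero => exact i.elim0
  | succ n =>
    rw [integral_split i (int_dom (by fun_prop) C (c + 1)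
      fun x => mul_bd (abs_le_W x i) (W_nonneg x) (h x)), integral_split i (int_dom hc C c h')]
    congr 1; ext x
    simp only [Fin.insertNth_apply_same]
    refine stein1 (f := fun z => f (i.insertNth (α := fun _ => ℝ) z x))
      (f' := fun z => f' (i.insertNth (α := fun _ => ℝ) z x))
      (fun z => ?_) (by fun_prop) (C * exp (c * W x)) c (fun z => ?_) (fun z => ?_)
    · have := hd (i.insertNth (α := fun _ => ℝ) z x)
      simpa using this
    · refine (h _).trans_eq ?_
      rw [W_insertNth, mul_add, exp_add]; ring
    · refine (h' _).trans_eq ?_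
      rw [W_insertNth, mul_add, exp_add]; ring

lemma rot (n : ℕ) (θ : ℝ) : ((gam n).prod (gam n)).map (ContinuousLinearMap.rotation θ)
    = (gam n).prod (gam n) := by
  have e : gam n = (stdGaussian (EuclideanSpace ℝ (Fin n))).map
      (PiLp.continuousLinearEquiv 2 ℝ (fun _ : Fin n => ℝ)) := by
    rw [← map_pi_eq_stdGaussian, Measure.map_map (by fun_prop) (by fun_prop)]
    symm
    exact Measure.map_id
  have : IsGaussian (gam n) := by
    rw [e]; infer_instance
  refine IsGaussian.map_rotation_eq_self_of_forall_strongDual_eq_zero (fun L => ?_) θ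
  rw [IsGaussian.integral_dual]
  have : ∫ x, x ∂(gam n) = 0 := by
    rw [e, integral_map (by fun_prop) (by fun_prop)]
    have := (PiLp.continuousLinearEquiv 2 ℝ (fun _ : Fin n => ℝ)).integral_comp_comm
      (μ := stdGaussian (EuclideanSpace ℝ (Fin n))) (fun x => x)
    rw [this]
    simp
  rw [this, map_zero]

lemma W_comb {n : ℕ} {a b : ℝ} (ha : |a| ≤ 1) (hb : |b| ≤ 1) (x y : Fin n → ℝ) :
    W (a • x + b • y) ≤ W x + W y := by
  unfold W
  rw [← Finset.sum_add_distrib]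
  refine Finset.sum_le_sum fun i _ => ?_
  simp only [Pi.add_apply, Pi.smul_apply, smul_eq_mul]
  refine (abs_add_le _ _).trans ?_
  rw [abs_mul, abs_mul]
  nlinarith [abs_nonneg (x i), abs_nonneg (y i)]

structure Sm {n : ℕ} (F : (Fin n → ℝ) → ℝ) (D : Fin n → (Fin n → ℝ) → ℝ) (A K : ℝ) : Prop where
  hF : ∀ x, HasFDerivAt F (∑ i, D i x • (ContinuousLinearMap.proj i : (Fin n → ℝ) →L[ℝ] ℝ)) x
  hc : ∀ i, Continuous (D i)
  h0 : ∀ i x, 0 ≤ D i x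
  h1 : ∀ i x, D i x ≤ 1
  hK : ∀ x, ∑ i, D i x ≤ K
  hA : 0 ≤ A
  hb : ∀ x, |F x| ≤ A + W x

namespace Sm
variable {n : ℕ} {F : (Fin n → ℝ) → ℝ} {D : Fin n → (Fin n → ℝ) → ℝ} {A K : ℝ}

lemma cont (h : Sm F D A K) : Continuous F :=
  continuous_iff_continuousAt.2 fun x => (h.hF x).continuousAt

lemma g_le (h : Sm F D A K) {l : ℝ} (hl : 0 ≤ l) (x : Fin n → ℝ) {w : ℝ} (hw : W x ≤ w) :
    |exp (l * F x)| ≤ exp (l * A) * exp (l * w) := by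
  rw [abs_of_pos (exp_pos _), ← exp_add, ← mul_add]
  have := (le_abs_self _).trans (h.hb x)
  gcongr; linarith

lemma D_sum (h : Sm F D A K) (u y : Fin n → ℝ) : |∑ i, D i u * y i| ≤ W y := by
  refine (Finset.abs_sum_le_sum_abs _ _).trans (Finset.sum_le_sum fun i _ => ?_)
  rw [abs_mul, abs_of_nonneg (h.h0 i u)]
  exact mul_le_of_le_one_left (abs_nonneg _) (h.h1 i u)

lemma inner_bd (h : Sm F D A K) {l : ℝ} (hl : 0 ≤ l) {c s : ℝ} (hc : |c| ≤ 1) (hs : |s| ≤ 1)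
    (hs0 : 0 ≤ s) (u : Fin n → ℝ) :
    - (s * l * K) * ∫ v, exp (l * F (c • u + (-s) • v)) ∂(gam n) ≤
      ∫ v, exp (l * F (c • u + (-s) • v)) * ∑ i, D i u * v i ∂(gam n) := by
  have hFc := h.cont
  have hDc := h.hc
  have hs' : |(-s)| ≤ 1 := by rwa [abs_neg]
  set g : (Fin n → ℝ) → ℝ := fun v => exp (l * F (c • u + (-s) • v)) with hg
  have hgc : Continuous g := by fun_prop
  have hgb : ∀ v, |g v| ≤ (exp (l * A) * exp (l * W u)) * exp (l * W v) := fun v => by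
    refine (h.g_le hl _ (W_comb hc hs' u v)).trans_eq ?_
    rw [mul_add, exp_add]; ring
  have hgi : Integrable g (gam n) := int_dom hgc _ _ hgb
  have hgd : ∀ i v, HasDerivAt (fun t => g (Function.update v i t))
      (- (s * l) * (D i (c • u + (-s) • v) * g v)) (v i) := by
    intro i v
    have e1 : HasDerivAt (fun t => c • u + (-s) • Function.update v i t)
        ((-s) • Pi.single i (1:ℝ)) (v i) :=
      ((hasDerivAt_update v i (v i)).const_smul (-s)).const_add _
    have e2 := (h.hF (c • u + (-s) • v))
    have e3 : HasFDerivAt F (∑ j, D j (c • u + (-s) • v) •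
        (ContinuousLinearMap.proj j : (Fin n → ℝ) →L[ℝ] ℝ))
        (c • u + (-s) • Function.update v i (v i)) := by
      rwa [Function.update_eq_self]
    have e4 := ((e3.comp_hasDerivAt (v i) e1).const_mul l).exp
    refine e4.congr_deriv ?_
    simp only [Function.comp, Function.update_eq_self, hg]
    have : (∑ j, D j (c • u + (-s) • v) • (ContinuousLinearMap.proj j : (Fin n → ℝ) →L[ℝ] ℝ))
        ((-s) • Pi.single i (1:ℝ)) = - s * D i (c • u + (-s) • v) := by
      simp [Pi.single_apply]
      ring
    rw [this]; ring
  have hDgb : ∀ i v, |D i (c • u + (-s) • v) * g v| ≤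
      (exp (l * A) * exp (l * W u)) * exp (l * W v) := fun i v => by
    rw [abs_mul, abs_of_nonneg (h.h0 _ _)]
    exact (mul_le_of_le_one_left (abs_nonneg _) (h.h1 _ _)).trans (hgb v)
  set C0 := exp (l * A) * exp (l * W u) with hC0
  have hC0p : 0 < C0 := by positivity
  have st : ∀ i, ∫ v, v i * g v ∂(gam n) =
      ∫ v, - (s * l) * (D i (c • u + (-s) • v) * g v) ∂(gam n) := fun i =>
    stein i (hgd i) hgc (by fun_prop) ((1 + s * l) * C0) l
      (fun v => (hgb v).trans (by
        gcongr; nlinarith [mul_nonneg (mul_nonneg hs0 hl) hC0p.le]))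
      (fun v => by
        rw [abs_mul, abs_neg, abs_of_nonneg (mul_nonneg hs0 hl), mul_assoc]
        have := hDgb i v
        have h2 := mul_nonneg hs0 hl
        have h3 : 0 ≤ C0 * exp (l * W v) := by positivity
        nlinarith [mul_le_mul_of_nonneg_left this h2])
  have hDi : ∀ i, Integrable (fun v => D i (c • u + (-s) • v) * g v) (gam n) := fun i =>
    int_dom (by fun_prop) _ _ (hDgb i)
  have hvi : ∀ i, Integrable (fun v : Fin n → ℝ => v i * g v) (gam n) := fun i =>
    int_dom (by fun_prop) _ _ (fun v => mul_bd (abs_le_W v i) (W_nonneg v) (hgb v))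
  have R : ∫ v, g v * ∑ i, D i u * v i ∂(gam n)
      = ∫ v, ∑ i, D i u * (- (s * l) * (D i (c • u + (-s) • v) * g v)) ∂(gam n) := by
    rw [integral_finsetSum _ (fun i _ => ((hDi i).const_mul _).const_mul _)]
    simp_rw [integral_const_mul (D _ u), ← st, ← integral_const_mul (D _ u)]
    rw [← integral_finsetSum _ (fun i _ => (hvi i).const_mul _)]
    congr 1; ext v; rw [Finset.mul_sum]
    exact Finset.sum_congr rfl fun i _ => by ring
  rw [R, ← integral_const_mul]
  refine integral_mono (hgi.const_mul _)
    (integrable_finsetSum _ (fun i _ => ((hDi i).const_mul _).const_mul _)) fun v => ?_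
  have e : ∑ i, D i u * (- (s * l) * (D i (c • u + (-s) • v) * g v)) =
    - ((s * l) * ((∑ i, D i u * D i (c • u + (-s) • v)) * g v)) := by
    rw [Finset.sum_mul, Finset.mul_sum, ← Finset.sum_neg_distrib]
    exact Finset.sum_congr rfl fun i _ => by ring
  have hle : ∑ i, D i u * D i (c • u + (-s) • v) ≤ K :=
    (Finset.sum_le_sum fun i _ => mul_le_of_le_one_right (h.h0 i u) (h.h1 _ _)).trans (h.hK u)
  show -(s * l * K) * g v ≤ ∑ i, D i u * (- (s * l) * (D i (c • u + (-s) • v) * g v))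
  rw [e]
  have : (s * l) * ((∑ i, D i u * D i (c • u + (-s) • v)) * g v) ≤ (s * l) * (K * g v) := by
    have : 0 ≤ g v := (exp_pos _).le
    gcongr
  linarith

lemma cov (h : Sm F D A K) {l : ℝ} (hl : 0 ≤ l) :
    ∫ x, F x * exp (l * F x) ∂(gam n) ≤
      (∫ x, F x ∂(gam n) + l * K) * ∫ x, exp (l * F x) ∂(gam n) := by
  have hFc := h.cont
  have hDc := h.hc
  have hA := h.hA
  let P := (gam n).prod (gam n)
  let H : ℝ → ((Fin n → ℝ) × (Fin n → ℝ)) → ℝ :=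
    fun θ p => exp (l * F p.1) * F (cos θ • p.1 + sin θ • p.2)
  let H' : ℝ → ((Fin n → ℝ) × (Fin n → ℝ)) → ℝ := fun θ p => exp (l * F p.1) *
    ∑ i, D i (cos θ • p.1 + sin θ • p.2) * ((- sin θ) • p.1 + cos θ • p.2) i
  have W12 : ∀ p : (Fin n → ℝ) × (Fin n → ℝ), 0 ≤ W p.1 + W p.2 :=
    fun p => add_nonneg (W_nonneg _) (W_nonneg _)
  have gb : ∀ p : (Fin n → ℝ) × (Fin n → ℝ),
      |exp (l * F p.1)| ≤ exp (l * A) * exp (l * (W p.1 + W p.2)) := fun p =>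
    h.g_le hl _ (by linarith [W_nonneg p.2])
  have Hi : ∀ θ, Integrable (H θ) P := fun θ => by
    refine int_dom2 (by fun_prop) (exp (l * A) * (A + 1)) (l + 1) fun p => ?_
    have b1 := (h.hb (cos θ • p.1 + sin θ • p.2)).trans
      (add_le_add_right (W_comb (abs_cos_le_one θ) (abs_sin_le_one θ) p.1 p.2) A)
    set w := W p.1 + W p.2 with hw
    have b2 : A + w ≤ (A + 1) * exp w := by
      nlinarith [add_one_le_exp w, W12 p, mul_nonneg hA (W12 p)]
    have : (l + 1) * w = l * w + w := by ring
    rw [abs_mul, this, exp_add]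
    calc _ ≤ (exp (l * A) * exp (l * w)) * ((A + 1) * exp w) := by
          gcongr
          · exact gb p
          · exact b1.trans b2
      _ = _ := by ring
  have H'b : ∀ θ p, ‖H' θ p‖ ≤ exp (l * A) * exp ((l + 1) * (W p.1 + W p.2)) := fun θ p => by
    simp only [H']
    rw [norm_eq_abs, mul_comm (exp (l * F p.1))]
    exact mul_bd ((h.D_sum _ _).trans (W_comb (by rw [abs_neg]; exact abs_sin_le_one θ)
      (abs_cos_le_one θ) _ _)) (W12 p) (gb p)
  have H'c : ∀ θ, Continuous (H' θ) := fun θ => by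
    simp only [H', Pi.add_apply, Pi.smul_apply]
    fun_prop
  have Hd : ∀ θ p, HasDerivAt (fun θ => H θ p) (H' θ p) θ := by
    intro θ p
    have e1 : HasDerivAt (fun θ => cos θ • p.1 + sin θ • p.2)
        ((- sin θ) • p.1 + cos θ • p.2) θ :=
      ((hasDerivAt_cos θ).smul_const p.1).add ((hasDerivAt_sin θ).smul_const p.2)
    refine (((h.hF _).comp_hasDerivAt θ e1).const_mul _).congr_deriv ?_
    simp [H']
  have D1 : ∀ θ, HasDerivAt (fun θ => ∫ p, H θ p ∂P) (∫ p, H' θ p ∂P) θ := fun θ =>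
    (hasDerivAt_integral_of_dominated_loc_of_deriv_le (s := Set.univ) Filter.univ_mem
      (Filter.Eventually.of_forall fun θ => (Hi θ).1) (Hi θ) (H'c θ).aestronglyMeasurable
      (Filter.Eventually.of_forall fun p θ _ => H'b θ p)
      ((int_W2 n (l + 1)).const_mul _)
      (Filter.Eventually.of_forall fun p θ _ => Hd θ p)).2
  set G := ∫ x, exp (l * F x) ∂(gam n) with hG
  have key : ∀ θ, 0 ≤ sin θ → - (sin θ * l * K) * G ≤ ∫ p, H' θ p ∂P := by
    intro θ hs
    have mp : MeasurePreserving (ContinuousLinearMap.rotation (E := Fin n → ℝ) θ) P P :=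
      ⟨by fun_prop, rot n θ⟩
    have back : ∀ p : (Fin n → ℝ) × (Fin n → ℝ),
        cos θ • (cos θ • p.1 + sin θ • p.2) + (- sin θ) • (- sin θ • p.1 + cos θ • p.2) = p.1 := by
      intro p; ext i
      simp only [Pi.add_apply, Pi.smul_apply, smul_eq_mul]
      linear_combination (p.1 i) * (sin_sq_add_cos_sq θ)
    let Ph : ((Fin n → ℝ) × (Fin n → ℝ)) → ℝ := fun q =>
      exp (l * F (cos θ • q.1 + (-sin θ) • q.2)) * ∑ i, D i q.1 * q.2 i
    let g2 : ((Fin n → ℝ) × (Fin n → ℝ)) → ℝ := fun q =>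
      exp (l * F (cos θ • q.1 + (-sin θ) • q.2))
    have g2b : ∀ q, |g2 q| ≤ exp (l * A) * exp (l * (W q.1 + W q.2)) := fun q =>
      h.g_le hl _ (W_comb (abs_cos_le_one θ) (by rw [abs_neg]; exact abs_sin_le_one θ) _ _)
    have Phc : Continuous Ph := by fun_prop
    have g2c : Continuous g2 := by fun_prop
    have Phi : Integrable Ph P := int_dom2 Phc (exp (l * A)) (l + 1) fun q => by
      simp only [Ph]; rw [mul_comm]
      exact mul_bd ((h.D_sum _ _).trans (by linarith [W_nonneg q.1])) (W12 q) (g2b q)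
    have g2i : Integrable g2 P := int_dom2 g2c (exp (l * A)) l g2b
    have r1 : ∫ p, H' θ p ∂P = ∫ q, Ph q ∂P := by
      conv_rhs => rw [← mp.map_eq]
      rw [integral_map mp.measurable.aemeasurable Phc.aestronglyMeasurable]
      congr 1; ext p
      simp only [Ph, H', ContinuousLinearMap.rotation_apply, back]
    have r2 : G = ∫ q, g2 q ∂P := by
      conv_rhs => rw [← mp.map_eq]
      rw [integral_map mp.measurable.aemeasurable g2c.aestronglyMeasurable]
      simp only [g2, ContinuousLinearMap.rotation_apply, back]
      rw [integral_fun_fst (fun x => exp (l * F x))]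
      simp [hG]
    rw [r1, r2, integral_prod _ Phi, integral_prod _ g2i, ← integral_const_mul]
    exact integral_mono (g2i.integral_prod_left.const_mul _) Phi.integral_prod_left
      fun u => h.inner_bd hl (abs_cos_le_one θ) (abs_sin_le_one θ) hs u
  have mono : MonotoneOn (fun θ => ∫ p, H θ p ∂P - cos θ * (l * K * G)) (Set.Icc 0 (π / 2)) := by
    have dd : ∀ θ, HasDerivAt (fun θ => ∫ p, H θ p ∂P - cos θ * (l * K * G))
        (∫ p, H' θ p ∂P - (- sin θ) * (l * K * G)) θ := fun θ =>
      (D1 θ).sub ((hasDerivAt_cos θ).mul_const _)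
    refine monotoneOn_of_deriv_nonneg (convex_Icc _ _)
      (fun θ _ => (dd θ).continuousAt.continuousWithinAt)
      (fun θ _ => (dd θ).differentiableAt.differentiableWithinAt) fun θ hθ => ?_
    rw [interior_Icc] at hθ
    rw [(dd θ).deriv]
    have := key θ (sin_nonneg_of_nonneg_of_le_pi hθ.1.le (by linarith [hθ.2, pi_pos]))
    linarith
  have fin := mono (Set.left_mem_Icc.2 (by positivity)) (Set.right_mem_Icc.2 (by positivity))
    (by positivity : (0:ℝ) ≤ π / 2)
  simp only [H, cos_zero, sin_zero, cos_pi_div_two, sin_pi_div_two, one_smul, zero_smul, add_zero,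
    zero_add, one_mul, zero_mul, sub_zero] at fin
  have f1 : ∫ p, exp (l * F p.1) * F p.1 ∂P = ∫ x, F x * exp (l * F x) ∂(gam n) := by
    rw [integral_fun_fst (fun x => exp (l * F x) * F x)]
    simp [mul_comm]
  have f2 : ∫ p, exp (l * F p.1) * F p.2 ∂P = G * ∫ x, F x ∂(gam n) :=
    integral_prod_mul (fun x => exp (l * F x)) F
  rw [f1, f2] at fin
  linarith

lemma int_exp (h : Sm F D A K) (l : ℝ) : Integrable (fun x => exp (l * F x)) (gam n) := by
  have := h.cont
  refine int_dom (by fun_prop) (exp (|l| * A)) |l| fun x => ?_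
  rw [abs_of_pos (exp_pos _), ← exp_add, ← mul_add]
  refine exp_le_exp.2 ((le_abs_self _).trans ?_)
  rw [abs_mul]
  exact mul_le_mul_of_nonneg_left (h.hb x) (abs_nonneg _)

lemma mgf_bd (h : Sm F D A K) {l : ℝ} (hl : 0 ≤ l) :
    ∫ x, exp (l * F x) ∂(gam n) ≤ exp (l * ∫ x, F x ∂(gam n) + l ^ 2 * K / 2) := by
  set m := ∫ x, F x ∂(gam n) with hm
  have hset : integrableExpSet F (gam n) = Set.univ := by
    ext t; simpa [integrableExpSet] using h.int_exp t
  have d : ∀ t, HasDerivAt (mgf F (gam n)) (∫ x, F x * exp (t * F x) ∂(gam n)) t := fun t =>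
    hasDerivAt_mgf (by rw [hset]; simp)
  have d2 : ∀ t, HasDerivAt (fun t => mgf F (gam n) t * exp (- (t * m + t ^ 2 * K / 2)))
      ((∫ x, F x * exp (t * F x) ∂(gam n)) * exp (- (t * m + t ^ 2 * K / 2)) +
        mgf F (gam n) t * (exp (- (t * m + t ^ 2 * K / 2)) * (- (m + t * K)))) t := by
    intro t
    refine (d t).mul (HasDerivAt.exp ?_)
    have := (((hasDerivAt_id t).mul_const m).add
      (((hasDerivAt_pow 2 t).mul_const K).div_const 2)).neg
    refine this.congr_deriv ?_
    simp; ring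
  have anti : AntitoneOn (fun t => mgf F (gam n) t * exp (- (t * m + t ^ 2 * K / 2)))
      (Set.Ici 0) := by
    refine antitoneOn_of_deriv_nonpos (convex_Ici _)
      (fun θ _ => (d2 θ).continuousAt.continuousWithinAt)
      (fun θ _ => (d2 θ).differentiableAt.differentiableWithinAt) fun t ht => ?_
    rw [interior_Ici] at ht
    rw [(d2 t).deriv]
    have c := h.cov (le_of_lt ht)
    rw [← hm] at c
    have e := exp_pos (- (t * m + t ^ 2 * K / 2))
    have : mgf F (gam n) t = ∫ x, exp (t * F x) ∂(gam n) := rfl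
    rw [this]
    nlinarith [mul_le_mul_of_nonneg_right c e.le]
  have := anti (Set.self_mem_Ici) (Set.mem_Ici.2 hl) hl
  simp only [mgf_zero, zero_mul, ne_eq, OfNat.ofNat_ne_zero, not_false_eq_true, zero_pow,
    zero_div, add_zero, neg_zero, exp_zero, mul_one] at this
  rw [exp_neg, ← div_eq_mul_inv, div_le_one (exp_pos _)] at this
  exact this

end Sm

section soft
variable {n : ℕ} (C : Finset (Finset (Fin n))) (b : ℝ)

noncomputable def XS (S : Finset (Fin n)) (x : Fin n → ℝ) : ℝ := ∑ i ∈ S, x i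
noncomputable def Z (x : Fin n → ℝ) : ℝ := ∑ S ∈ C, exp (b * XS S x)
noncomputable def sF (x : Fin n → ℝ) : ℝ := log (Z C b x) / b
noncomputable def sD (i : Fin n) (x : Fin n → ℝ) : ℝ :=
  (∑ S ∈ C, exp (b * XS S x) * (if i ∈ S then 1 else 0)) / Z C b x

lemma XS_le (S : Finset (Fin n)) (x : Fin n → ℝ) : |XS S x| ≤ W x := by
  unfold XS W
  exact (Finset.abs_sum_le_sum_abs _ _).trans
    (Finset.sum_le_univ_sum_of_nonneg fun _ => abs_nonneg _)

lemma continuous_XS (S : Finset (Fin n)) : Continuous (XS S) := by unfold XS; fun_prop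

variable {C b}

lemma Z_pos (hC : C.Nonempty) (x : Fin n → ℝ) : 0 < Z C b x :=
  Finset.sum_pos (fun _ _ => exp_pos _) hC

lemma le_sF (hC : C.Nonempty) (hb : 0 < b) {S} (hS : S ∈ C) (x : Fin n → ℝ) :
    XS S x ≤ sF C b x := by
  unfold sF
  rw [le_div_iff₀ hb, le_log_iff_exp_le (Z_pos hC x), mul_comm]
  exact Finset.single_le_sum (f := fun S => exp (b * XS S x)) (fun _ _ => (exp_pos _).le) hS

lemma sF_le (hC : C.Nonempty) (hb : 0 < b) {x : Fin n → ℝ} {m : ℝ} (hm : ∀ S ∈ C, XS S x ≤ m) :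
    sF C b x ≤ log C.card / b + m := by
  have hc : (0:ℝ) < C.card := by exact_mod_cast hC.card_pos
  have : Z C b x ≤ C.card * exp (b * m) := by
    unfold Z
    rw [← nsmul_eq_mul]
    refine Finset.sum_le_card_nsmul _ _ _ fun S hS => ?_
    have := hm S hS
    gcongr
  have := log_le_log (Z_pos hC x) this
  rw [log_mul hc.ne' (exp_pos _).ne', log_exp] at this
  unfold sF
  rw [div_le_iff₀ hb, add_mul, div_mul_cancel₀ _ hb.ne']
  linarith

lemma sm (hC : C.Nonempty) (hb : 0 < b) {K : ℕ} (hK : ∀ S ∈ C, S.card = K) :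
    Sm (sF C b) (sD C b) (log C.card / b) K where
  hF x := by
    have hz := (Z_pos (b := b) hC x).ne'
    have h1 : ∀ S, HasFDerivAt (XS S)
        (∑ i ∈ S, (ContinuousLinearMap.proj i : (Fin n → ℝ) →L[ℝ] ℝ)) x := fun S => by
      unfold XS
      exact HasFDerivAt.fun_sum fun i _ =>
        (ContinuousLinearMap.proj i : (Fin n → ℝ) →L[ℝ] ℝ).hasFDerivAt
    have h2 : HasFDerivAt (Z C b) (∑ S ∈ C, exp (b * XS S x) • b •
        (∑ i ∈ S, (ContinuousLinearMap.proj i : (Fin n → ℝ) →L[ℝ] ℝ))) x := by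
      unfold Z
      exact HasFDerivAt.fun_sum fun S _ => ((h1 S).const_mul b).exp
    have h3 := (h2.log hz).mul_const b⁻¹
    have e : sF C b = fun x => log (Z C b x) * b⁻¹ := by ext; simp [sF, div_eq_mul_inv]
    rw [e]
    refine h3.congr_fderiv ?_
    ext v
    simp only [sD, sum_apply, smul_apply, ContinuousLinearMap.proj_apply, smul_eq_mul]
    have e2 : ∀ S : Finset (Fin n), ∑ i ∈ S, v i = ∑ i, (if i ∈ S then 1 else 0) * v i := by
      intro S; simp
    simp_rw [e2, Finset.sum_div, Finset.sum_mul]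
    rw [Finset.sum_comm, Finset.mul_sum, Finset.mul_sum]
    refine Finset.sum_congr rfl fun S _ => ?_
    simp_rw [Finset.mul_sum]
    refine Finset.sum_congr rfl fun i _ => ?_
    field_simp
  hc i := by
    have := fun S => continuous_XS (n := n) S
    unfold sD
    refine Continuous.div ?_ ?_ fun x => (Z_pos hC x).ne'
    · fun_prop
    · unfold Z; fun_prop
  h0 i x := div_nonneg (Finset.sum_nonneg fun S _ => by positivity) (Z_pos hC x).le
  h1 i x := by
    unfold sD
    rw [div_le_one (Z_pos hC x)]
    refine Finset.sum_le_sum fun S _ => mul_le_of_le_one_right (exp_pos _).le ?_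
    split_ifs <;> simp
  hK x := by
    unfold sD
    rw [← Finset.sum_div, div_le_iff₀ (Z_pos hC x), Finset.sum_comm]
    unfold Z
    rw [Finset.mul_sum]
    refine Finset.sum_le_sum fun S hS => ?_
    rw [← Finset.mul_sum]
    simp [hK S hS, mul_comm]
  hA := div_nonneg (log_natCast_nonneg _) hb.le
  hb x := by
    have h0 : 0 ≤ log (C.card : ℝ) / b := div_nonneg (log_natCast_nonneg _) hb.le
    rw [abs_le]
    constructor
    · obtain ⟨S, hS⟩ := hC
      have := le_sF ⟨S, hS⟩ hb hS x
      have := (abs_le.1 (XS_le S x)).1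
      linarith
    · exact sF_le hC hb fun S _ => (abs_le.1 (XS_le S x)).2

noncomputable def Mx (C : Finset (Finset (Fin n))) (x : Fin n → ℝ) : ℝ :=
  ⨆ S : C, XS (S : Finset (Fin n)) x

lemma le_Mx {S} (hS : S ∈ C) (x : Fin n → ℝ) : XS S x ≤ Mx C x :=
  le_ciSup (f := fun S : C => XS (S : Finset (Fin n)) x) (Set.finite_range _).bddAbove ⟨S, hS⟩

lemma Mx_le (hC : C.Nonempty) {x : Fin n → ℝ} {m : ℝ} (h : ∀ S ∈ C, XS S x ≤ m) : Mx C x ≤ m := by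
  have := hC.to_subtype
  exact ciSup_le fun S => h S S.2

lemma abs_Mx (hC : C.Nonempty) (x : Fin n → ℝ) : |Mx C x| ≤ W x := by
  rw [abs_le]
  constructor
  · obtain ⟨S, hS⟩ := hC
    exact ((abs_le.1 (XS_le S x)).1).trans (le_Mx hS x)
  · exact Mx_le hC fun S _ => (abs_le.1 (XS_le S x)).2

lemma meas_Mx : Measurable (Mx C) := by
  unfold Mx
  exact Measurable.iSup fun S => (continuous_XS _).measurable

lemma int_Mx (hC : C.Nonempty) : Integrable (Mx C) (gam n) := by
  refine (int_W n 1).mono' meas_Mx.aestronglyMeasurable (Filter.Eventually.of_forall fun x => ?_)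
  refine (abs_Mx hC x).trans ?_
  linarith [add_one_le_exp (1 * W x)]

lemma int_exp_Mx (hC : C.Nonempty) {l : ℝ} (hl : 0 ≤ l) :
    Integrable (fun x => exp (l * Mx C x)) (gam n) := by
  refine (int_W n l).mono' (meas_Mx.const_mul l).exp.aestronglyMeasurable
    (Filter.Eventually.of_forall fun x => ?_)
  rw [norm_eq_abs, abs_of_pos (exp_pos _)]
  have := (le_abs_self _).trans (abs_Mx hC x)
  gcongr

lemma mgf_Mx (hC : C.Nonempty) {K : ℕ} (hK : ∀ S ∈ C, S.card = K) {l : ℝ} (hl : 0 ≤ l) :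
    mgf (Mx C) (gam n) l ≤ exp (l * ∫ x, Mx C x ∂(gam n) + l ^ 2 * K / 2) := by
  have key : ∀ b : ℝ, 0 < b → mgf (Mx C) (gam n) l ≤
      exp (l * (log C.card / b + ∫ x, Mx C x ∂(gam n)) + l ^ 2 * K / 2) := by
    intro b hb
    have h := sm hC hb hK
    have i1 : Integrable (sF C b) (gam n) :=
      int_dom h.cont (log C.card / b + 1) 1 fun x => by
        refine (h.hb x).trans ?_
        have := add_one_le_exp (W x)
        rw [one_mul]
        nlinarith [W_nonneg x, h.hA, mul_nonneg h.hA (W_nonneg x)]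
    refine (integral_mono (int_exp_Mx hC hl) (h.int_exp l) fun x => ?_).trans
      ((h.mgf_bd hl).trans ?_)
    · have := Mx_le hC (x := x) fun S hS => le_sF hC hb hS x
      show exp _ ≤ exp _
      gcongr
    · have : ∫ x, sF C b x ∂(gam n) ≤ ∫ x, (log C.card / b + Mx C x) ∂(gam n) :=
        integral_mono i1 ((integrable_const _).add (int_Mx hC)) fun x =>
          sF_le hC hb fun S hS => le_Mx hS x
      rw [integral_add (integrable_const _) (int_Mx hC)] at this
      simp only [integral_const, probReal_univ, one_smul] at this
      gcongr
  have lim : Filter.Tendsto (fun b : ℝ =>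
      exp (l * (log C.card / b + ∫ x, Mx C x ∂(gam n)) + l ^ 2 * K / 2)) Filter.atTop
      (nhds (exp (l * (0 + ∫ x, Mx C x ∂(gam n)) + l ^ 2 * K / 2))) := by
    refine (Real.continuous_exp.tendsto _).comp ?_
    refine Filter.Tendsto.add_const _ (Filter.Tendsto.const_mul _ (Filter.Tendsto.add_const _ ?_))
    exact Filter.Tendsto.const_div_atTop Filter.tendsto_id _
  rw [zero_add] at lim
  exact ge_of_tendsto lim ((Filter.eventually_gt_atTop 0).mono key)

lemma null_tail (hC : C.Nonempty) {K : ℕ} (hK0 : 0 < K) (hK : ∀ S ∈ C, S.card = K) {t : ℝ}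
    (ht : 0 ≤ t) :
    (gam n).real {x | ∫ x, Mx C x ∂(gam n) + t ≤ Mx C x} ≤ exp (- t ^ 2 / (2 * K)) := by
  have hk : (0:ℝ) < K := by exact_mod_cast hK0
  have hl : 0 ≤ t / K := by positivity
  refine (measure_ge_le_exp_mul_mgf _ hl (int_exp_Mx hC hl)).trans ?_
  refine (mul_le_mul_of_nonneg_left (mgf_Mx hC hK hl) (exp_pos _).le).trans_eq ?_
  rw [← exp_add]
  congr 1
  field_simp
  ring

lemma alt_tail {S : Finset (Fin n)} {K : ℕ} (hK0 : 0 < K) (hK : S.card = K) {t m : ℝ}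
    (ht : 0 ≤ t) :
    (Measure.pi fun i => gaussianReal (if i ∈ S then m else 0) 1).real
      {x | XS S x ≤ m * K - t} ≤ exp (- t ^ 2 / (2 * K)) := by
  have hk : (0:ℝ) < K := by exact_mod_cast hK0
  have hl : 0 ≤ t / K := by positivity
  set Q := Measure.pi fun i : Fin n => gaussianReal (if i ∈ S then m else 0) 1 with hQ
  set l := t / K with hldef
  have e : ∀ x : Fin n → ℝ, exp (-l * XS S x) = ∏ i, exp ((if i ∈ S then -l else 0) * x i) := by
    intro x
    rw [← exp_sum, XS, Finset.mul_sum]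
    congr 1
    simp [Finset.sum_ite_mem]
  have hi : Integrable (fun x => exp (-l * XS S x)) Q := by
    simp_rw [e]
    exact Integrable.fintype_prod (f := fun i z => exp ((if i ∈ S then -l else 0) * z))
      fun i => integrable_exp_mul_gaussianReal _
  have hm : mgf (XS S) Q (-l) = exp (K * (- l * m + l ^ 2 / 2)) := by
    unfold mgf
    simp_rw [e]
    rw [hQ, integral_fintype_prod_eq_prod (fun i z => exp ((if i ∈ S then -l else 0) * z))]
    have : ∀ i, ∫ z, exp ((if i ∈ S then -l else 0) * z)
        ∂(gaussianReal (if i ∈ S then m else 0) 1) =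
        exp (if i ∈ S then (-l * m + l ^ 2 / 2) else 0) := by
      intro i
      have := mgf_gaussianReal (p := gaussianReal (if i ∈ S then m else 0) 1)
        (X := id) (μ := if i ∈ S then m else 0) (v := 1) Measure.map_id (if i ∈ S then -l else 0)
      simp only [mgf, id] at this
      rw [this]
      split_ifs <;> simp <;> ring
    simp_rw [this]
    rw [← exp_sum]
    congr 1
    simp [Finset.sum_ite_mem, hK]
    ring
  refine (measure_le_le_exp_mul_mgf (m * K - t) (neg_nonpos.2 hl) hi).trans_eq ?_
  rw [hm, ← exp_add]
  congr 1
  rw [hldef]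
  field_simp
  ring

end soft

end ScanAux

/-- **Risk bound for the scan test via Gaussian concentration**
(Tanguy, Proposition 5.1 / `Lug`, after Addario-Berry–Broutin–Devroye–Lugosi).
Under `P_0` the coordinates are i.i.d. standard normal; under the alternative `P_S`
(`S ∈ 𝒞`, all of cardinality `K`) the coordinates in `S` have mean `μ > 0`. The scan test
rejects iff `2 max_{S ∈ 𝒞} X_S ≥ μ K + E_0[max_{S ∈ 𝒞} X_S]` where `X_S = ∑_{i ∈ S} X_i`.
Then for `δ ∈ (0,1)`, the risk satisfies `R(f) ≤ δ` whenever
`μ ≥ (1/K) E_0[max_{S ∈ 𝒞} X_S] + 2 √((2/K) log(2/δ))`. -/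
theorem scan_test_risk_bound_gaussian_concentration
    (n N K : ℕ) (hK : 0 < K) (hN : 0 < N)
    (𝒞 : Finset (Finset (Fin n))) (h𝒞card : 𝒞.card = N)
    (hcard : ∀ S ∈ 𝒞, S.card = K)
    (μ : ℝ) (hμ : 0 < μ)
    (P0 : Measure (Fin n → ℝ))
    (hP0 : P0 = Measure.pi fun _ => gaussianReal 0 1)
    (PS : Finset (Fin n) → Measure (Fin n → ℝ))
    (hPS : ∀ S, PS S = Measure.pi fun i => gaussianReal (if i ∈ S then μ else 0) 1)
    -- `max_{S ∈ 𝒞} X_S` and its expectation under the null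
    (maxC : (Fin n → ℝ) → ℝ)
    (hmaxC : ∀ x, maxC x = ⨆ S : 𝒞, ∑ i ∈ (S : Finset (Fin n)), x i)
    (E0 : ℝ) (hE0 : E0 = ∫ x, maxC x ∂P0)
    (δ : ℝ) (hδ : δ ∈ Set.Ioo (0 : ℝ) 1)
    (hμbound : (1 / K) * E0 + 2 * Real.sqrt ((2 / K) * Real.log (2 / δ)) ≤ μ) :
    (P0 {x | μ * K + E0 ≤ 2 * maxC x}).toReal +
      (1 / N) * ∑ S ∈ 𝒞, (PS S {x | 2 * maxC x < μ * K + E0}).toReal ≤ δ := by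
  have hk : (0:ℝ) < K := by exact_mod_cast hK
  have hn : (0:ℝ) < N := by exact_mod_cast hN
  have hC : 𝒞.Nonempty := Finset.card_pos.1 (by omega)
  have hM : maxC = ScanAux.Mx 𝒞 := funext hmaxC
  have hg : P0 = ScanAux.gam n := hP0
  subst hM hg
  obtain ⟨hδ0, hδ1⟩ := hδ
  set t := K * Real.sqrt ((2 / K) * Real.log (2 / δ)) with ht
  have hlog : 0 ≤ Real.log (2 / δ) := Real.log_nonneg (by rw [le_div_iff₀ hδ0]; linarith)
  have ht0 : 0 ≤ t := by positivity
  have hexp : Real.exp (- t ^ 2 / (2 * K)) = δ / 2 := by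
    have : - t ^ 2 / (2 * K) = - Real.log (2 / δ) := by
      rw [ht, mul_pow, Real.sq_sqrt (by positivity)]
      field_simp
    rw [this, Real.exp_neg, Real.exp_log (by positivity), inv_div]
  have hb : E0 + 2 * t ≤ μ * K := by
    have := mul_le_mul_of_nonneg_right hμbound hk.le
    have e : ((1 / K) * E0 + 2 * Real.sqrt ((2 / K) * Real.log (2 / δ))) * K = E0 + 2 * t := by
      rw [ht]; field_simp
    linarith
  have h1 : (ScanAux.gam n {x | μ * K + E0 ≤ 2 * ScanAux.Mx 𝒞 x}).toReal ≤ δ / 2 := by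
    rw [← hexp]
    refine le_trans (measureReal_mono ?_) (ScanAux.null_tail hC hK hcard ht0)
    intro x hx
    simp only [Set.mem_setOf_eq] at hx ⊢
    rw [← hE0]
    linarith
  have h2 : ∀ S ∈ 𝒞, (PS S {x | 2 * ScanAux.Mx 𝒞 x < μ * K + E0}).toReal ≤ δ / 2 := by
    intro S hS
    rw [← hexp, hPS S]
    refine le_trans (measureReal_mono ?_) (ScanAux.alt_tail (m := μ) hK (hcard S hS) ht0)
    intro x hx
    simp only [Set.mem_setOf_eq] at hx ⊢
    have := ScanAux.le_Mx hS x
    linarith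
  have h3 := Finset.sum_le_card_nsmul _ _ _ h2
  rw [h𝒞card, nsmul_eq_mul] at h3
  have h4 : (1 / (N:ℝ)) * ∑ S ∈ 𝒞, (PS S {x | 2 * ScanAux.Mx 𝒞 x < μ * K + E0}).toReal ≤ δ / 2 := by
    rw [one_div, inv_mul_le_iff₀ hn]
    exact h3
  linarith
end

section
/- Let (X_i)_{i≥0} be a centered stationary Gaussian sequence with E[X_i²] = 1 and covariance Cov(X_i,X_j) = φ(|i−j|), where φ : ℕ → ℝ is non-increasing with φ(1) < 1/2 and φ(n) log n → 0 as n → ∞. Let a_n = (2 log n)^{1/2} and b_n = (2 log n)^{1/2} − (1/2)(2 log n)^{−1/2}(log log n + log 4π). Then sup_{n≥3} E[ a_n |M_n − b_n| ] < ∞, where M_n = max_{1≤i≤n} X_i. -/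
open MeasureTheory ProbabilityTheory Real Filter

section Aux

open scoped ENNReal Pointwise MatrixOrder

lemma aux_bm_compact (A B C : Set ℝ) (hA : IsCompact A) (hB : IsCompact B) (hA' : A.Nonempty)
    (hB' : B.Nonempty) (h : ∀ a ∈ A, ∀ b ∈ B, (a + b) / 2 ∈ C) :
    volume A + volume B ≤ 2 * volume C := by
  obtain ⟨a, haA, ha⟩ := hA.exists_isGreatest hA'
  obtain ⟨b, hbB, hb⟩ := hB.exists_isLeast hB'
  set S := (fun x : ℝ => x + b) '' A
  set T := (fun x : ℝ => x + a) '' B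
  have hS : volume S = volume A := by
    simp only [S, Set.image_add_right, measure_preimage_add_right]
  have hT : volume T = volume B := by
    simp only [T, Set.image_add_right, measure_preimage_add_right]
  have hdis : AEDisjoint volume S T := by
    refine measure_mono_null (t := {a + b}) ?_ (by simp)
    rintro x ⟨⟨y, hy, rfl⟩, ⟨z, hz, hzx⟩⟩
    have h1 := ha hy
    have h2 := hb hz
    simp only [Set.mem_singleton_iff] at *
    linarith
  have hTm : MeasurableSet T := by
    have : IsCompact T := hB.image (by fun_prop)
    exact this.measurableSet
  have hU : volume (S ∪ T) = volume A + volume B := by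
    rw [measure_union₀ hTm.nullMeasurableSet hdis, hS, hT]
  rw [← hU]
  have hsub : S ∪ T ⊆ (fun x : ℝ => 2 * x) '' C := by
    rintro x (⟨y, hy, rfl⟩ | ⟨y, hy, rfl⟩)
    · exact ⟨_, h y hy b hbB, by ring⟩
    · exact ⟨_, h a haA y hy, by ring⟩
  refine (measure_mono hsub).trans ?_
  have := Measure.addHaar_image_homothety (volume : Measure ℝ) 0 2 C
  have h2 := Measure.addHaar_smul (volume : Measure ℝ) (2:ℝ) C
  have h3 : (fun x : ℝ => 2 * x) '' C = (2:ℝ) • C := rfl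
  rw [h3, h2]
  simp

lemma aux_bm (A B C : Set ℝ) (hA : MeasurableSet A) (hB : MeasurableSet B) (hA' : A.Nonempty)
    (hB' : B.Nonempty) (h : ∀ a ∈ A, ∀ b ∈ B, (a + b) / 2 ∈ C) :
    volume A + volume B ≤ 2 * volume C := by
  obtain ⟨a, ha⟩ := hA'
  obtain ⟨b, hb⟩ := hB'
  have key : ∀ (A : Set ℝ) (hA : MeasurableSet A) (a : ℝ) (ha : a ∈ A) (r : ℝ≥0∞),
      r < volume A → ∃ K ⊆ A, IsCompact K ∧ K.Nonempty ∧ r < volume K := by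
    intro A hA a ha r hr
    obtain ⟨K, hK1, hK2, hK3⟩ := hA.exists_lt_isCompact hr
    refine ⟨insert a K, Set.insert_subset ha hK1, hK2.insert a, ⟨a, by simp⟩, ?_⟩
    exact hK3.trans_le (measure_mono (Set.subset_insert _ _))
  have key2 : ∀ r < volume A, ∀ s < volume B, r + s ≤ 2 * volume C := by
    intro r hr s hs
    obtain ⟨K, k1, k2, k3, k4⟩ := key A hA a ha r hr
    obtain ⟨L, l1, l2, l3, l4⟩ := key B hB b hb s hs
    refine (add_le_add k4.le l4.le).trans (aux_bm_compact K L C k2 l2 k3 l3 ?_)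
    intro x hx y hy
    exact h x (k1 hx) y (l1 hy)
  have hmon : ∀ (A C : Set ℝ), A ⊆ C → volume A ≤ volume C := fun _ _ h => measure_mono h
  by_cases hA0 : volume A = 0
  · by_cases hB0 : volume B = 0
    · simp [hA0, hB0]
    · rw [hA0, zero_add]
      refine le_of_forall_lt_imp_le_of_dense fun s hs => ?_
      obtain ⟨L, l1, l2, l3, l4⟩ := key B hB b hb s hs
      have := aux_bm_compact {a} L C isCompact_singleton l2 (by simp) l3 (by
        rintro x hx y hy; rw [Set.mem_singleton_iff.1 hx]; exact h a ha y (l1 hy))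
      exact l4.le.trans (le_add_self.trans this)
  · by_cases hB0 : volume B = 0
    · rw [hB0, add_zero]
      refine le_of_forall_lt_imp_le_of_dense fun s hs => ?_
      obtain ⟨L, l1, l2, l3, l4⟩ := key A hA a ha s hs
      have := aux_bm_compact L {b} C l2 isCompact_singleton l3 (by simp) (by
        rintro x hx y hy; rw [Set.mem_singleton_iff.1 hy]; exact h x (l1 hx) b hb)
      exact l4.le.trans (le_self_add.trans this)
    · have h1 : ∀ r < volume A, r + volume B ≤ 2 * volume C := by
        intro r hr
        have hB1 : volume B ≤ 2 * volume C - r := by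
          refine le_of_forall_lt_imp_le_of_dense fun s hs => ?_
          exact ENNReal.le_sub_of_add_le_left hr.ne_top (key2 r hr s hs)
        have hr' : r ≤ 2 * volume C :=
          le_self_add.trans (key2 r hr 0 (pos_iff_ne_zero.2 hB0))
        calc r + volume B ≤ r + (2 * volume C - r) := by gcongr
          _ = _ := add_tsub_cancel_of_le hr'
      by_cases hBt : volume B = ∞
      · have := h1 0 (pos_iff_ne_zero.2 hA0)
        rw [hBt] at this ⊢
        simp at this
        simp [this]
      · have hA1 : volume A ≤ 2 * volume C - volume B := by
          refine le_of_forall_lt_imp_le_of_dense fun s hs => ?_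
          exact ENNReal.le_sub_of_add_le_right hBt (h1 s hs)
        have hr' : volume B ≤ 2 * volume C :=
          le_add_self.trans (h1 0 (pos_iff_ne_zero.2 hA0))
        calc volume A + volume B ≤ (2 * volume C - volume B) + volume B := by gcongr
          _ = _ := tsub_add_cancel_of_le hr'

lemma aux_pl0 (f g h : ℝ → ℝ) (hf : Measurable f) (hg : Measurable g) (hh : Measurable h)
    (f0 : ∀ x, 0 ≤ f x) (g0 : ∀ x, 0 ≤ g x) (h0 : ∀ x, 0 ≤ h x)
    (f1 : ∀ x, f x ≤ 1) (g1 : ∀ x, g x ≤ 1)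
    (f2 : ∀ t < 1, ∃ x, t < f x) (g2 : ∀ t < 1, ∃ x, t < g x)
    (H : ∀ x y, f x * g y ≤ h ((x + y) / 2) ^ 2) :
    (∫⁻ x, ENNReal.ofReal (f x)) + ∫⁻ x, ENNReal.ofReal (g x)
      ≤ 2 * ∫⁻ x, ENNReal.ofReal (h x) := by
  rw [lintegral_eq_lintegral_meas_lt _ (.of_forall f0) hf.aemeasurable,
    lintegral_eq_lintegral_meas_lt _ (.of_forall g0) hg.aemeasurable,
    lintegral_eq_lintegral_meas_lt _ (.of_forall h0) hh.aemeasurable]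
  have hanti : ∀ f : ℝ → ℝ, Measurable fun t : ℝ => volume {a : ℝ | t < f a} := by
    intro f
    refine Antitone.measurable fun s t hst => measure_mono fun a ha => ?_
    exact lt_of_le_of_lt hst ha
  rw [← lintegral_add_left (hanti f), ← lintegral_const_mul _ (hanti h)]
  refine setLIntegral_mono ((hanti h).const_mul 2) ?_
  intro t ht
  by_cases h1 : t < 1
  · refine aux_bm _ _ _ (measurableSet_lt measurable_const hf)
      (measurableSet_lt measurable_const hg) (f2 t h1) (g2 t h1) ?_
    intro a ha b hb
    have ha' : t < f a := ha
    have hb' : t < g b := hb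
    have ht' : 0 < t := ht
    have := H a b
    change t < h ((a + b) / 2)
    have h2 : t ^ 2 < f a * g b := by nlinarith
    exact lt_of_pow_lt_pow_left₀ 2 (h0 _) (h2.trans_le this)
  · have e1 : {a | t < f a} = ∅ := by
      ext x; simp only [Set.mem_ofPred_eq, Set.mem_empty_iff_false, iff_false, not_lt]
      exact (f1 x).trans (not_lt.1 h1)
    have e2 : {a | t < g a} = ∅ := by
      ext x; simp only [Set.mem_ofPred_eq, Set.mem_empty_iff_false, iff_false, not_lt]
      exact (g1 x).trans (not_lt.1 h1)
    simp [e1, e2]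

lemma aux_pl1 (f g h : ℝ → ℝ) (hf : Measurable f) (hg : Measurable g) (hh : Measurable h)
    (f0 : ∀ x, 0 ≤ f x) (g0 : ∀ x, 0 ≤ g x) (h0 : ∀ x, 0 ≤ h x)
    (f1 : ∀ x, f x ≤ 1) (g1 : ∀ x, g x ≤ 1)
    (H : ∀ x y, f x * g y ≤ h ((x + y) / 2) ^ 2) :
    (∫⁻ x, ENNReal.ofReal (f x)) * ∫⁻ x, ENNReal.ofReal (g x)
      ≤ (∫⁻ x, ENNReal.ofReal (h x)) ^ 2 := by
  have key : ∀ f : ℝ → ℝ, (∀ x, 0 ≤ f x) → (∀ x, f x ≤ 1) →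
      (∫⁻ x, ENNReal.ofReal (f x)) = 0 ∨ ∃ α > 0, (∀ x, f x ≤ α) ∧ ∀ t < α, ∃ x, t < f x := by
    intro f f0 f1
    have hb : BddAbove (Set.range f) := ⟨1, by rintro _ ⟨x, rfl⟩; exact f1 x⟩
    rcases (le_ciSup_of_le hb 0 (f0 0)).eq_or_lt with h | h
    · left
      have : ∀ x, f x = 0 := fun x => le_antisymm (h ▸ le_ciSup hb x) (f0 x)
      simp [this]
    · right
      exact ⟨_, h, fun x => le_ciSup hb x, fun t ht => exists_lt_of_lt_ciSup ht⟩
  rcases key f f0 f1 with hf' | ⟨α, hα, fα, fα'⟩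
  · simp [hf']
  rcases key g g0 g1 with hg' | ⟨β, hβ, gβ, gβ'⟩
  · simp [hg']
  have hs : 0 < √(α * β) := by positivity
  have hss : √(α * β) ^ 2 = α * β := Real.sq_sqrt (by positivity)
  have := aux_pl0 (fun x => α⁻¹ * f x) (fun x => β⁻¹ * g x) (fun x => (√(α * β))⁻¹ * h x)
    (by fun_prop) (by fun_prop) (by fun_prop)
    (fun x => mul_nonneg (by positivity) (f0 x)) (fun x => mul_nonneg (by positivity) (g0 x))
    (fun x => mul_nonneg (by positivity) (h0 x))
    (fun x => by rw [inv_mul_le_iff₀ hα]; simpa using fα x)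
    (fun x => by rw [inv_mul_le_iff₀ hβ]; simpa using gβ x)
    (fun t ht => by
      obtain ⟨x, hx⟩ := fα' (α * t) (by nlinarith)
      exact ⟨x, by rwa [lt_inv_mul_iff₀ hα]⟩)
    (fun t ht => by
      obtain ⟨x, hx⟩ := gβ' (β * t) (by nlinarith)
      exact ⟨x, by rwa [lt_inv_mul_iff₀ hβ]⟩)
    (fun x y => by
      have := H x y
      rw [mul_pow, inv_pow, hss]
      calc α⁻¹ * f x * (β⁻¹ * g y) = (α * β)⁻¹ * (f x * g y) := by rw [mul_inv]; ring
        _ ≤ _ := by gcongr)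
  simp_rw [ENNReal.ofReal_mul (inv_pos.2 hα).le, ENNReal.ofReal_mul (inv_pos.2 hβ).le,
    ENNReal.ofReal_mul (inv_pos.2 hs).le] at this
  rw [lintegral_const_mul _ (by fun_prop), lintegral_const_mul _ (by fun_prop),
    lintegral_const_mul _ (by fun_prop)] at this
  set I := ∫⁻ x, ENNReal.ofReal (f x)
  set J := ∫⁻ x, ENNReal.ofReal (g x)
  set K := ∫⁻ x, ENNReal.ofReal (h x)
  by_cases hK : K = ∞
  · simp [hK]
  have hR : 2 * (ENNReal.ofReal (√(α * β))⁻¹ * K) ≠ ∞ :=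
    ENNReal.mul_ne_top (by simp) (ENNReal.mul_ne_top (by simp) hK)
  have hI : I ≠ ∞ := by
    intro hI
    rw [hI, ENNReal.mul_top (by simpa using hα)] at this
    simp at this
    exact hR this
  have hJ : J ≠ ∞ := by
    intro hJ
    rw [hJ, ENNReal.mul_top (by simpa using hβ)] at this
    simp at this
    exact hR this
  have h3 := ENNReal.toReal_mono hR this
  rw [ENNReal.toReal_add (ENNReal.mul_ne_top (by simp) hI) (ENNReal.mul_ne_top (by simp) hJ)] at h3
  simp only [ENNReal.toReal_mul, ENNReal.toReal_ofReal (inv_pos.2 hα).le,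
    ENNReal.toReal_ofReal (inv_pos.2 hβ).le, ENNReal.toReal_ofReal (inv_pos.2 hs).le,
    ENNReal.toReal_ofNat] at h3
  rw [← ENNReal.toReal_le_toReal (ENNReal.mul_ne_top hI hJ) (ENNReal.pow_ne_top hK),
    ENNReal.toReal_mul, ENNReal.toReal_pow]
  have i0 : 0 ≤ I.toReal := ENNReal.toReal_nonneg
  have j0 : 0 ≤ J.toReal := ENNReal.toReal_nonneg
  have k0 : 0 ≤ K.toReal := ENNReal.toReal_nonneg
  generalize I.toReal = i at *
  generalize J.toReal = j at *
  generalize K.toReal = k at *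
  have h4 : (α⁻¹ * i + β⁻¹ * j) ^ 2 ≤ (2 * ((√(α * β))⁻¹ * k)) ^ 2 := by
    gcongr
  rw [mul_pow, mul_pow, inv_pow, hss] at h4
  have h5 : 4 * ((α⁻¹ * i) * (β⁻¹ * j)) ≤ (α⁻¹ * i + β⁻¹ * j) ^ 2 := by
    nlinarith [sq_nonneg (α⁻¹ * i - β⁻¹ * j)]
  have h6 : (α * β)⁻¹ * (i * j) ≤ (α * β)⁻¹ * k ^ 2 := by
    have : (α⁻¹ * i) * (β⁻¹ * j) = (α * β)⁻¹ * (i * j) := by rw [mul_inv]; ring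
    rw [this] at h5
    linarith
  exact le_of_mul_le_mul_left h6 (by positivity)

/-- Midpoint Prékopa–Leindler property. -/
def AuxPL {E : Type*} [AddCommGroup E] [Module ℝ E] [MeasurableSpace E] (μ : Measure E) : Prop :=
  ∀ f g h : E → ℝ≥0∞, Measurable f → Measurable g → Measurable h →
    (∀ x, f x ≤ 1) → (∀ x, g x ≤ 1) → (∀ x, h x ≤ 1) →
    (∀ x y, f x * g y ≤ h ((1 / 2 : ℝ) • (x + y)) ^ 2) →
    (∫⁻ x, f x ∂μ) * (∫⁻ x, g x ∂μ) ≤ (∫⁻ x, h x ∂μ) ^ 2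

lemma auxPL_gauss : AuxPL (gaussianReal 0 1) := by
  intro f g h hf hg hh f1 g1 h1 H
  have hp1 : ∀ x, gaussianPDFReal 0 1 x ≤ 1 := by
    intro x
    rw [gaussianPDFReal]
    have h2 : (√(2 * π * (1 : NNReal)))⁻¹ ≤ 1 := by
      apply inv_le_one_of_one_le₀
      rw [Real.one_le_sqrt]
      simp
      nlinarith [Real.pi_gt_three]
    have h3 : Real.exp (-(x - 0) ^ 2 / (2 * (1 : NNReal))) ≤ 1 := by
      rw [Real.exp_le_one_iff]
      simp
      nlinarith [sq_nonneg x]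
    calc _ ≤ (1 : ℝ) * 1 := by gcongr
      _ = 1 := by norm_num
  have hp0 : ∀ x, 0 ≤ gaussianPDFReal 0 1 x := fun x => gaussianPDFReal_nonneg 0 1 x
  have hpm : ∀ x y, gaussianPDFReal 0 1 x * gaussianPDFReal 0 1 y
      ≤ gaussianPDFReal 0 1 ((x + y) / 2) ^ 2 := by
    intro x y
    simp only [gaussianPDFReal, mul_pow]
    rw [mul_mul_mul_comm, ← pow_two, ← Real.exp_add, ← Real.exp_nat_mul]
    gcongr
    simp
    nlinarith [sq_nonneg (x - y)]
  have conv : ∀ f : ℝ → ℝ≥0∞, Measurable f → (∀ x, f x ≤ 1) → ∫⁻ x, f x ∂(gaussianReal 0 1) =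
      ∫⁻ x, ENNReal.ofReal ((f x).toReal * gaussianPDFReal 0 1 x) := by
    intro f hf f1
    rw [gaussianReal_of_var_ne_zero _ (by simp), lintegral_withDensity_eq_lintegral_mul _ (by fun_prop) hf]
    refine lintegral_congr fun x => ?_
    simp only [Pi.mul_apply]
    rw [ENNReal.ofReal_mul ENNReal.toReal_nonneg, ENNReal.ofReal_toReal, mul_comm]
    · rfl
    · exact ((f1 x).trans_lt (by simp)).ne
  have tr1 : ∀ a : ℝ≥0∞, a ≤ 1 → a.toReal ≤ 1 := fun a ha => by
    simpa using ENNReal.toReal_mono (by simp) ha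
  rw [conv f hf f1, conv g hg g1, conv h hh h1]
  apply aux_pl1
  · fun_prop
  · fun_prop
  · fun_prop
  · intro x; exact mul_nonneg ENNReal.toReal_nonneg (hp0 x)
  · intro x; exact mul_nonneg ENNReal.toReal_nonneg (hp0 x)
  · intro x; exact mul_nonneg ENNReal.toReal_nonneg (hp0 x)
  · intro x; exact mul_le_one₀ (tr1 _ (f1 x)) (hp0 x) (hp1 x)
  · intro x; exact mul_le_one₀ (tr1 _ (g1 x)) (hp0 x) (hp1 x)
  · intro x y
    have h1' : (f x * g y).toReal ≤ (h ((x + y) / 2) ^ 2).toReal := by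
      refine ENNReal.toReal_mono (ENNReal.pow_ne_top ((h1 _).trans_lt (by simp)).ne) ?_
      have := H x y
      rwa [smul_eq_mul, one_div_mul_eq_div] at this
    rw [ENNReal.toReal_mul, ENNReal.toReal_pow] at h1'
    rw [mul_mul_mul_comm, mul_pow]
    exact mul_le_mul h1' (hpm x y) (mul_nonneg (hp0 _) (hp0 _)) (by positivity)

lemma auxPL_map {E F : Type*} [AddCommGroup E] [Module ℝ E] [MeasurableSpace E]
    [AddCommGroup F] [Module ℝ F] [MeasurableSpace F] {μ : Measure E} (hμ : AuxPL μ)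
    (L : E →ₗ[ℝ] F) (hL : Measurable L) : AuxPL (μ.map L) := by
  intro f g h hf hg hh f1 g1 h1 H
  rw [lintegral_map hf hL, lintegral_map hg hL, lintegral_map hh hL]
  refine hμ _ _ _ (hf.comp hL) (hg.comp hL) (hh.comp hL) (fun _ => f1 _) (fun _ => g1 _)
    (fun _ => h1 _) ?_
  intro x y
  simpa using H (L x) (L y)

lemma auxPL_prod {E F : Type*} [AddCommGroup E] [Module ℝ E] [MeasurableSpace E]
    [AddCommGroup F] [Module ℝ F] [MeasurableSpace F] {μ : Measure E} {ν : Measure F}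
    [IsProbabilityMeasure μ] [IsProbabilityMeasure ν] (hμ : AuxPL μ) (hν : AuxPL ν) :
    AuxPL (μ.prod ν) := by
  intro f g h hf hg hh f1 g1 h1 H
  rw [lintegral_prod _ hf.aemeasurable, lintegral_prod _ hg.aemeasurable,
    lintegral_prod _ hh.aemeasurable]
  have b1 : ∀ (f : E × F → ℝ≥0∞), (∀ x, f x ≤ 1) → ∀ x, ∫⁻ y, f (x, y) ∂ν ≤ 1 := by
    intro f f1 x
    calc _ ≤ ∫⁻ y, 1 ∂ν := lintegral_mono fun y => f1 _
      _ = 1 := by simp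
  refine hμ _ _ _ hf.lintegral_prod_right' hg.lintegral_prod_right' hh.lintegral_prod_right'
    (b1 f f1) (b1 g g1) (b1 h h1) ?_
  intro x y
  refine hν _ _ _ (by fun_prop) (by fun_prop) (by fun_prop) (fun _ => f1 _) (fun _ => g1 _)
    (fun _ => h1 _) ?_
  intro x' y'
  exact H (x, x') (y, y')

lemma auxPL_pi (n : ℕ) : AuxPL (Measure.pi (fun _ : Fin n => gaussianReal 0 1)) := by
  induction n with
  | zero =>
    intro f g h hf hg hh f1 g1 h1 H
    rw [Measure.pi_of_empty _ (0 : Fin 0 → ℝ), lintegral_dirac' _ hf, lintegral_dirac' _ hg,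
      lintegral_dirac' _ hh]
    simpa using H 0 0
  | succ n ih =>
    have h1 := auxPL_prod auxPL_gauss ih
    let L : (ℝ × (Fin n → ℝ)) →ₗ[ℝ] (Fin (n + 1) → ℝ) :=
      { toFun := fun p => Fin.cons p.1 p.2
        map_add' := by
          intro x y; ext i; refine Fin.cases ?_ (fun j => ?_) i <;> simp
        map_smul' := by
          intro x y; ext i; refine Fin.cases ?_ (fun j => ?_) i <;> simp }
    have hLm : Measurable L := by
      rw [measurable_pi_iff]
      intro i
      refine Fin.cases ?_ (fun j => ?_) i
      · exact measurable_fst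
      · exact (measurable_pi_apply j).comp measurable_snd
    have h2 := auxPL_map h1 L hLm
    have h3 := (measurePreserving_piFinSuccAbove (fun _ : Fin (n + 1) => gaussianReal 0 1) 0).symm
    have h4 : Measure.map L ((gaussianReal 0 1).prod (Measure.pi fun _ : Fin n => gaussianReal 0 1))
        = Measure.pi (fun _ : Fin (n + 1) => gaussianReal 0 1) := by
      rw [← h3.map_eq]
      congr 1
      ext p i
      refine Fin.cases ?_ (fun j => ?_) i <;> simp [L, MeasurableEquiv.piFinSuccAbove]
    rwa [h4] at h2

lemma auxPL_of_gaussian {n : ℕ} (μ : Measure (EuclideanSpace ℝ (Fin n))) [IsGaussian μ]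
    (hm : ∫ x, x ∂μ = 0) : AuxPL μ := by
  let S : Matrix (Fin n) (Fin n) ℝ := Matrix.of fun i j =>
    covarianceBilin μ (EuclideanSpace.basisFun (Fin n) ℝ i) (EuclideanSpace.basisFun (Fin n) ℝ j)
  have hS1 : ∀ x y : EuclideanSpace ℝ (Fin n),
      dotProduct (x : Fin n → ℝ) (S.mulVec (y : Fin n → ℝ)) = covarianceBilin μ x y := by
    intro x y
    conv_rhs => rw [← (EuclideanSpace.basisFun (Fin n) ℝ).sum_repr x,
      ← (EuclideanSpace.basisFun (Fin n) ℝ).sum_repr y]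
    simp only [map_sum, map_smul, sum_apply, smul_apply,
      smul_eq_mul, dotProduct, Matrix.mulVec, S, Matrix.of_apply, Finset.mul_sum,
      EuclideanSpace.basisFun_repr]
    refine (Finset.sum_congr rfl fun i _ => Finset.sum_congr rfl fun j _ => ?_).trans
      Finset.sum_comm
    ring
  have hS : S.PosSemidef := by
    refine Matrix.PosSemidef.of_dotProduct_mulVec_nonneg ?_ ?_
    · ext i j
      simp [S, Matrix.conjTranspose, covarianceBilin_comm]
    · intro x
      have := hS1 (WithLp.toLp 2 x) (WithLp.toLp 2 x)
      simp only [star_trivial]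
      exact this ▸ covarianceBilin_self_nonneg _
  have hμ : μ = multivariateGaussian 0 S := by
    apply IsGaussian.ext
    · simpa using hm
    · ext x y
      rw [covarianceBilin_multivariateGaussian hS, hS1]
  rw [hμ, multivariateGaussian]
  have h1 := auxPL_map (auxPL_pi n) (WithLp.linearEquiv 2 ℝ (Fin n → ℝ)).symm.toLinearMap
    (by exact WithLp.measurable_toLp 2 _)
  have h2 : Measure.map (WithLp.linearEquiv 2 ℝ (Fin n → ℝ)).symm.toLinearMap
      (Measure.pi (fun _ : Fin n => gaussianReal 0 1)) = stdGaussian (EuclideanSpace ℝ (Fin n)) :=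
    map_pi_eq_stdGaussian
  rw [h2] at h1
  have h3 := auxPL_map h1 (Matrix.toEuclideanCLM (𝕜 := ℝ) (CFC.sqrt S)).toLinearMap
    (by
      have : Continuous (Matrix.toEuclideanCLM (𝕜 := ℝ) (n := Fin n) (CFC.sqrt S)) :=
        ContinuousLinearMap.continuous _
      exact this.measurable)
  simpa using h3

lemma aux_gaussLaw {Ω : Type*} [MeasurableSpace Ω] (P : Measure Ω) [IsProbabilityMeasure P]
    (X : ℕ → Ω → ℝ) (hXmeas : ∀ i, Measurable (X i))
    (hgauss : ∀ (k : ℕ) (s : Fin k → ℕ) (a : Fin k → ℝ), ∃ v : NNReal,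
      P.map (fun ω => ∑ i, a i * X (s i) ω) = gaussianReal 0 v) (k : ℕ) (s : Fin k → ℕ) :
    HasGaussianLaw (fun ω => (WithLp.toLp 2 (fun i => X (s i) ω) : EuclideanSpace ℝ (Fin k))) P where
  isGaussian_map := by
    have hm : Measurable
        (fun ω => (WithLp.toLp 2 (fun i => X (s i) ω) : EuclideanSpace ℝ (Fin k))) := by
      fun_prop
    refine isGaussian_of_map_eq_gaussianReal fun L => ?_
    obtain ⟨v, hv⟩ := hgauss k s (fun i => L (EuclideanSpace.basisFun (Fin k) ℝ i))
    refine ⟨0, v, ?_⟩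
    rw [← hv, Measure.map_map (by fun_prop) hm]
    congr 1
    ext ω
    simp only [Function.comp]
    conv_lhs => rw [← (EuclideanSpace.basisFun (Fin k) ℝ).sum_repr (WithLp.toLp 2 (fun i => X (s i) ω))]
    simp only [map_sum, map_smul, smul_eq_mul, EuclideanSpace.basisFun_repr]
    exact Finset.sum_congr rfl fun i _ => mul_comm _ _

lemma aux_single {Ω : Type*} [MeasurableSpace Ω] (P : Measure Ω) [IsProbabilityMeasure P]
    (X : ℕ → Ω → ℝ)
    (hgauss : ∀ (k : ℕ) (s : Fin k → ℕ) (a : Fin k → ℝ), ∃ v : NNReal,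
      P.map (fun ω => ∑ i, a i * X (s i) ω) = gaussianReal 0 v) (i : ℕ) :
    ∃ v, P.map (X i) = gaussianReal 0 v := by
  simpa using hgauss 1 (fun _ => i) (fun _ => 1)

lemma aux_mean {Ω : Type*} [MeasurableSpace Ω] (P : Measure Ω) [IsProbabilityMeasure P]
    (X : Ω → ℝ) (hX : Measurable X) (v) (h : P.map X = gaussianReal 0 v) :
    ∫ ω, X ω ∂P = 0 := by
  have h1 : ∫ x, x ∂(P.map X) = ∫ ω, X ω ∂P := integral_map hX.aemeasurable (by fun_prop)
  rw [← h1, h]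
  simp

lemma aux_logconcave {Ω : Type*} [MeasurableSpace Ω] (P : Measure Ω) [IsProbabilityMeasure P]
    (X : ℕ → Ω → ℝ) (hXmeas : ∀ i, Measurable (X i))
    (hgauss : ∀ (k : ℕ) (s : Fin k → ℕ) (a : Fin k → ℝ), ∃ v : NNReal,
      P.map (fun ω => ∑ i, a i * X (s i) ω) = gaussianReal 0 v) (n : ℕ) (s r : ℝ) :
    P {ω | ∀ i ∈ Set.Icc 1 n, X i ω ≤ s} * P {ω | ∀ i ∈ Set.Icc 1 n, X i ω ≤ r} ≤
      P {ω | ∀ i ∈ Set.Icc 1 n, X i ω ≤ (s + r) / 2} ^ 2 := by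
  set Y : Ω → EuclideanSpace ℝ (Fin n) := fun ω => WithLp.toLp 2 (fun i => X (i.1 + 1) ω) with hY
  have hYm : Measurable Y := by fun_prop
  have hg : HasGaussianLaw Y P := aux_gaussLaw P X hXmeas hgauss n (fun i => i.1 + 1)
  have := hg.isGaussian_map
  have hmean : ∫ x, x ∂(P.map Y) = 0 := by
    rw [integral_map hYm.aemeasurable (by fun_prop)]
    ext i
    have h1 := (EuclideanSpace.proj i : EuclideanSpace ℝ (Fin n) →L[ℝ] ℝ).integral_comp_comm hg.integrable
    refine h1.symm.trans ?_
    obtain ⟨v, hv⟩ := aux_single P X hgauss (i.1 + 1)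
    exact aux_mean P _ (hXmeas _) v hv
  have hPL := auxPL_of_gaussian (P.map Y) hmean
  have hset : ∀ s : ℝ, MeasurableSet {y : EuclideanSpace ℝ (Fin n) | ∀ i, y i ≤ s} := by
    intro s
    have : {y : EuclideanSpace ℝ (Fin n) | ∀ i, y i ≤ s} = ⋂ i, {y | y i ≤ s} := by
      ext; simp
    rw [this]
    exact MeasurableSet.iInter fun i => measurableSet_le (by fun_prop) measurable_const
  have hP : ∀ s : ℝ, P {ω | ∀ i ∈ Set.Icc 1 n, X i ω ≤ s} =
      ∫⁻ y, {y : EuclideanSpace ℝ (Fin n) | ∀ i, y i ≤ s}.indicator 1 y ∂(P.map Y) := by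
    intro s
    rw [lintegral_indicator_one (hset s), Measure.map_apply hYm (hset s)]
    congr 1
    ext ω
    simp only [Set.mem_ofPred_eq, Set.mem_preimage, hY, Set.mem_Icc]
    constructor
    · intro h i
      exact h _ ⟨by omega, by omega⟩
    · rintro h i ⟨h1, h2⟩
      have := h ⟨i - 1, by omega⟩
      simpa [Nat.sub_add_cancel h1] using this
  rw [hP, hP, hP]
  refine hPL _ _ _ (measurable_one.indicator (hset _)) (measurable_one.indicator (hset _))
    (measurable_one.indicator (hset _)) ?_ ?_ ?_ ?_
  · exact fun x => Set.indicator_le_self _ _ x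
  · exact fun x => Set.indicator_le_self _ _ x
  · exact fun x => Set.indicator_le_self _ _ x
  · intro x y
    by_cases hx : x ∈ {y : EuclideanSpace ℝ (Fin n) | ∀ i, y i ≤ s}
    · by_cases hy : y ∈ {y : EuclideanSpace ℝ (Fin n) | ∀ i, y i ≤ r}
      · have : (1 / 2 : ℝ) • (x + y) ∈ {y : EuclideanSpace ℝ (Fin n) | ∀ i, y i ≤ (s + r) / 2} := by
          intro i
          have h1 := hx i
          have h2 := hy i
          simp
          linarith
        rw [Set.indicator_of_mem hx, Set.indicator_of_mem hy, Set.indicator_of_mem this]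
        simp
      · rw [Set.indicator_of_notMem hy]; simp
    · rw [Set.indicator_of_notMem hx]; simp
lemma aux_tail_upper (v : ℝ) (hv : 0 < v) :
    (gaussianReal 0 1).real (Set.Ioi v) ≤ rexp (-v ^ 2 / 2) / (v * √(2 * π)) := by
  rw [measureReal_def, gaussianReal_apply_eq_integral _ (by simp),
    ENNReal.toReal_ofReal (integral_nonneg fun x => gaussianPDFReal_nonneg _ _ _)]
  have hI : IntegrableOn (fun x => ((√(2 * π))⁻¹ * rexp (v ^ 2 / 2)) * rexp (-v * x))
      (Set.Ioi v) := (integrableOn_exp_mul_Ioi (by linarith) v).const_mul _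
  calc ∫ x in Set.Ioi v, gaussianPDFReal 0 1 x
      ≤ ∫ x in Set.Ioi v, ((√(2 * π))⁻¹ * rexp (v ^ 2 / 2)) * rexp (-v * x) := by
        refine setIntegral_mono_on (integrable_gaussianPDFReal 0 1).integrableOn hI
          measurableSet_Ioi fun x hx => ?_
        rw [gaussianPDFReal, mul_assoc (√(2 * π))⁻¹, ← Real.exp_add]
        simp only [NNReal.coe_one, mul_one, sub_zero]
        gcongr
        nlinarith [sq_nonneg (x - v)]
    _ = rexp (-v ^ 2 / 2) / (v * √(2 * π)) := by
        rw [integral_const_mul, integral_exp_mul_Ioi (by linarith)]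
        have : rexp (-v * v) = rexp (-v ^ 2 / 2) * rexp (-v ^ 2 / 2) := by
          rw [← Real.exp_add]; ring_nf
        have h2 : rexp (v ^ 2 / 2) * rexp (-v ^ 2 / 2) = 1 := by
          rw [← Real.exp_add]; ring_nf; simp
        rw [this]
        have hs : (0:ℝ) < √(2 * π) := by positivity
        rw [neg_div] at h2 ⊢
        field_simp
        linear_combination h2

lemma aux_tail_lower (u : ℝ) (hu : 1 ≤ u) :
    rexp (-u ^ 2 / 2 - 3 / 2) / (u * √(2 * π)) ≤ (gaussianReal 0 1).real (Set.Ioc u (u + 1)) := by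
  rw [measureReal_def, gaussianReal_apply_eq_integral _ (by simp),
    ENNReal.toReal_ofReal (integral_nonneg fun x => gaussianPDFReal_nonneg _ _ _)]
  have hu1 : u⁻¹ ≤ 1 := inv_le_one_of_one_le₀ hu
  have hu0 : 0 < u⁻¹ := by positivity
  calc rexp (-u ^ 2 / 2 - 3 / 2) / (u * √(2 * π))
      = ∫ x in Set.Ioc u (u + u⁻¹), (√(2 * π))⁻¹ * rexp (-u ^ 2 / 2 - 3 / 2) := by
        rw [setIntegral_const]
        simp [measureReal_def, hu0.le]
        field_simp
    _ ≤ ∫ x in Set.Ioc u (u + u⁻¹), gaussianPDFReal 0 1 x := by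
        refine setIntegral_mono_on (integrableOn_const (by simp)) (integrable_gaussianPDFReal 0 1).integrableOn
          measurableSet_Ioc fun x hx => ?_
        rw [gaussianPDFReal]
        simp only [NNReal.coe_one, mul_one, sub_zero]
        gcongr
        have h1 : u * u⁻¹ = 1 := mul_inv_cancel₀ (by positivity)
        have h2 := hx.1
        have h3 := hx.2
        have h4 : x ^ 2 ≤ (u + u⁻¹) ^ 2 := by gcongr; linarith
        nlinarith
    _ ≤ ∫ x in Set.Ioc u (u + 1), gaussianPDFReal 0 1 x := by
        refine setIntegral_mono_set (integrable_gaussianPDFReal 0 1).integrableOn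
          (.of_forall fun x => gaussianPDFReal_nonneg _ _ _) (.of_forall ?_)
        exact Set.Ioc_subset_Ioc_right (by linarith)

lemma aux_cond (ρ u : ℝ) (hρ0 : 0 ≤ ρ) (hρ1 : ρ < 1) (hu : 1 ≤ u) (x : ℝ)
    (hx : x ∈ Set.Ioc u (u + 1)) :
    (gaussianReal (ρ * x) (1 - ρ ^ 2).toNNReal).real (Set.Ioc u (u + 1)) ≤
      ((√(1 - ρ ^ 2))⁻¹ * rexp (4 * ρ * u ^ 2)) * (gaussianReal 0 1).real (Set.Ioc u (u + 1)) := by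
  have hr : 0 < 1 - ρ ^ 2 := by nlinarith
  have hv : (1 - ρ ^ 2).toNNReal ≠ 0 := by simpa using hr
  rw [measureReal_def, measureReal_def, gaussianReal_apply_eq_integral _ hv,
    gaussianReal_apply_eq_integral _ (by simp),
    ENNReal.toReal_ofReal (integral_nonneg fun x => gaussianPDFReal_nonneg _ _ _),
    ENNReal.toReal_ofReal (integral_nonneg fun x => gaussianPDFReal_nonneg _ _ _),
    ← integral_const_mul]
  refine setIntegral_mono_on (integrable_gaussianPDFReal _ _).integrableOn
    ((integrable_gaussianPDFReal 0 1).const_mul _).integrableOn measurableSet_Ioc fun y hy => ?_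
  simp only [gaussianPDFReal, Real.coe_toNNReal _ hr.le, NNReal.coe_one, mul_one, sub_zero]
  rw [Real.sqrt_mul (by positivity) (1 - ρ ^ 2), mul_inv]
  have h1 : rexp (-(y - ρ * x) ^ 2 / (2 * (1 - ρ ^ 2))) ≤
      rexp (4 * ρ * u ^ 2) * rexp (-y ^ 2 / 2) := by
    rw [← Real.exp_add]
    gcongr
    rw [div_le_iff₀ (by positivity)]
    obtain ⟨x1, x2⟩ := hx
    obtain ⟨y1, y2⟩ := hy
    have hxy : x * y ≤ 4 * u ^ 2 := by
      have : x * y ≤ (2 * u) * (2 * u) := by gcongr <;> linarith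
      linarith
    have hxy0 : 0 ≤ x * y := mul_nonneg (by linarith) (by linarith)
    have h2 : (1 - ρ ^ 2) * (y ^ 2 - 2 * ρ * (x * y)) ≤ (y - ρ * x) ^ 2 := by
      have : 0 ≤ ρ ^ 2 * ((x - y) ^ 2 + 2 * (1 - ρ) * (x * y)) := by
        have : 0 ≤ 1 - ρ := by linarith
        positivity
      nlinarith
    have h3 : (1 - ρ ^ 2) * (ρ * (x * y)) ≤ (1 - ρ ^ 2) * (ρ * (4 * u ^ 2)) := by gcongr
    nlinarith
  calc (√(2 * π))⁻¹ * (√(1 - ρ ^ 2))⁻¹ * rexp (-(y - ρ * x) ^ 2 / (2 * (1 - ρ ^ 2)))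
      ≤ (√(2 * π))⁻¹ * (√(1 - ρ ^ 2))⁻¹ * (rexp (4 * ρ * u ^ 2) * rexp (-y ^ 2 / 2)) := by gcongr
    _ = _ := by ring

lemma aux_second_moment {Ω : Type*} [MeasurableSpace Ω] (P : Measure Ω) [IsProbabilityMeasure P]
    {ι : Type*} (s : Finset ι) (A : ι → Set Ω) (hA : ∀ i, MeasurableSet (A i)) :
    P.real {ω | ∀ i ∈ s, ω ∉ A i} * (∑ i ∈ s, P.real (A i)) ^ 2 ≤
      (∑ i ∈ s, ∑ j ∈ s, P.real (A i ∩ A j)) - (∑ i ∈ s, P.real (A i)) ^ 2 := by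
  set m := ∑ i ∈ s, P.real (A i) with hm
  set N : Ω → ℝ := fun ω => ∑ i ∈ s, (A i).indicator 1 ω with hN
  have hi1 : ∀ i, Integrable ((A i).indicator (1 : Ω → ℝ)) P := fun i =>
    (integrable_const (1 : ℝ)).indicator (hA i)
  have hNi : Integrable N P := integrable_finsetSum _ fun i _ => hi1 i
  have hN1 : ∫ ω, N ω ∂P = m := by
    rw [integral_finsetSum _ fun i _ => hi1 i]
    simp [integral_indicator_one (hA _), hm]
  have hsq : ∀ ω, N ω ^ 2 = ∑ i ∈ s, ∑ j ∈ s, (A i ∩ A j).indicator (1 : Ω → ℝ) ω := by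
    intro ω
    simp only [hN, pow_two, Finset.sum_mul_sum]
    refine Finset.sum_congr rfl fun i _ => Finset.sum_congr rfl fun j _ => ?_
    rw [Set.inter_indicator_one]; rfl
  have hi2 : ∀ i j, Integrable ((A i ∩ A j).indicator (1 : Ω → ℝ)) P := fun i j =>
    (integrable_const (1 : ℝ)).indicator ((hA i).inter (hA j))
  have hN2i : Integrable (fun ω => N ω ^ 2) P := by
    simp_rw [hsq]
    exact integrable_finsetSum _ fun i _ => integrable_finsetSum _ fun j _ => hi2 i j
  have hN2 : ∫ ω, N ω ^ 2 ∂P = ∑ i ∈ s, ∑ j ∈ s, P.real (A i ∩ A j) := by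
    simp_rw [hsq]
    rw [integral_finsetSum _ fun i _ => integrable_finsetSum _ fun j _ => hi2 i j]
    refine Finset.sum_congr rfl fun i _ => ?_
    rw [integral_finsetSum _ fun j _ => hi2 i j]
    exact Finset.sum_congr rfl fun j _ => integral_indicator_one ((hA i).inter (hA j))
  have hE : MeasurableSet {ω | ∀ i ∈ s, ω ∉ A i} := by
    have : {ω | ∀ i ∈ s, ω ∉ A i} = ⋂ i ∈ s, (A i)ᶜ := by ext; simp
    rw [this]
    exact Finset.measurableSet_biInter _ fun i _ => (hA i).compl
  have hv : ∫ ω, (N ω - m) ^ 2 ∂P = (∫ ω, N ω ^ 2 ∂P) - m ^ 2 := by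
    have : ∀ ω, (N ω - m) ^ 2 = N ω ^ 2 - (2 * m) * N ω + m ^ 2 := fun ω => by ring
    simp_rw [this]
    rw [integral_add (f := fun ω => N ω ^ 2 - (2 * m) * N ω) (hN2i.sub (hNi.const_mul _)) (integrable_const _),
      integral_sub hN2i (hNi.const_mul _), integral_const_mul, hN1]
    simp
    ring
  have hvi : Integrable (fun ω => (N ω - m) ^ 2) P := by
    have : ∀ ω, (N ω - m) ^ 2 = N ω ^ 2 - (2 * m) * N ω + m ^ 2 := fun ω => by ring
    simp_rw [this]
    exact (hN2i.sub (hNi.const_mul _)).add (integrable_const _)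
  rw [← hN2, ← hv]
  calc P.real {ω | ∀ i ∈ s, ω ∉ A i} * m ^ 2
      = ∫ ω, {ω | ∀ i ∈ s, ω ∉ A i}.indicator (fun _ => m ^ 2) ω ∂P := by
        rw [integral_indicator hE, setIntegral_const, smul_eq_mul]
    _ ≤ _ := by
        refine integral_mono ((integrable_const _).indicator hE) hvi fun ω => ?_
        by_cases hω : ω ∈ {ω | ∀ i ∈ s, ω ∉ A i}
        · rw [Set.indicator_of_mem hω]
          have : N ω = 0 := Finset.sum_eq_zero fun i hi => Set.indicator_of_notMem (hω i hi) _
          simp [this]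
        · rw [Set.indicator_of_notMem hω]; positivity

lemma aux_pair_far {Ω : Type*} [MeasurableSpace Ω] (P : Measure Ω) [IsProbabilityMeasure P]
    (X Y : Ω → ℝ) (hX : Measurable X) (hY : Measurable Y)
    (hXY : HasGaussianLaw (fun ω => (X ω, Y ω)) P)
    (hX1 : P.map X = gaussianReal 0 1) (hY1 : P.map Y = gaussianReal 0 1)
    (ρ u : ℝ) (hρ : ∫ ω, X ω * Y ω ∂P = ρ) (hρ0 : 0 ≤ ρ) (hρ1 : ρ < 1) (hu : 1 ≤ u) :
    P.real (X ⁻¹' (Set.Ioc u (u + 1)) ∩ Y ⁻¹' (Set.Ioc u (u + 1))) ≤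
      ((√(1 - ρ ^ 2))⁻¹ * rexp (4 * ρ * u ^ 2)) *
        (gaussianReal 0 1).real (Set.Ioc u (u + 1)) ^ 2 := by
  set I := Set.Ioc u (u + 1) with hI
  set W : Ω → ℝ := fun ω => Y ω - ρ * X ω with hW
  have hWm : Measurable W := by fun_prop
  have hr : 0 ≤ 1 - ρ ^ 2 := by nlinarith
  have hXW : HasGaussianLaw (fun ω => (X ω, W ω)) P :=
    hXY.map_fun ((ContinuousLinearMap.fst ℝ ℝ ℝ).prod
      (ContinuousLinearMap.snd ℝ ℝ ℝ - ρ • ContinuousLinearMap.fst ℝ ℝ ℝ))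
  have mX : MemLp X 2 P := hXY.fst.memLp_two
  have mY : MemLp Y 2 P := hXY.snd.memLp_two
  have mW : MemLp W 2 P := hXW.snd.memLp_two
  have eX := aux_mean P X hX 1 hX1
  have eY := aux_mean P Y hY 1 hY1
  have vX : Var[X; P] = 1 := by
    have := variance_map (μ := P) (X := id) (Y := X) (by fun_prop) hX.aemeasurable
    rw [hX1, variance_id_gaussianReal] at this
    simpa using this.symm
  have vY : Var[Y; P] = 1 := by
    have := variance_map (μ := P) (X := id) (Y := Y) (by fun_prop) hY.aemeasurable
    rw [hY1, variance_id_gaussianReal] at this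
    simpa using this.symm
  have cXY : cov[X, Y; P] = ρ := by
    rw [covariance_eq_sub mX mY, eX, eY, ← hρ]; simp
  have cYX : cov[Y, X; P] = ρ := by rw [covariance_comm, cXY]
  have cXX : cov[X, X; P] = 1 := by rw [covariance_self hX.aemeasurable, vX]
  have cYY : cov[Y, Y; P] = 1 := by rw [covariance_self hY.aemeasurable, vY]
  have mρ : MemLp (fun ω => ρ * X ω) 2 P := mX.const_mul ρ
  have cXW : cov[X, W; P] = 0 := by
    rw [hW, covariance_fun_sub_right mX mY mρ, covariance_const_mul_right, cXX, cXY]; ring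
  have cYW : cov[Y, W; P] = 1 - ρ ^ 2 := by
    rw [hW, covariance_fun_sub_right mY mY mρ, covariance_const_mul_right, cYX, cYY]; ring
  have vW : Var[W; P] = 1 - ρ ^ 2 := by
    rw [← covariance_self hWm.aemeasurable]
    conv_lhs => arg 1; rw [hW]
    rw [covariance_fun_sub_left mY mρ mW, covariance_const_mul_left, cXW, cYW]; ring
  have eW : P[W] = 0 := by
    rw [hW, integral_sub (mY.integrable (by simp)) (mρ.integrable (by simp)),
      integral_const_mul, eX, eY]; ring
  have lW : P.map W = gaussianReal 0 (1 - ρ ^ 2).toNNReal := by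
    rw [hXW.snd.map_eq_gaussianReal, eW, vW]
  have hind : IndepFun X W P := hXW.indepFun_of_covariance_eq_zero cXW
  have hmap := (indepFun_iff_map_prod_eq_prod_map_map hX.aemeasurable hWm.aemeasurable).1 hind
  rw [hX1, lW] at hmap
  set S : Set (ℝ × ℝ) := {p | p.1 ∈ I ∧ p.2 + ρ * p.1 ∈ I} with hS
  have hSm : MeasurableSet S := by
    refine MeasurableSet.inter ?_ ?_
    · exact measurable_fst measurableSet_Ioc
    · exact (show Measurable (fun p : ℝ × ℝ => p.2 + ρ * p.1) by fun_prop) measurableSet_Ioc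
  have hset : X ⁻¹' I ∩ Y ⁻¹' I = (fun ω => (X ω, W ω)) ⁻¹' S := by
    ext ω; simp [hS, hW]
  set R := (√(1 - ρ ^ 2))⁻¹ * rexp (4 * ρ * u ^ 2) with hR
  have hR0 : 0 ≤ R := by positivity
  have hsec : ∀ x, gaussianReal 0 (1 - ρ ^ 2).toNNReal (Prod.mk x ⁻¹' S) ≤
      I.indicator (fun _ => ENNReal.ofReal (R * (gaussianReal 0 1).real I)) x := by
    intro x
    by_cases hx : x ∈ I
    · rw [Set.indicator_of_mem hx]
      have h1 : Prod.mk x ⁻¹' S = (fun w => w + ρ * x) ⁻¹' I := by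
        ext w; simp [hS, hx]
      rw [h1, ← Measure.map_apply (by fun_prop) measurableSet_Ioc, gaussianReal_map_add_const,
        zero_add, ← ofReal_measureReal]
      exact ENNReal.ofReal_le_ofReal (aux_cond ρ u hρ0 hρ1 hu x hx)
    · rw [Set.indicator_of_notMem hx]
      have : Prod.mk x ⁻¹' S = ∅ := by
        ext w; simp [hS, hx]
      simp [this]
  have hfin : P (X ⁻¹' I ∩ Y ⁻¹' I) ≤
      ENNReal.ofReal (R * (gaussianReal 0 1).real I) * gaussianReal 0 1 I := by
    rw [hset, ← Measure.map_apply (hX.prodMk hWm) hSm, hmap, Measure.prod_apply hSm]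
    refine (lintegral_mono hsec).trans ?_
    rw [lintegral_indicator measurableSet_Ioc, setLIntegral_const]
  have := ENNReal.toReal_mono (by finiteness) hfin
  rw [ENNReal.toReal_mul, ENNReal.toReal_ofReal (by positivity)] at this
  calc _ ≤ _ := this
    _ = _ := by rw [← measureReal_def]; ring

lemma aux_pair_near {Ω : Type*} [MeasurableSpace Ω] (P : Measure Ω) [IsProbabilityMeasure P]
    (X Y : Ω → ℝ) (hX : Measurable X) (hY : Measurable Y)
    (hXY : HasGaussianLaw (fun ω => (X ω, Y ω)) P)
    (hX1 : P.map X = gaussianReal 0 1) (hY1 : P.map Y = gaussianReal 0 1)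
    (ρ u : ℝ) (hρ : ∫ ω, X ω * Y ω ∂P = ρ) (hρ1 : ρ ≤ 1 / 2) (hu : 0 ≤ u) :
    P.real (X ⁻¹' (Set.Ioc u (u + 1)) ∩ Y ⁻¹' (Set.Ioc u (u + 1))) ≤ rexp (-2 * u ^ 2 / 3) := by
  set W : Ω → ℝ := fun ω => X ω + Y ω with hW
  have hWm : Measurable W := by fun_prop
  have mX : MemLp X 2 P := hXY.fst.memLp_two
  have mY : MemLp Y 2 P := hXY.snd.memLp_two
  have eX := aux_mean P X hX 1 hX1
  have eY := aux_mean P Y hY 1 hY1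
  have vX : Var[X; P] = 1 := by
    have := variance_map (μ := P) (X := id) (Y := X) (by fun_prop) hX.aemeasurable
    rw [hX1, variance_id_gaussianReal] at this
    simpa using this.symm
  have vY : Var[Y; P] = 1 := by
    have := variance_map (μ := P) (X := id) (Y := Y) (by fun_prop) hY.aemeasurable
    rw [hY1, variance_id_gaussianReal] at this
    simpa using this.symm
  have cXY : cov[X, Y; P] = ρ := by
    rw [covariance_eq_sub mX mY, eX, eY, ← hρ]; simp
  have vW : Var[W; P] = 2 + 2 * ρ := by
    rw [hW, variance_fun_add mX mY, vX, vY, cXY]; ring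
  have eW : P[W] = 0 := by
    rw [hW, integral_add (mX.integrable (by simp)) (mY.integrable (by simp)), eX, eY]; ring
  have lW : P.map W = gaussianReal 0 (2 + 2 * ρ).toNNReal := by
    rw [hXY.fun_add.map_eq_gaussianReal, eW, vW]
  have hvar : ((2 + 2 * ρ).toNNReal : ℝ) ≤ 3 := by
    rw [Real.coe_toNNReal']
    exact max_le (by linarith) (by norm_num)
  have hint : Integrable (fun ω => rexp (2 * u / 3 * W ω)) P := by
    have := integrable_exp_mul_gaussianReal (μ := 0) (v := (2 + 2 * ρ).toNNReal) (2 * u / 3)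
    rw [← lW] at this
    exact this.comp_measurable hWm
  have hch := measure_ge_le_exp_mul_mgf (μ := P) (X := W) (2 * u) (t := 2 * u / 3) (by positivity)
    hint
  rw [mgf_gaussianReal lW] at hch
  calc P.real (X ⁻¹' (Set.Ioc u (u + 1)) ∩ Y ⁻¹' (Set.Ioc u (u + 1)))
      ≤ P.real {ω | 2 * u ≤ W ω} := by
        refine measureReal_mono ?_
        rintro ω ⟨⟨h1, _⟩, ⟨h2, _⟩⟩
        change 2 * u ≤ X ω + Y ω
        linarith
    _ ≤ _ := hch
    _ ≤ rexp (-2 * u ^ 2 / 3) := by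
        rw [← Real.exp_add]
        gcongr
        nlinarith [sq_nonneg u, mul_le_mul_of_nonneg_right hvar (sq_nonneg u)]

lemma aux_law1 {Ω : Type*} [MeasurableSpace Ω] (P : Measure Ω) [IsProbabilityMeasure P]
    (X : ℕ → Ω → ℝ) (hXmeas : ∀ i, Measurable (X i))
    (hgauss : ∀ (k : ℕ) (s : Fin k → ℕ) (a : Fin k → ℝ), ∃ v : NNReal,
      P.map (fun ω => ∑ i, a i * X (s i) ω) = gaussianReal 0 v)
    (φ : ℕ → ℝ) (hφ0 : φ 0 = 1)
    (hcov : ∀ i j, ∫ ω, X i ω * X j ω ∂P = φ (max i j - min i j)) (i : ℕ) :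
    P.map (X i) = gaussianReal 0 1 := by
  obtain ⟨v, hv⟩ := aux_single P X hgauss i
  have hm := aux_mean P (X i) (hXmeas i) v hv
  have h1 := variance_map (μ := P) (X := id) (Y := X i) (by fun_prop) (hXmeas i).aemeasurable
  rw [hv, variance_id_gaussianReal, Function.id_comp,
    variance_of_integral_eq_zero (hXmeas i).aemeasurable hm] at h1
  have h2 := hcov i i
  simp only [max_self, min_self, Nat.sub_self, hφ0] at h2
  have h3 : (v : ℝ) = 1 := by
    rw [h1, ← h2]
    simp only [pow_two]
  rw [hv, show v = 1 from by exact_mod_cast h3]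

lemma aux_pairlaw {Ω : Type*} [MeasurableSpace Ω] (P : Measure Ω) [IsProbabilityMeasure P]
    (X : ℕ → Ω → ℝ) (hXmeas : ∀ i, Measurable (X i))
    (hgauss : ∀ (k : ℕ) (s : Fin k → ℕ) (a : Fin k → ℝ), ∃ v : NNReal,
      P.map (fun ω => ∑ i, a i * X (s i) ω) = gaussianReal 0 v) (i j : ℕ) :
    HasGaussianLaw (fun ω => (X i ω, X j ω)) P := by
  have h := aux_gaussLaw P X hXmeas hgauss 2 ![i, j]
  exact h.map_fun ((EuclideanSpace.proj 0 : EuclideanSpace ℝ (Fin 2) →L[ℝ] ℝ).prod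
    (EuclideanSpace.proj 1 : EuclideanSpace ℝ (Fin 2) →L[ℝ] ℝ))

lemma aux_lower {Ω : Type*} [MeasurableSpace Ω] (P : Measure Ω) [IsProbabilityMeasure P]
    (X : ℕ → Ω → ℝ) (hXmeas : ∀ i, Measurable (X i))
    (hgauss : ∀ (k : ℕ) (s : Fin k → ℕ) (a : Fin k → ℝ), ∃ v : NNReal,
      P.map (fun ω => ∑ i, a i * X (s i) ω) = gaussianReal 0 v)
    (φ : ℕ → ℝ) (hφ0 : φ 0 = 1)
    (hcov : ∀ i j, ∫ ω, X i ω * X j ω ∂P = φ (max i j - min i j))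
    (hφmono : Antitone φ) (hφ1 : φ 1 < 1 / 2) (hφnn : ∀ k, 0 ≤ φ k)
    (n : ℕ) (L : ℕ) (hL : 1 ≤ L) (u p q R : ℝ) (hu : 1 ≤ u)
    (hp : p = (gaussianReal 0 1).real (Set.Ioc u (u + 1)))
    (hq : q = rexp (-2 * u ^ 2 / 3))
    (hR : R = (√(1 - φ L ^ 2))⁻¹ * rexp (4 * φ L * u ^ 2)) :
    P.real {ω | ∀ i ∈ Set.Icc 1 n, X i ω ≤ u} * (n * p) ^ 2 ≤
      n * p + n * ((2 * L + 1) * q) + (R - 1) * (n * p) ^ 2 := by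
  have hlaw := aux_law1 P X hXmeas hgauss φ hφ0 hcov
  set A : ℕ → Set Ω := fun i => X i ⁻¹' (Set.Ioc u (u + 1)) with hAdef
  have hA : ∀ i, MeasurableSet (A i) := fun i => hXmeas i measurableSet_Ioc
  have hAp : ∀ i, P.real (A i) = p := by
    intro i
    rw [hp, ← hlaw i, map_measureReal_apply (hXmeas i) measurableSet_Ioc]
  have hp0 : 0 ≤ p := hp ▸ measureReal_nonneg
  have hq0 : 0 ≤ q := hq ▸ (Real.exp_pos _).le
  have hφL : φ L < 1 / 2 := (hφmono hL).trans_lt hφ1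
  have hR0 : 0 ≤ R := by rw [hR]; positivity
  have hpair : ∀ i j, P.real (A i ∩ A j) ≤
      (if i = j then p else 0) + (if j ∈ Finset.Icc (i - L) (i + L) then q else 0) + R * p ^ 2 := by
    intro i j
    by_cases hij : i = j
    · subst hij
      rw [Set.inter_self, hAp, if_pos rfl]
      have : 0 ≤ (if i ∈ Finset.Icc (i - L) (i + L) then q else 0) := by split_ifs <;> simp [hq0]
      nlinarith [mul_nonneg hR0 (sq_nonneg p)]
    · rw [if_neg hij, zero_add]
      have hd1 : 1 ≤ max i j - min i j := by omega
      have hrho : φ (max i j - min i j) ≤ 1 / 2 := ((hφmono hd1).trans_lt hφ1).le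
      by_cases hn : j ∈ Finset.Icc (i - L) (i + L)
      · rw [if_pos hn]
        have := aux_pair_near P (X i) (X j) (hXmeas i) (hXmeas j)
          (aux_pairlaw P X hXmeas hgauss i j) (hlaw i) (hlaw j) _ u (hcov i j) hrho (by linarith)
        rw [← hq] at this
        nlinarith [mul_nonneg hR0 (sq_nonneg p)]
      · rw [if_neg hn, zero_add]
        have hd : L ≤ max i j - min i j := by
          simp only [Finset.mem_Icc, not_and_or] at hn
          omega
        have hle := hφmono hd
        have h0 := hφnn (max i j - min i j)
        have := aux_pair_far P (X i) (X j) (hXmeas i) (hXmeas j)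
          (aux_pairlaw P X hXmeas hgauss i j) (hlaw i) (hlaw j) _ u (hcov i j) h0
          (by linarith) hu
        rw [← hp] at this
        refine this.trans ?_
        rw [hR]
        have : 0 < 1 - φ L ^ 2 := by nlinarith [hφnn L]
        gcongr
  have hsm := aux_second_moment P (Finset.Icc 1 n) A hA
  simp only [hAp, Finset.sum_const, Nat.card_Icc, Nat.add_sub_cancel, nsmul_eq_mul] at hsm
  have hsub : P.real {ω | ∀ i ∈ Set.Icc 1 n, X i ω ≤ u} ≤
      P.real {ω | ∀ i ∈ Finset.Icc 1 n, ω ∉ A i} := by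
    refine measureReal_mono ?_
    intro ω hω i hi hmem
    have h1 := hω i (by simpa using hi)
    have h2 : u < X i ω := hmem.1
    linarith
  have hdouble : ∑ i ∈ Finset.Icc 1 n, ∑ j ∈ Finset.Icc 1 n, P.real (A i ∩ A j) ≤
      n * p + n * ((2 * L + 1) * q) + n * (n * (R * p ^ 2)) := by
    have hrow : ∀ i ∈ Finset.Icc 1 n, ∑ j ∈ Finset.Icc 1 n, P.real (A i ∩ A j) ≤
        p + (2 * L + 1) * q + n * (R * p ^ 2) := by
      intro i hi
      refine (Finset.sum_le_sum fun j _ => hpair i j).trans ?_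
      rw [Finset.sum_add_distrib, Finset.sum_add_distrib, Finset.sum_ite_eq, if_pos hi]
      have h2 : ∑ j ∈ Finset.Icc 1 n, (if j ∈ Finset.Icc (i - L) (i + L) then q else 0) ≤
          (2 * L + 1) * q := by
        rw [← Finset.sum_filter, Finset.sum_const, nsmul_eq_mul]
        gcongr
        have : (Finset.filter (fun j => j ∈ Finset.Icc (i - L) (i + L)) (Finset.Icc 1 n)).card ≤
            2 * L + 1 := by
          calc _ ≤ (Finset.Icc (i - L) (i + L)).card := by
                refine Finset.card_le_card fun j hj => (Finset.mem_filter.1 hj).2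
            _ ≤ _ := by rw [Nat.card_Icc]; omega
        exact_mod_cast this
      have h3 : ∑ j ∈ Finset.Icc 1 n, R * p ^ 2 = n * (R * p ^ 2) := by simp
      rw [h3]
      linarith
    refine (Finset.sum_le_sum hrow).trans ?_
    rw [Finset.sum_const, Nat.card_Icc, Nat.add_sub_cancel, nsmul_eq_mul]
    linarith
  calc _ ≤ P.real {ω | ∀ i ∈ Finset.Icc 1 n, ω ∉ A i} * (n * p) ^ 2 := by gcongr
    _ ≤ _ := hsm
    _ ≤ _ := by nlinarith [hdouble]

lemma aux_upper {Ω : Type*} [MeasurableSpace Ω] (P : Measure Ω) [IsProbabilityMeasure P]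
    (X : ℕ → Ω → ℝ) (hXmeas : ∀ i, Measurable (X i))
    (hlaw : ∀ i, P.map (X i) = gaussianReal 0 1) (n : ℕ) (v : ℝ) (hv : 0 < v) :
    P.real {ω | ∀ i ∈ Set.Icc 1 n, X i ω ≤ v}ᶜ ≤ n * (rexp (-v ^ 2 / 2) / (v * √(2 * π))) := by
  have : {ω | ∀ i ∈ Set.Icc 1 n, X i ω ≤ v}ᶜ = ⋃ i ∈ Finset.Icc 1 n, X i ⁻¹' Set.Ioi v := by
    ext ω; simp [and_assoc]
  rw [this]
  refine (measureReal_biUnion_finset_le _ _).trans ?_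
  have : ∀ i, P.real (X i ⁻¹' Set.Ioi v) ≤ rexp (-v ^ 2 / 2) / (v * √(2 * π)) := by
    intro i
    rw [← map_measureReal_apply (hXmeas i) measurableSet_Ioi, hlaw]
    exact aux_tail_upper v hv
  refine (Finset.sum_le_sum fun i _ => this i).trans ?_
  simp

lemma aux_geom (G : ℕ → ℝ) (h0 : ∀ k, 0 ≤ G k) (hanti : ∀ k, G (k + 1) ≤ G k)
    (hG0 : 1 / 2 ≤ G 0) (hG1b : G 0 ≤ 1)
    (hG1 : G 1 ≤ 1 / 4) (hlc : ∀ k, G (k + 2) * G k ≤ G (k + 1) ^ 2) (k : ℕ) :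
    G k ≤ (1 / 2) ^ k := by
  have hstep : ∀ k, G (k + 1) ≤ G k / 2 := by
    intro k
    induction k with
    | zero => simp only [zero_add]; linarith
    | succ k ih =>
      have h1 := hlc k
      rcases (h0 k).eq_or_lt with h | h
      · have := hanti k
        have := hanti (k + 1)
        have := h0 (k + 1)
        linarith
      · have h3 : G (k + 2) * G k ≤ (G (k + 1) / 2) * G k := by
          have := h0 (k + 1)
          nlinarith
        exact le_of_mul_le_mul_right h3 h
  induction k with
  | zero => simpa using hG1b
  | succ k ih => rw [pow_succ]; linarith [hstep k]

lemma aux_expD (l c : ℝ) (hl : 0 < l) :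
    rexp ((Real.log l + Real.log (4 * π)) / 2 + c) = √(2 * l) * √(2 * π) * rexp c := by
  rw [Real.exp_add]
  congr 1
  rw [← Real.sqrt_mul (by positivity), ← Real.log_mul hl.ne' (by positivity), Real.exp_half,
    Real.exp_log (by positivity)]
  congr 1
  ring

lemma aux_det_upper (N l a b t D : ℝ) (hN : 0 < N) (hl : l = Real.log N) (hl16 : 16 ≤ l)
    (ha : a = √(2 * l)) (hD : D = (Real.log l + Real.log (4 * π)) / 2 + 0)
    (hD0 : 0 ≤ D) (hDl : D ≤ √l / 2) (hb : b = a - D / a) (ht : 0 ≤ t) :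
    0 < a ∧ 0 < b + t / a ∧
      N * (rexp (-(b + t / a) ^ 2 / 2) / ((b + t / a) * √(2 * π))) ≤ 2 * rexp (-t / 2) := by
  have hl0 : 0 < l := by linarith
  have ha2 : a ^ 2 = 2 * l := by rw [ha, Real.sq_sqrt (by linarith)]
  have ha0 : 0 < a := by rw [ha]; positivity
  have hs2 : √l ^ 2 = l := Real.sq_sqrt hl0.le
  have hs4 : 4 ≤ √l := Real.le_sqrt_of_sq_le (by linarith)
  have hba : b * a = 2 * l - D := by rw [hb]; field_simp; linarith
  have hb2 : a / 2 ≤ b := by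
    rw [hb]
    have : D / a ≤ a / 2 := by
      rw [div_le_iff₀ ha0]; nlinarith
    linarith
  have hta : 0 ≤ t / a := by positivity
  have hv : a / 2 ≤ b + t / a := by linarith
  have hvp : 0 < b + t / a := by linarith
  refine ⟨ha0, hvp, ?_⟩
  have hvsq : 2 * l - 2 * D + t ≤ (b + t / a) ^ 2 := by
    have h1 : b ^ 2 ≥ 2 * l - 2 * D := by
      have : b ^ 2 = a ^ 2 - 2 * D + (D / a) ^ 2 := by rw [hb]; field_simp; ring
      rw [this, ha2]; nlinarith [sq_nonneg (D / a)]
    have h2 : 2 * b * (t / a) ≥ t := by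
      have : t = a * (t / a) := by field_simp
      nlinarith
    nlinarith [sq_nonneg (t / a)]
  have hNexp : N = rexp l := by rw [hl, Real.exp_log hN]
  have hE : rexp D = a * √(2 * π) := by
    rw [hD, aux_expD l 0 hl0, ha, Real.exp_zero, mul_one]
  have hexp : N * rexp (-(b + t / a) ^ 2 / 2) ≤ a * √(2 * π) * rexp (-t / 2) := by
    rw [← hE, hNexp, ← Real.exp_add, ← Real.exp_add]
    apply Real.exp_le_exp.2
    linarith
  rw [← mul_div_assoc, div_le_iff₀ (by positivity)]
  refine hexp.trans ?_
  have : 0 < √(2 * π) * rexp (-t / 2) := by positivity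
  nlinarith

lemma aux_det_lower (N l a u D p : ℝ) (hN : 0 < N) (hl : l = Real.log N) (hl16 : 16 ≤ l)
    (ha : a = √(2 * l)) (hD : D = (Real.log l + Real.log (4 * π)) / 2 + 6)
    (hD0 : 0 ≤ D) (hDl : D ≤ √l / 2) (hu : u = a - D / a)
    (hp : 1 ≤ u → rexp (-u ^ 2 / 2 - 3 / 2) / (u * √(2 * π)) ≤ p) :
    1 ≤ u ∧ u ^ 2 ≤ 2 * l ∧ 12 ≤ N * p ∧ rexp (l / 6) * N * rexp (-2 * u ^ 2 / 3) ≤ 1 := by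
  have hl0 : 0 < l := by linarith
  have ha2 : a ^ 2 = 2 * l := by rw [ha, Real.sq_sqrt (by linarith)]
  have ha0 : 0 < a := by rw [ha]; positivity
  have hs2 : √l ^ 2 = l := Real.sq_sqrt hl0.le
  have hs4 : 4 ≤ √l := Real.le_sqrt_of_sq_le (by linarith)
  have hDa0 : 0 ≤ D / a := by positivity
  have hDa : D / a ≤ a / 2 := by
      rw [div_le_iff₀ ha0]; nlinarith
  have ha4 : 4 ≤ a := by nlinarith
  have hu1 : 1 ≤ u := by rw [hu]; linarith
  have hua : u ≤ a := by rw [hu]; linarith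
  have hDa1 : (D / a) ^ 2 ≤ 1 := by
    rw [div_pow, ha2, div_le_one (by positivity)]; nlinarith
  have husq : u ^ 2 = 2 * l - 2 * D + (D / a) ^ 2 := by rw [← ha2, hu]; field_simp; ring
  have hNexp : N = rexp l := by rw [hl, Real.exp_log hN]
  have hE : rexp D = a * √(2 * π) * rexp 6 := by
    rw [hD, aux_expD l 6 hl0, ha]
  refine ⟨hu1, by nlinarith, ?_, ?_⟩
  · have h1 := hp hu1
    have h2 : rexp D * rexp (-2) ≤ N * rexp (-u ^ 2 / 2 - 3 / 2) := by
      rw [hNexp, ← Real.exp_add, ← Real.exp_add]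
      apply Real.exp_le_exp.2
      linarith
    have h3 : (12 : ℝ) ≤ rexp 6 * rexp (-2) := by
      rw [← Real.exp_add, show (6 : ℝ) + -2 = (4 : ℕ) * 1 by norm_num, Real.exp_nat_mul]
      have := Real.add_one_le_exp (1 : ℝ)
      calc (12 : ℝ) ≤ 2 ^ 4 := by norm_num
        _ ≤ _ := by gcongr; linarith
    have h4 : 12 ≤ N * (rexp (-u ^ 2 / 2 - 3 / 2) / (u * √(2 * π))) := by
      rw [← mul_div_assoc, le_div_iff₀ (by positivity)]
      refine le_trans ?_ h2
      rw [hE]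
      calc 12 * (u * √(2 * π)) ≤ (rexp 6 * rexp (-2)) * (a * √(2 * π)) := by gcongr
        _ = _ := by ring
    refine h4.trans ?_
    gcongr
  · rw [hNexp, ← Real.exp_add, ← Real.exp_add, Real.exp_le_one_iff]
    nlinarith [sq_nonneg (D / a)]

lemma aux_evD : ∀ᶠ n : ℕ in atTop, 16 ≤ Real.log n ∧
    (Real.log (Real.log n) + Real.log (4 * π)) / 2 + 6 ≤ √(Real.log n) / 2 := by
  have hlog : Tendsto (fun n : ℕ => Real.log n) atTop atTop :=
    Real.tendsto_log_atTop.comp tendsto_natCast_atTop_atTop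
  have h1 : ∀ᶠ l : ℝ in atTop, 16 ≤ l ∧
      (Real.log l + Real.log (4 * π)) / 2 + 6 ≤ √l / 2 := by
    have hlo := isLittleO_log_rpow_atTop (r := 1 / 2) (by norm_num)
    have hb := hlo.bound (c := 1 / 2) (by norm_num)
    have hsq : Tendsto (fun l : ℝ => √l) atTop atTop := Real.tendsto_sqrt_atTop
    filter_upwards [hb, eventually_ge_atTop 16,
      hsq.eventually_ge_atTop (2 * (Real.log (4 * π) + 12))] with l h1 h2 h3
    refine ⟨h2, ?_⟩
    rw [← Real.sqrt_eq_rpow, Real.norm_eq_abs, Real.norm_eq_abs, abs_of_nonneg (Real.sqrt_nonneg l)] at h1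
    have := le_abs_self (Real.log l)
    linarith
  exact hlog.eventually h1

lemma aux_evR (φ : ℕ → ℝ) (hφnn : ∀ k, 0 ≤ φ k) 
    (hφlog : Tendsto (fun n : ℕ => φ n * Real.log n) atTop (nhds 0)) :
    ∀ᶠ L : ℕ in atTop, (√(1 - φ L ^ 2))⁻¹ * rexp (48 * (φ L * Real.log L)) ≤ 13 / 12 := by
  have h0 : Tendsto φ atTop (nhds 0) := by
    refine squeeze_zero' (Eventually.of_forall hφnn) ?_ hφlog
    have hlog : Tendsto (fun n : ℕ => Real.log n) atTop atTop :=
      Real.tendsto_log_atTop.comp tendsto_natCast_atTop_atTop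
    filter_upwards [hlog.eventually_ge_atTop 1] with n hn
    nlinarith [hφnn n]
  have h1 : Tendsto (fun L : ℕ => (√(1 - φ L ^ 2))⁻¹ * rexp (48 * (φ L * Real.log L))) atTop
      (nhds ((√(1 - 0 ^ 2))⁻¹ * rexp (48 * 0))) := by
    refine Tendsto.mul (Tendsto.inv₀ ?_ (by simp)) ?_
    · exact (Real.continuous_sqrt.tendsto _).comp ((h0.pow 2).const_sub 1)
    · exact (Real.continuous_exp.tendsto _).comp (hφlog.const_mul 48)
  refine h1.eventually_le_const ?_
  norm_num

lemma aux_nonneg (φ : ℕ → ℝ) (hφmono : Antitone φ)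
    (hφlog : Tendsto (fun n : ℕ => φ n * Real.log n) atTop (nhds 0)) (k : ℕ) : 0 ≤ φ k := by
  by_contra hk
  push Not at hk
  have hlog : Tendsto (fun n : ℕ => Real.log n) atTop atTop :=
      Real.tendsto_log_atTop.comp tendsto_natCast_atTop_atTop
  have h1 : ∀ᶠ n in atTop, φ n * Real.log n ≤ φ k := by
    filter_upwards [hlog.eventually_ge_atTop 1, eventually_ge_atTop k] with n h1 h2
    have := hφmono h2
    nlinarith
  have := le_of_tendsto hφlog h1
  linarith

lemma aux_tailsum {Ω : Type*} [MeasurableSpace Ω] (P : Measure Ω) [IsProbabilityMeasure P]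
    (Y : Ω → ℝ) (hY : Measurable Y) (hY0 : ∀ ω, 0 ≤ Y ω)
    (h : ∀ k : ℕ, P.real {ω | 10 * (k : ℝ) < Y ω} ≤ 3 * (1 / 2) ^ k) : ∫ ω, Y ω ∂P ≤ 60 := by
  have hms : ∀ k : ℕ, MeasurableSet {ω | 10 * (k : ℝ) < Y ω} := fun k =>
    measurableSet_lt measurable_const hY
  rw [integral_eq_lintegral_of_nonneg_ae (Eventually.of_forall hY0) hY.aestronglyMeasurable]
  refine ENNReal.toReal_le_of_le_ofReal (by norm_num) ?_
  have hpt : ∀ ω, ENNReal.ofReal (Y ω) ≤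
      ∑' k : ℕ, Set.indicator {ω | 10 * (k : ℝ) < Y ω} (fun _ => (10 : ℝ≥0∞)) ω := by
    intro ω
    set m := ⌈Y ω / 10⌉₊
    have h1 : Y ω ≤ 10 * m := by
      have := Nat.le_ceil (Y ω / 10)
      linarith
    calc ENNReal.ofReal (Y ω) ≤ ENNReal.ofReal (10 * m) := ENNReal.ofReal_le_ofReal h1
      _ = ∑ k ∈ Finset.range m, (10 : ℝ≥0∞) := by
        rw [Finset.sum_const, Finset.card_range, nsmul_eq_mul, ENNReal.ofReal_mul (by norm_num),
          ENNReal.ofReal_natCast, mul_comm]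
        norm_num
      _ = ∑ k ∈ Finset.range m,
          Set.indicator {ω | 10 * (k : ℝ) < Y ω} (fun _ => (10 : ℝ≥0∞)) ω := by
        refine Finset.sum_congr rfl fun k hk => ?_
        rw [Set.indicator_of_mem]
        have := Nat.lt_ceil.1 (Finset.mem_range.1 hk)
        show 10 * (k : ℝ) < Y ω
        linarith
      _ ≤ _ := ENNReal.sum_le_tsum _
  calc ∫⁻ ω, ENNReal.ofReal (Y ω) ∂P ≤ ∫⁻ ω, ∑' k : ℕ,
        Set.indicator {ω | 10 * (k : ℝ) < Y ω} (fun _ => (10 : ℝ≥0∞)) ω ∂P := lintegral_mono hpt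
    _ = ∑' k : ℕ, 10 * P {ω | 10 * (k : ℝ) < Y ω} := by
      rw [lintegral_tsum fun k => (measurable_const.indicator (hms k)).aemeasurable]
      refine tsum_congr fun k => ?_
      rw [lintegral_indicator_const (hms k)]
    _ ≤ ∑' k : ℕ, ENNReal.ofReal (30 * (1 / 2) ^ k) := by
      refine ENNReal.tsum_le_tsum fun k => ?_
      rw [← ofReal_measureReal, show (10 : ℝ≥0∞) = ENNReal.ofReal 10 by norm_num,
        ← ENNReal.ofReal_mul (by norm_num)]
      apply ENNReal.ofReal_le_ofReal
      linarith [h k]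
    _ = ENNReal.ofReal 60 := by
      rw [← ENNReal.ofReal_tsum_of_nonneg (fun k => by positivity)
        (summable_geometric_two.mul_left 30), tsum_mul_left, tsum_geometric_two]
      norm_num

lemma aux_main {Ω : Type*} [MeasurableSpace Ω] (P : Measure Ω) [IsProbabilityMeasure P]
    (X : ℕ → Ω → ℝ) (hXmeas : ∀ i, Measurable (X i))
    (hgauss : ∀ (k : ℕ) (s : Fin k → ℕ) (a : Fin k → ℝ), ∃ v : NNReal,
      P.map (fun ω => ∑ i, a i * X (s i) ω) = gaussianReal 0 v)
    (φ : ℕ → ℝ) (hφ0 : φ 0 = 1)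
    (hcov : ∀ i j, ∫ ω, X i ω * X j ω ∂P = φ (max i j - min i j))
    (hφmono : Antitone φ) (hφ1 : φ 1 < 1 / 2)
    (hφlog : Tendsto (fun n : ℕ => φ n * Real.log n) atTop (nhds 0)) :
    ∀ᶠ n : ℕ in atTop, ∀ a b : ℝ, a = √(2 * Real.log n) →
      b = a - (1 / 2) * a⁻¹ * (Real.log (Real.log n) + Real.log (4 * π)) →
      0 < a ∧
      (∀ t, 0 ≤ t → P.real {ω | ∀ i ∈ Set.Icc 1 n, X i ω ≤ b + t / a}ᶜ ≤ 2 * rexp (-t / 2)) ∧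
      P.real {ω | ∀ i ∈ Set.Icc 1 n, X i ω ≤ b - 6 / a} ≤ 1 / 4 := by
  have hφnn := aux_nonneg φ hφmono hφlog
  have hlaw := aux_law1 P X hXmeas hgauss φ hφ0 hcov
  have hLt : Tendsto (fun n : ℕ => ⌈rexp (Real.log n / 6)⌉₊) atTop atTop := by
    refine tendsto_nat_ceil_atTop.comp (Real.tendsto_exp_atTop.comp ?_)
    exact (Real.tendsto_log_atTop.comp tendsto_natCast_atTop_atTop).atTop_div_const (by norm_num)
  filter_upwards [aux_evD, hLt.eventually (aux_evR φ hφnn hφlog), eventually_ge_atTop 3]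
    with n hD hR hn a b ha hb
  obtain ⟨hl16, hDl⟩ := hD
  have hN : (0 : ℝ) < n := by positivity
  have hlog1 : 0 ≤ Real.log (Real.log n) := Real.log_nonneg (by linarith)
  have hlog2 : 0 ≤ Real.log (4 * π) := Real.log_nonneg (by linarith [Real.pi_gt_three])
  have hU := fun t ht => aux_det_upper n (Real.log n) a b t _ hN rfl hl16 ha rfl
    (by linarith) (by linarith) (by rw [hb]; ring) ht
  have ha0 : 0 < a := (hU 0 le_rfl).1
  refine ⟨ha0, fun t ht => ?_, ?_⟩
  · exact (aux_upper P X hXmeas hlaw n _ (hU t ht).2.1).trans (hU t ht).2.2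
  · obtain ⟨hu1, husq, hnp, hq⟩ := aux_det_lower n (Real.log n) a (b - 6 / a) _ _ hN rfl hl16 ha rfl
      (by linarith) (by linarith) (by rw [hb]; ring) (aux_tail_lower (b - 6 / a))
    set u := b - 6 / a
    set L := ⌈rexp (Real.log n / 6)⌉₊ with hLdef
    have hx1 : 1 ≤ rexp (Real.log n / 6) := Real.one_le_exp (by linarith)
    have hL1 : 1 ≤ L := Nat.one_le_ceil_iff.2 (by positivity)
    have hLle : (L : ℝ) < rexp (Real.log n / 6) + 1 := Nat.ceil_lt_add_one (by positivity)
    have hLge : rexp (Real.log n / 6) ≤ L := Nat.le_ceil _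
    have hlogL : Real.log n / 6 ≤ Real.log L := (Real.le_log_iff_exp_le (by positivity)).2 hLge
    have hlow := aux_lower P X hXmeas hgauss φ hφ0 hcov hφmono hφ1 hφnn n L hL1 u _ _ _ hu1 rfl rfl rfl
    set p := (gaussianReal 0 1).real (Set.Ioc u (u + 1))
    have hR2 : (√(1 - φ L ^ 2))⁻¹ * rexp (4 * φ L * u ^ 2) ≤ 13 / 12 := by
      refine le_trans ?_ hR
      refine mul_le_mul_of_nonneg_left (Real.exp_le_exp.2 ?_) (by positivity)
      have : u ^ 2 ≤ 12 * Real.log L := by linarith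
      nlinarith [hφnn L]
    have hq2 : n * ((2 * L + 1) * rexp (-2 * u ^ 2 / 3)) ≤ 5 := by
      have hq0 : 0 < n * rexp (-2 * u ^ 2 / 3) := by positivity
      nlinarith
    have hnp2 : 144 ≤ (n * p) ^ 2 := by nlinarith
    have hpos : 0 < (n * p) ^ 2 := by linarith
    refine le_of_mul_le_mul_right (hlow.trans ?_) hpos
    have h1 : n * p ≤ (n * p) ^ 2 / 12 := by nlinarith
    nlinarith

lemma aux_final {Ω : Type*} [MeasurableSpace Ω] (P : Measure Ω) [IsProbabilityMeasure P]
    (X : ℕ → Ω → ℝ) (hXmeas : ∀ i, Measurable (X i))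
    (hgauss : ∀ (k : ℕ) (s : Fin k → ℕ) (a : Fin k → ℝ), ∃ v : NNReal,
      P.map (fun ω => ∑ i, a i * X (s i) ω) = gaussianReal 0 v) (n : ℕ) (hn : 1 ≤ n) (a b : ℝ)
    (ha : 0 < a)
    (hU : ∀ t, 0 ≤ t → P.real {ω | ∀ i ∈ Set.Icc 1 n, X i ω ≤ b + t / a}ᶜ ≤ 2 * rexp (-t / 2))
    (hLo : P.real {ω | ∀ i ∈ Set.Icc 1 n, X i ω ≤ b - 6 / a} ≤ 1 / 4) :
    ∫ ω, a * |(⨆ i : Set.Icc 1 n, X i ω) - b| ∂P ≤ 60 := by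
  have : Nonempty (Set.Icc 1 n) := ⟨⟨1, by simp [hn]⟩⟩
  have hM : Measurable fun ω => ⨆ i : Set.Icc 1 n, X i ω :=
    Measurable.iSup fun i => hXmeas i
  have hiff : ∀ ω s, (⨆ i : Set.Icc 1 n, X i ω) ≤ s ↔ ∀ i ∈ Set.Icc 1 n, X i ω ≤ s := by
    intro ω s
    rw [ciSup_le_iff (Set.finite_range _).bddAbove]
    exact ⟨fun h i hi => h ⟨i, hi⟩, fun h i => h i i.2⟩
  have hmeas : ∀ s : ℝ, MeasurableSet {ω | ∀ i ∈ Set.Icc 1 n, X i ω ≤ s} := by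
    intro s
    have : {ω | ∀ i ∈ Set.Icc 1 n, X i ω ≤ s} = {ω | (⨆ i : Set.Icc 1 n, X i ω) ≤ s} := by
      ext ω; exact (hiff ω s).symm
    rw [this]
    exact measurableSet_le hM measurable_const
  have hlc : ∀ s r : ℝ, P.real {ω | ∀ i ∈ Set.Icc 1 n, X i ω ≤ s} *
      P.real {ω | ∀ i ∈ Set.Icc 1 n, X i ω ≤ r} ≤
      P.real {ω | ∀ i ∈ Set.Icc 1 n, X i ω ≤ (s + r) / 2} ^ 2 := by
    intro s r
    have h := aux_logconcave P X hXmeas hgauss n s r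
    have := ENNReal.toReal_mono (by finiteness) h
    rwa [ENNReal.toReal_mul, ENNReal.toReal_pow] at this
  have hexp5 : rexp (-5) ≤ 1 / 2 := by
    rw [Real.exp_neg, one_div]
    have := Real.add_one_le_exp (5 : ℝ)
    gcongr
    linarith
  have hexp2 : rexp (-4 / 2) ≤ 1 / 4 := by
    rw [show (-4 / 2 : ℝ) = -(1 + 1) by norm_num, Real.exp_neg, Real.exp_add, one_div]
    have := Real.add_one_le_exp (1 : ℝ)
    gcongr
    nlinarith
  set G : ℕ → ℝ := fun k => P.real {ω | ∀ i ∈ Set.Icc 1 n, X i ω ≤ b + (4 - 10 * k) / a} with hG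
  have hgeom : ∀ k, G k ≤ (1 / 2) ^ k := by
    refine aux_geom G (fun k => measureReal_nonneg) ?_ ?_ measureReal_le_one ?_ ?_
    · intro k
      refine measureReal_mono fun ω hω i hi => (hω i hi).trans ?_
      push_cast
      gcongr
      linarith
    · have h := hU 4 (by norm_num)
      rw [probReal_compl_eq_one_sub (hmeas _)] at h
      simp only [hG, Nat.cast_zero, mul_zero, sub_zero]
      linarith
    · have : b + (4 - 10 * ((1 : ℕ) : ℝ)) / a = b - 6 / a := by push_cast; ring
      simp only [hG, this]
      exact hLo
    · intro k
      have h := hlc (b + (4 - 10 * ((k + 2 : ℕ) : ℝ)) / a) (b + (4 - 10 * (k : ℝ)) / a)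
      have e : (b + (4 - 10 * ((k + 2 : ℕ) : ℝ)) / a + (b + (4 - 10 * (k : ℝ)) / a)) / 2 =
          b + (4 - 10 * ((k + 1 : ℕ) : ℝ)) / a := by push_cast; ring
      rw [e] at h
      exact h
  refine aux_tailsum P _ (by fun_prop) (fun ω => by positivity) fun k => ?_
  have hsub : {ω | 10 * (k : ℝ) < a * |(⨆ i : Set.Icc 1 n, X i ω) - b|} ⊆
      {ω | ∀ i ∈ Set.Icc 1 n, X i ω ≤ b + (10 * k) / a}ᶜ ∪
      {ω | ∀ i ∈ Set.Icc 1 n, X i ω ≤ b + (4 - 10 * k) / a} := by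
    intro ω hω
    have hω' : 10 * (k : ℝ) < a * |(⨆ i : Set.Icc 1 n, X i ω) - b| := hω
    by_contra hcon
    simp only [Set.mem_union, not_or, Set.mem_compl_iff, not_not] at hcon
    obtain ⟨h1, h2⟩ := hcon
    have h1' := (hiff ω _).2 h1
    have h2' := mt (hiff ω _).1 h2
    push Not at h2'
    have h3 : |(⨆ i : Set.Icc 1 n, X i ω) - b| ≤ (10 * k) / a := by
      rw [abs_le]
      constructor
      · have : -(10 * k / a) ≤ (4 - 10 * k) / a := by
          rw [← neg_div]; gcongr; linarith
        linarith
      · linarith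
    rw [le_div_iff₀ ha] at h3
    linarith
  refine (measureReal_mono hsub).trans ((measureReal_union_le _ _).trans ?_)
  have h1 := hU (10 * k) (by positivity)
  have h2 : rexp (-(10 * k) / 2) ≤ (1 / 2) ^ k := by
    rw [show (-(10 * (k : ℝ)) / 2) = k * (-5) by ring, Real.exp_nat_mul]
    gcongr
  have := hgeom k
  simp only [hG] at this
  linarith


end Aux

/-- **Uniform integrability of the normalized maxima around the Gumbel centering**
(Tanguy, remark after Theorem 1.3). Let `(X_i)_{i ≥ 0}` be a centered stationary Gaussian
sequence with unit variances, covariance `Cov(X_i, X_j) = φ(|i − j|)` where `φ : ℕ → ℝ` is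
non-increasing, `φ(1) < 1/2` and `φ(n) log n → 0`. With `a_n = (2 log n)^{1/2}` and
`b_n = (2 log n)^{1/2} − (1/2)(2 log n)^{−1/2}(log log n + log 4π)`, one has
`sup_{n ≥ 3} E[a_n |M_n − b_n|] < ∞`, where `M_n = max_{1 ≤ i ≤ n} X_i`. -/
theorem stationary_gaussian_uniform_integrability_gumbel_centering
    {Ω : Type*} [MeasurableSpace Ω] (P : Measure Ω) [IsProbabilityMeasure P]
    (X : ℕ → Ω → ℝ) (hXmeas : ∀ i, Measurable (X i))
    -- every finite subfamily is jointly centered Gaussian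
    (hgauss : ∀ (k : ℕ) (s : Fin k → ℕ) (a : Fin k → ℝ), ∃ v : NNReal,
      P.map (fun ω => ∑ i, a i * X (s i) ω) = gaussianReal 0 v)
    (φ : ℕ → ℝ) (hφ0 : φ 0 = 1)
    -- stationary covariance structure: `Cov(X_i, X_j) = φ(|i − j|)`
    (hcov : ∀ i j, ∫ ω, X i ω * X j ω ∂P = φ (max i j - min i j))
    (hφmono : Antitone φ) (hφ1 : φ 1 < 1 / 2)
    (hφlog : Tendsto (fun n : ℕ => φ n * Real.log n) atTop (nhds 0)) :
    ∃ Cbd : ℝ, ∀ n : ℕ, 3 ≤ n →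
      ∫ ω, Real.sqrt (2 * Real.log n) *
          |(⨆ i : Set.Icc 1 n, X i ω) -
            (Real.sqrt (2 * Real.log n) - (1 / 2) * (Real.sqrt (2 * Real.log n))⁻¹ *
              (Real.log (Real.log n) + Real.log (4 * Real.pi)))| ∂P ≤ Cbd := by
  have hev := aux_main P X hXmeas hgauss φ hφ0 hcov hφmono hφ1 hφlog
  obtain ⟨n0, hn0⟩ := eventually_atTop.1 hev
  set I : ℕ → ℝ := fun n => ∫ ω, Real.sqrt (2 * Real.log n) *
          |(⨆ i : Set.Icc 1 n, X i ω) -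
            (Real.sqrt (2 * Real.log n) - (1 / 2) * (Real.sqrt (2 * Real.log n))⁻¹ *
              (Real.log (Real.log n) + Real.log (4 * Real.pi)))| ∂P with hI
  refine ⟨60 + ∑ m ∈ Finset.range n0, |I m|, fun n hn => ?_⟩
  have hsum : 0 ≤ ∑ m ∈ Finset.range n0, |I m| := Finset.sum_nonneg fun _ _ => abs_nonneg _
  by_cases h : n0 ≤ n
  · obtain ⟨h1, h2, h3⟩ := hn0 n h _ _ rfl rfl
    have := aux_final P X hXmeas hgauss n (by omega) _ _ h1 h2 h3
    linarith
  · have h1 : |I n| ≤ ∑ m ∈ Finset.range n0, |I m| :=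
      Finset.single_le_sum (f := fun m => |I m|) (fun _ _ => abs_nonneg _)
        (Finset.mem_range.2 (by omega))
    have h2 := le_abs_self (I n)
    change I n ≤ _
    linarith
end
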